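/- Let λ^{(1)},…,λ^{(k)} be gl_n-highest weights. The Y(gl_n)-module L(λ^{(1)})⊗L(λ^{(2)})⊗⋯⊗L(λ^{(k)}) (all evaluation modules evaluated at 0) is irreducible if and only if for every pair of indices 1 ≤ p < q ≤ k the Y(gl_n)-module L(λ^{(p)})⊗L(λ^{(q)}) is irreducible. -/

import Mathlib

open scoped TensorProduct

/-- An `n`-tuple of complex numbers is a `gl_n`-highest weight if the consecutive
differences `λ_i - λ_{i+1}` are non-negative integers. -/
def IsGLHighestWeight (n : ℕ) (lam : Fin n → ℂ) : Prop :=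
  ∀ i : Fin n, ∀ h : (i : ℕ) + 1 < n, ∃ N : ℕ, lam i - lam ⟨(i : ℕ) + 1, h⟩ = N

/-- A realization of the irreducible finite-dimensional `gl_n`-module `L(λ)`
with highest weight `lam`, given by the action of the matrix units `E i j`. -/
structure GLRep (n : ℕ) (lam : Fin n → ℂ) where
  V : Type
  [instAddCommGroup : AddCommGroup V]
  [instModule : Module ℂ V]
  [instFiniteDimensional : FiniteDimensional ℂ V]
  E : Fin n → Fin n → (V →ₗ[ℂ] V)
  commRel : ∀ i j k l : Fin n,
    E i j ∘ₗ E k l - E k l ∘ₗ E i j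
      = (if j = k then E i l else 0) - (if l = i then E k j else 0)
  hv : V
  hv_ne : hv ≠ 0
  hv_upper : ∀ i j : Fin n, i < j → E i j hv = 0
  hv_diag : ∀ i : Fin n, E i i hv = lam i • hv
  irreducible : ∀ U : Submodule ℂ V,
    (∀ i j : Fin n, ∀ v ∈ U, E i j v ∈ U) → U = ⊥ ∨ U = ⊤

attribute [instance] GLRep.instAddCommGroup GLRep.instModule GLRep.instFiniteDimensional

/-- The action of the Yangian generator `t_{ij}^{(1)}` on `L(λ) ⊗ L(μ)`
(both evaluation modules evaluated at `0`). -/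
noncomputable def t1 {n : ℕ} {lam mu : Fin n → ℂ} (A : GLRep n lam) (B : GLRep n mu)
    (i j : Fin n) : A.V ⊗[ℂ] B.V →ₗ[ℂ] A.V ⊗[ℂ] B.V :=
  TensorProduct.map (A.E i j) LinearMap.id + TensorProduct.map LinearMap.id (B.E i j)

/-- The action of the Yangian generator `t_{ij}^{(2)}` on `L(λ) ⊗ L(μ)`. -/
noncomputable def t2 {n : ℕ} {lam mu : Fin n → ℂ} (A : GLRep n lam) (B : GLRep n mu)
    (i j : Fin n) : A.V ⊗[ℂ] B.V →ₗ[ℂ] A.V ⊗[ℂ] B.V :=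
  ∑ a : Fin n, TensorProduct.map (A.E i a) (B.E a j)

/-- Irreducibility of `L(λ) ⊗ L(μ)` as a module over the Yangian `Y(gl_n)`:
the only subspaces invariant under all the operators `t1` and `t2`
(the generators `t_{ij}^{(r)}` with `r ≥ 3` acting as zero) are `⊥` and `⊤`. -/
def YangianIrred2 {n : ℕ} {lam mu : Fin n → ℂ} (A : GLRep n lam) (B : GLRep n mu) : Prop :=
  ∀ U : Submodule ℂ (A.V ⊗[ℂ] B.V),
    (∀ i j : Fin n, ∀ v ∈ U, t1 A B i j v ∈ U) →
    (∀ i j : Fin n, ∀ v ∈ U, t2 A B i j v ∈ U) →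
    U = ⊥ ∨ U = ⊤

attribute [local instance] Classical.propDecidable

/-- The action of the Yangian generator `t_{ij}^{(r)}` on the tensor product
`L(λ^{(1)}) ⊗ ⋯ ⊗ L(λ^{(k)})` of evaluation modules (all evaluated at `0`):
the sum over `1 ≤ p_1 < ⋯ < p_r ≤ k` and over all sequences
`i = a_0, a_1, …, a_r = j` of the operator acting by `E_{a_{s−1} a_s}` in the
`p_s`-th tensor factor and by the identity in the remaining factors
(the empty sum, hence `0`, when `r > k`). -/
noncomputable def tMulti {k n : ℕ} {lam : Fin k → Fin n → ℂ}
    (M : ∀ p : Fin k, GLRep n (lam p)) (r : ℕ) (i j : Fin n) :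
    (⨂[ℂ] p : Fin k, (M p).V) →ₗ[ℂ] ⨂[ℂ] p : Fin k, (M p).V :=
  ∑ p : {p : Fin r → Fin k // StrictMono p},
    ∑ a : {g : Fin (r + 1) → Fin n // g 0 = i ∧ g (Fin.last r) = j},
      PiTensorProduct.map fun q : Fin k =>
        if h : ∃ s : Fin r, p.1 s = q then
          (M q).E (a.1 h.choose.castSucc) (a.1 h.choose.succ)
        else LinearMap.id

/-- Irreducibility of `L(λ^{(1)}) ⊗ ⋯ ⊗ L(λ^{(k)})` as a `Y(gl_n)`-module:
the only subspaces invariant under the action of all generators `t_{ij}^{(r)}`,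
`r ≥ 1`, are `⊥` and `⊤`. -/
def YangianIrredMulti {k n : ℕ} {lam : Fin k → Fin n → ℂ}
    (M : ∀ p : Fin k, GLRep n (lam p)) : Prop :=
  ∀ U : Submodule ℂ (⨂[ℂ] p : Fin k, (M p).V),
    (∀ r : ℕ, 1 ≤ r → ∀ i j : Fin n, ∀ v ∈ U, tMulti M r i j v ∈ U) →
    U = ⊥ ∨ U = ⊤

set_option linter.all false
namespace YG
open Filter

/-- Polynomial functions of one complex variable with values in a vector space. -/
def PolyFun {E : Type*} [AddCommGroup E] [Module ℂ E] (f : ℂ → E) : Prop :=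
  f ∈ Submodule.span ℂ {g : ℂ → E | ∃ (r : ℕ) (a : E), g = fun u => u ^ r • a}

section PF
variable {E F G : Type*} [AddCommGroup E] [Module ℂ E] [AddCommGroup F] [Module ℂ F]
  [AddCommGroup G] [Module ℂ G]

theorem PolyFun.mono (r : ℕ) (a : E) : PolyFun (fun u : ℂ => u ^ r • a) :=
  Submodule.subset_span ⟨r, a, rfl⟩

theorem PolyFun.const (a : E) : PolyFun (fun _ : ℂ => a) := by
  simpa using PolyFun.mono 0 a

theorem PolyFun.id_smul (a : E) : PolyFun (fun u : ℂ => u • a) := by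
  simpa using PolyFun.mono 1 a

theorem PolyFun.add {f g : ℂ → E} (hf : PolyFun f) (hg : PolyFun g) :
    PolyFun (fun u => f u + g u) := Submodule.add_mem _ hf hg

theorem PolyFun.sub {f g : ℂ → E} (hf : PolyFun f) (hg : PolyFun g) :
    PolyFun (fun u => f u - g u) := Submodule.sub_mem _ hf hg

theorem PolyFun.neg {f : ℂ → E} (hf : PolyFun f) :
    PolyFun (fun u => - f u) := Submodule.neg_mem _ hf

theorem PolyFun.csmul {f : ℂ → E} (c : ℂ) (hf : PolyFun f) :
    PolyFun (fun u => c • f u) := Submodule.smul_mem _ c hf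

theorem PolyFun.sum {ι : Type*} (s : Finset ι) {f : ι → ℂ → E} (hf : ∀ i ∈ s, PolyFun (f i)) :
    PolyFun (fun u => ∑ i ∈ s, f i u) := by
  have := Submodule.sum_mem _ hf
  unfold PolyFun
  convert this using 1
  ext u
  simp

theorem PolyFun.map (L : E →ₗ[ℂ] F) {f : ℂ → E} (hf : PolyFun f) :
    PolyFun (fun u => L (f u)) := by
  unfold PolyFun at hf
  induction hf using Submodule.span_induction with
  | mem x h => obtain ⟨r, a, rfl⟩ := h; simpa using PolyFun.mono r (L a)
  | zero => simpa using PolyFun.const (0 : F)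
  | add x y _ _ hx hy => simpa using hx.add hy
  | smul c x _ hx => simpa using hx.csmul c

theorem PolyFun.bilin (B : E →ₗ[ℂ] F →ₗ[ℂ] G) {f : ℂ → E} {g : ℂ → F} (hf : PolyFun f)
    (hg : PolyFun g) : PolyFun (fun u => B (f u) (g u)) := by
  unfold PolyFun at hf
  induction hf using Submodule.span_induction with
  | mem x h =>
    obtain ⟨r, a, rfl⟩ := h
    unfold PolyFun at hg
    induction hg using Submodule.span_induction with
    | mem y h =>
      obtain ⟨s, b, rfl⟩ := h
      have := PolyFun.mono (s + r) (B a b)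
      simpa [pow_add, mul_smul] using this
    | zero => simpa using PolyFun.const (0 : G)
    | add x y _ _ hx hy => simpa using hx.add hy
    | smul c x _ hx =>
      have := hx.csmul c
      convert this using 2
      simp [smul_comm c]
  | zero => simpa using PolyFun.const (0 : G)
  | add x y _ _ hx hy => simpa using hx.add hy
  | smul c x _ hx => simpa using hx.csmul c

theorem PolyFun.smul {p : ℂ → ℂ} {f : ℂ → E} (hp : PolyFun p) (hf : PolyFun f) :
    PolyFun (fun u => p u • f u) :=
  PolyFun.bilin (LinearMap.lsmul ℂ E) hp hf

theorem PolyFun.mul {A : Type*} [Ring A] [Algebra ℂ A] {f g : ℂ → A} (hf : PolyFun f)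
    (hg : PolyFun g) : PolyFun (fun u => f u * g u) :=
  PolyFun.bilin (LinearMap.mul ℂ A) hf hg

theorem PolyFun.id : PolyFun (fun u : ℂ => u) := by simpa using PolyFun.id_smul (1 : ℂ)

theorem PolyFun.pow {A : Type*} [Ring A] [Algebra ℂ A] {f : ℂ → A} (hf : PolyFun f) (r : ℕ) :
    PolyFun (fun u => f u ^ r) := by
  induction r with
  | zero => simpa using PolyFun.const (1 : A)
  | succ r ih => simpa [pow_succ] using ih.mul hf

theorem PolyFun.comp {f : ℂ → E} (hf : PolyFun f) {p : ℂ → ℂ} (hp : PolyFun p) :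
    PolyFun (fun u => f (p u)) := by
  unfold PolyFun at hf
  induction hf using Submodule.span_induction with
  | mem x h => obtain ⟨r, a, rfl⟩ := h; exact (hp.pow r).smul (PolyFun.const a)
  | zero => simpa using PolyFun.const (0 : E)
  | add x y _ _ hx hy => simpa using hx.add hy
  | smul c x _ hx => simpa using hx.csmul c

theorem PolyFun.exists_sum {f : ℂ → E} (hf : PolyFun f) :
    ∃ (N : ℕ) (a : ℕ → E), ∀ u, f u = ∑ r ∈ Finset.range N, u ^ r • a r := by
  have key : ∃ (N : ℕ) (a : ℕ → E), (∀ r, N ≤ r → a r = 0) ∧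
      ∀ M, N ≤ M → ∀ u, f u = ∑ r ∈ Finset.range M, u ^ r • a r := by
    unfold PolyFun at hf
    induction hf using Submodule.span_induction with
    | mem x h =>
      obtain ⟨r, a, rfl⟩ := h
      refine ⟨r + 1, fun s => if s = r then a else 0, fun s hs => if_neg (by omega), ?_⟩
      intro M hM u
      simp only [smul_ite, smul_zero, Finset.sum_ite_eq', Finset.mem_range]
      rw [if_pos (by omega)]
    | zero => exact ⟨0, fun _ => 0, by simp, by simp⟩
    | add x y _ _ hx hy =>
      obtain ⟨N, a, h1, h2⟩ := hx
      obtain ⟨N', a', h1', h2'⟩ := hy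
      refine ⟨max N N', fun r => a r + a' r, ?_, ?_⟩
      · intro r hr
        beta_reduce
        rw [h1 r (le_trans (le_max_left _ _) hr), h1' r (le_trans (le_max_right _ _) hr), add_zero]
      · intro M hM u
        simp only [Pi.add_apply, smul_add, Finset.sum_add_distrib]
        rw [h2 M (le_trans (le_max_left _ _) hM) u, h2' M (le_trans (le_max_right _ _) hM) u]
    | smul c x _ hx =>
      obtain ⟨N, a, h1, h2⟩ := hx
      refine ⟨N, fun r => c • a r, fun r hr => by beta_reduce; rw [h1 r hr, smul_zero], ?_⟩
      intro M hM u
      rw [Pi.smul_apply, h2 M hM u, Finset.smul_sum]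
      exact Finset.sum_congr rfl fun r _ => smul_comm _ _ _
  obtain ⟨N, a, _, h⟩ := key
  exact ⟨N, a, h N le_rfl⟩

theorem PolyFun.of_sum {f : ℂ → E} (N : ℕ) (a : ℕ → E)
    (h : ∀ u, f u = ∑ r ∈ Finset.range N, u ^ r • a r) : PolyFun f := by
  have : f = fun u => ∑ r ∈ Finset.range N, u ^ r • a r := funext h
  rw [this]
  exact PolyFun.sum _ fun r _ => PolyFun.mono r (a r)

theorem PolyFun.exists_poly {p : ℂ → ℂ} (hp : PolyFun p) :
    ∃ P : Polynomial ℂ, ∀ u, p u = P.eval u := by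
  obtain ⟨N, a, h⟩ := hp.exists_sum
  refine ⟨∑ r ∈ Finset.range N, Polynomial.monomial r (a r), fun u => ?_⟩
  rw [h, Polynomial.eval_finsetSum]
  simp [mul_comm]

/-- A polynomial function is cofinitely nonzero as soon as it is somewhere nonzero. -/
theorem PolyFun.cofinite_ne {f : ℂ → E} (hf : PolyFun f) {u₀ : ℂ} (h0 : f u₀ ≠ 0) :
    ∀ᶠ u in cofinite, f u ≠ 0 := by
  obtain ⟨g, hg, -⟩ := Submodule.exists_le_ker_of_notMem (p := (⊥ : Submodule ℂ E)) (v := f u₀)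
    (by simpa using h0)
  obtain ⟨P, hP⟩ := (hf.map g).exists_poly
  have hP0 : P ≠ 0 := by
    rintro rfl
    apply hg
    rw [hP]
    simp
  have : {u : ℂ | P.eval u = 0}.Finite := by
    refine (P.roots.toFinset.finite_toSet).subset ?_
    intro u hu
    simp [hP0]
    exact hu
  have h2 : ∀ᶠ u in cofinite, ¬ (P.eval u = 0) := by
    simpa [Filter.eventually_cofinite] using this
  filter_upwards [h2] with u hu hfu
  apply hu
  rw [← hP, hfu, map_zero]

theorem ev_ne (c : ℂ) : ∀ᶠ u : ℂ in cofinite, u ≠ c := by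
  simp [Filter.eventually_cofinite]

instance : (cofinite : Filter ℂ).NeBot := Filter.cofinite_neBot

theorem PolyFun.mem_of_cofinite {f : ℂ → E} (hf : PolyFun f) (S : Submodule ℂ E)
    (h : ∀ᶠ u in cofinite, f u ∈ S) (u : ℂ) : f u ∈ S := by
  by_contra hu
  obtain ⟨g, hg, hS⟩ := Submodule.exists_le_ker_of_notMem hu
  obtain ⟨v, h1, h2⟩ := (((hf.map g).cofinite_ne hg).and h).exists
  exact h1 (hS h2)

theorem PolyFun.eq_of_cofinite {f g : ℂ → E} (hf : PolyFun f) (hg : PolyFun g)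
    (h : ∀ᶠ u in cofinite, f u = g u) (u : ℂ) : f u = g u := by
  have := (hf.sub hg).mem_of_cofinite ⊥ (by
    filter_upwards [h] with u hu
    simp [hu]) u
  simpa [sub_eq_zero] using this

theorem PolyFun.mem_of_ne {f : ℂ → E} (hf : PolyFun f) (S : Submodule ℂ E) (c : ℂ)
    (h : ∀ u, u ≠ c → f u ∈ S) (u : ℂ) : f u ∈ S :=
  hf.mem_of_cofinite S ((ev_ne c).mono h) u

theorem PolyFun.eq_of_ne {f g : ℂ → E} (hf : PolyFun f) (hg : PolyFun g) (c : ℂ)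
    (h : ∀ u, u ≠ c → f u = g u) (u : ℂ) : f u = g u :=
  hf.eq_of_cofinite hg ((ev_ne c).mono h) u

theorem PolyFun.step {f : ℂ → E} (hf : PolyFun f) :
    ∃ g : ℂ → E, PolyFun g ∧ ∀ u, f u = f 0 + u • g u := by
  unfold PolyFun at hf
  induction hf using Submodule.span_induction with
  | mem x h =>
    obtain ⟨r, a, rfl⟩ := h
    cases r with
    | zero => exact ⟨fun _ => 0, PolyFun.const 0, by simp⟩
    | succ r => exact ⟨_, PolyFun.mono r a, fun u => by simp [pow_succ', mul_smul]⟩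
  | zero => exact ⟨fun _ => 0, PolyFun.const 0, by simp⟩
  | add x y _ _ hx hy =>
    obtain ⟨g, hg, h⟩ := hx
    obtain ⟨g', hg', h'⟩ := hy
    refine ⟨_, hg.add hg', fun u => ?_⟩
    simp only [Pi.add_apply]
    rw [h u, h' u, smul_add]; abel
  | smul c x _ hx =>
    obtain ⟨g, hg, h⟩ := hx
    refine ⟨_, hg.csmul c, fun u => ?_⟩
    simp only [Pi.smul_apply]
    rw [h u, smul_add, smul_comm]

/-- `Lead f r`: `f u = u ^ b • g u` with `g` polynomial and `g 0 = r`. -/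
def Lead (f : ℂ → E) (r : E) : Prop :=
  ∃ (b : ℕ) (g : ℂ → E), PolyFun g ∧ (∀ u, f u = u ^ b • g u) ∧ g 0 = r

theorem exists_lead {f : ℂ → E} (hf : PolyFun f) {u₀ : ℂ} (h0 : f u₀ ≠ 0) :
    ∃ r, r ≠ 0 ∧ Lead f r := by
  obtain ⟨N, a, h⟩ := hf.exists_sum
  induction N generalizing f a with
  | zero => simp [h] at h0
  | succ N ih =>
    by_cases ha : a 0 = 0
    · have h' : ∀ u, f u = u • ∑ r ∈ Finset.range N, u ^ r • a (r + 1) := by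
        intro u
        rw [h, Finset.sum_range_succ', ha, smul_zero, add_zero, Finset.smul_sum]
        exact Finset.sum_congr rfl fun r _ => by rw [pow_succ', mul_smul]
      have hg : PolyFun (fun u : ℂ => ∑ r ∈ Finset.range N, u ^ r • a (r + 1)) :=
        PolyFun.of_sum N (fun r => a (r + 1)) fun _ => rfl
      obtain ⟨r, hr, b, g, hgp, hg1, hg2⟩ := ih hg (by
        intro h1
        apply h0
        rw [h', h1, smul_zero]) (fun r => a (r + 1)) (fun _ => rfl)
      refine ⟨r, hr, b + 1, g, hgp, fun u => ?_, hg2⟩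
      have := hg1 u
      beta_reduce at this
      rw [h', this, pow_succ', mul_smul]
    · refine ⟨a 0, ha, 0, f, hf, by simp, ?_⟩
      rw [h, Finset.sum_range_succ']
      simp

theorem Lead.map (L : E →ₗ[ℂ] F) {f : ℂ → E} {r : E} (hf : Lead f r) :
    Lead (fun u => L (f u)) (L r) := by
  obtain ⟨b, g, hg, h, rfl⟩ := hf
  exact ⟨b, _, hg.map L, fun u => by beta_reduce; rw [h, map_smul], rfl⟩

theorem Lead.mul {A : Type*} [Ring A] [Algebra ℂ A] {f g : ℂ → A} {r s : A} (hf : Lead f r)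
    (hg1 : Lead g s) : Lead (fun u => f u * g u) (r * s) := by
  obtain ⟨b, g, hg, h, rfl⟩ := hf
  obtain ⟨b', g', hg', h', rfl⟩ := hg1
  exact ⟨b + b', _, hg.mul hg', fun u => by
    beta_reduce
    rw [h, h', smul_mul_smul_comm, pow_add], rfl⟩

theorem Lead.const (a : E) : Lead (fun _ => a) a := ⟨0, _, PolyFun.const a, by simp, rfl⟩

theorem Lead.unique_aux {f g : ℂ → E} (hf : PolyFun f) (hg : PolyFun g) (a b : ℕ)
    (h : ∀ u : ℂ, u ^ a • f u = u ^ b • g u) (h0 : f 0 ≠ 0) (h0' : g 0 ≠ 0) : f 0 = g 0 := by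
  wlog hab : a ≤ b generalizing f g a b
  · exact (this hg hf b a (fun u => (h u).symm) h0' h0 (by omega)).symm
  obtain ⟨d, rfl⟩ := Nat.exists_eq_add_of_le hab
  have h1 : ∀ u, f u = u ^ d • g u := by
    refine fun u => hf.eq_of_ne ((PolyFun.id.pow d).smul hg) 0 (fun u hu => ?_) u
    have := h u
    rw [pow_add, mul_smul] at this
    exact smul_right_injective _ (pow_ne_zero a hu) this
  cases d with
  | zero => simpa using h1 0
  | succ d =>
    exfalso
    apply h0
    rw [h1]
    simp

/-- Proportional polynomial families have proportional leading terms. -/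
theorem Lead.unique {f g : ℂ → E} {r s : E} (hf : Lead f r) (hg : Lead g s) (hr : r ≠ 0)
    (hs : s ≠ 0) {p q : ℂ → ℂ} (hp : PolyFun p) (hq : PolyFun q) {u₁ u₂ : ℂ} (hp0 : p u₁ ≠ 0)
    (hq0 : q u₂ ≠ 0) (h : ∀ u, p u • f u = q u • g u) : ∃ κ : ℂ, κ ≠ 0 ∧ r = κ • s := by
  obtain ⟨b, f', hf', h1, rfl⟩ := hf
  obtain ⟨b', g', hg', h1', rfl⟩ := hg
  obtain ⟨x, hx, c, p', hp', h2, rfl⟩ := exists_lead hp hp0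
  obtain ⟨y, hy, c', q', hq', h2', rfl⟩ := exists_lead hq hq0
  have := Lead.unique_aux (hp'.smul hf') (hq'.smul hg') (c + b) (c' + b') (fun u => by
    have := h u
    rw [h1, h1', h2, h2'] at this
    simp only [smul_eq_mul] at this
    simp only [smul_smul] at this ⊢
    convert this using 2 <;> ring) (smul_ne_zero hx hr) (smul_ne_zero hy hs)
  refine ⟨(p' 0)⁻¹ * q' 0, mul_ne_zero (inv_ne_zero hx) hy, ?_⟩
  rw [mul_smul, ← this, smul_smul, inv_mul_cancel₀ hx, one_smul]

end PF
end YG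

namespace YG
open Filter

/-- Scalar matrices, seen as matrices over a `ℂ`-algebra. -/
noncomputable def sc {ι κ A : Type} [Ring A] [Algebra ℂ A] (M : Matrix ι κ ℂ) : Matrix ι κ A :=
  M.map (algebraMap ℂ A)

/-- Diagonal matrices. -/
noncomputable def dg {κ A : Type} [Fintype κ] [DecidableEq κ] [Ring A] [Algebra ℂ A] : A →ₐ[ℂ] Matrix κ κ A :=
  Matrix.scalarAlgHom κ ℂ

section scdg
variable {ι κ μ A : Type} [Ring A] [Algebra ℂ A] [Fintype ι] [DecidableEq ι] [Fintype κ] [DecidableEq κ] [Fintype μ] [DecidableEq μ]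

theorem sc_apply (M : Matrix ι κ ℂ) (a : ι) (b : κ) :
    (sc M : Matrix ι κ A) a b = algebraMap ℂ A (M a b) := rfl

theorem dg_apply (a : A) (b c : κ) : (dg a : Matrix κ κ A) b c = if b = c then a else 0 := by
  simp [dg, Matrix.scalar_apply, Matrix.diagonal_apply]

theorem sc_mul (M : Matrix ι κ ℂ) (N : Matrix κ μ ℂ) :
    (sc (M * N) : Matrix ι μ A) = (sc M : Matrix ι κ A) * (sc N : Matrix κ μ A) := by
  ext a b
  simp [sc_apply, Matrix.mul_apply]

theorem sc_add (M N : Matrix ι κ ℂ) : (sc (M + N) : Matrix ι κ A) = sc M + sc N := by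
  ext; simp [sc_apply]

theorem sc_sub (M N : Matrix ι κ ℂ) : (sc (M - N) : Matrix ι κ A) = sc M - sc N := by
  ext; simp [sc_apply]

theorem sc_zero : (sc (0 : Matrix ι κ ℂ) : Matrix ι κ A) = 0 := by
  ext; simp [sc_apply]

theorem sc_smul (c : ℂ) (M : Matrix ι κ ℂ) : (sc (c • M) : Matrix ι κ A) = c • sc M := by
  ext; simp [sc_apply, Algebra.smul_def]

theorem sc_one : (sc (1 : Matrix ι ι ℂ) : Matrix ι ι A) = 1 := by
  ext a b; simp [sc_apply, Matrix.one_apply]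

theorem sc_sum {σ : Type} (s : Finset σ) (f : σ → Matrix ι κ ℂ) :
    (sc (∑ i ∈ s, f i) : Matrix ι κ A) = ∑ i ∈ s, sc (f i) := by
  ext; simp [sc_apply, Matrix.sum_apply]

theorem dg_mul_apply (a : A) (M : Matrix κ μ A) (b : κ) (c : μ) :
    ((dg a : Matrix κ κ A) * M) b c = a * M b c := by
  simp [Matrix.mul_apply, dg_apply]

theorem mul_dg_apply (a : A) (M : Matrix μ κ A) (b : μ) (c : κ) :
    (M * (dg a : Matrix κ κ A)) b c = M b c * a := by
  simp [Matrix.mul_apply, dg_apply]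

theorem dg_sc (a : A) (M : Matrix ι κ ℂ) : (dg a : Matrix ι ι A) * (sc M : Matrix ι κ A)
    = (sc M : Matrix ι κ A) * (dg a : Matrix κ κ A) := by
  ext b c
  rw [dg_mul_apply, mul_dg_apply, sc_apply, Algebra.commutes]

theorem sc_complex (M : Matrix ι κ ℂ) : (sc M : Matrix ι κ ℂ) = M := by
  ext; simp [sc_apply]

/-- `sc` as an algebra morphism. -/
noncomputable def scA : Matrix κ κ ℂ →ₐ[ℂ] Matrix κ κ A := (Algebra.ofId ℂ A).mapMatrix

theorem scA_eq (M : Matrix κ κ ℂ) : (scA M : Matrix κ κ A) = sc M := rfl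

end scdg

/-- A representation of `gl_n` by matrices. -/
structure MRep (n : ℕ) (ι : Type) [Fintype ι] [DecidableEq ι] where
  e : Fin n → Fin n → Matrix ι ι ℂ
  comm : ∀ i j k l, e i j * e k l - e k l * e i j
    = (if j = k then e i l else 0) - (if l = i then e k j else 0)

noncomputable def MRep.L {n : ℕ} {ι : Type} [Fintype ι] [DecidableEq ι] (H : MRep n ι) (x : ℂ) (i j : Fin n) :
    Matrix ι ι ℂ := (if i = j then x • 1 else 0) + H.e i j

theorem MRep.L_rtt {n : ℕ} {ι : Type} [Fintype ι] [DecidableEq ι] (H : MRep n ι) (x y : ℂ) (i j k l : Fin n) :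
    (x - y) • (H.L x i j * H.L y k l) - H.L x k j * H.L y i l
      = (x - y) • (H.L y k l * H.L x i j) - H.L y k j * H.L x i l := by
  have h := H.comm i j k l
  obtain ⟨δ, hδ⟩ : ∃ δ : Fin n → Fin n → ℂ, δ = fun i j => if i = j then 1 else 0 := ⟨_, rfl⟩
  have hs : ∀ i j, δ i j = δ j i := by intro i j; simp only [hδ, eq_comm]
  have hL : ∀ x i j, H.L x i j = (x * δ i j) • 1 + H.e i j := by
    intro x i j
    simp only [MRep.L, hδ]
    split_ifs <;> simp
  have h2 : H.e i j * H.e k l = H.e k l * H.e i j + (δ k j • H.e i l - δ i l • H.e k j) := by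
    rw [hs k j, hs i l]
    have : H.e i j * H.e k l = H.e k l * H.e i j + (H.e i j * H.e k l - H.e k l * H.e i j) := by
      abel
    rw [this, h]
    simp only [hδ]
    split_ifs <;> simp
  simp only [hL, add_mul, mul_add, h2, smul_mul_assoc, mul_smul_comm, one_mul, mul_one]
  module

theorem MRep.L_poly {n : ℕ} {ι : Type} [Fintype ι] [DecidableEq ι] (H : MRep n ι) (i j : Fin n) :
    PolyFun (fun x => H.L x i j) := by
  unfold MRep.L
  refine PolyFun.add ?_ (PolyFun.const _)
  by_cases h : i = j
  · simpa [h] using PolyFun.id_smul (1 : Matrix ι ι ℂ)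
  · simpa [h] using PolyFun.const (0 : Matrix ι ι ℂ)

/-- A family of RTT matrices over an algebra. -/
structure YM (n : ℕ) (A : Type) [Ring A] [Algebra ℂ A] where
  T : ℂ → Fin n → Fin n → A
  poly : ∀ i j, PolyFun (fun x => T x i j)
  rtt : ∀ x y i j k l, (x - y) • (T x i j * T y k l) - T x k j * T y i l
    = (x - y) • (T y k l * T x i j) - T y k j * T x i l

theorem rtt_prod {n : ℕ} {B : Type} [Ring B] [Algebra ℂ B] (x y : ℂ)
    (p q s t : Fin n → Fin n → B)
    (h1 : ∀ i j k l, (x - y) • (p i j * q k l) - p k j * q i l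
      = (x - y) • (q k l * p i j) - q k j * p i l)
    (h2 : ∀ i j k l, (x - y) • (s i j * t k l) - s k j * t i l
      = (x - y) • (t k l * s i j) - t k j * s i l)
    (c1 : ∀ a b c d, s a b * p c d = p c d * s a b) (c2 : ∀ a b c d, s a b * q c d = q c d * s a b)
    (c3 : ∀ a b c d, t a b * p c d = p c d * t a b) (c4 : ∀ a b c d, t a b * q c d = q c d * t a b)
    (i j k l : Fin n) :
    (x - y) • ((∑ a, s a j * p i a) * ∑ b, t b l * q k b)
        - (∑ a, s a j * p k a) * ∑ b, t b l * q i b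
      = (x - y) • ((∑ b, t b l * q k b) * ∑ a, s a j * p i a)
        - (∑ a, t a j * q k a) * ∑ b, s b l * p i b := by
  have e1 : ∀ (a b c d e f g h : Fin n), s a b * p c d * (t e f * q g h)
      = p c d * q g h * (s a b * t e f) := by
    intros a b c d e f g h
    calc s a b * p c d * (t e f * q g h) = s a b * (p c d * t e f) * q g h := by noncomm_ring
      _ = s a b * t e f * p c d * q g h := by rw [← c3]; noncomm_ring
      _ = s a b * (t e f * (p c d * q g h)) := by noncomm_ring
      _ = s a b * (p c d * q g h * t e f) := by
        rw [← mul_assoc (t e f), c3, mul_assoc (p c d), c4, ← mul_assoc (p c d)]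
      _ = (s a b * p c d) * q g h * t e f := by noncomm_ring
      _ = p c d * (s a b * q g h) * t e f := by rw [c1]; noncomm_ring
      _ = _ := by rw [c2]; noncomm_ring
  have e2 : ∀ (a b c d e f g h : Fin n), t a b * q c d * (s e f * p g h)
      = q c d * p g h * (t a b * s e f) := by
    intros a b c d e f g h
    calc t a b * q c d * (s e f * p g h) = t a b * (q c d * s e f) * p g h := by noncomm_ring
      _ = t a b * s e f * q c d * p g h := by rw [← c2]; noncomm_ring
      _ = t a b * (s e f * (q c d * p g h)) := by noncomm_ring
      _ = t a b * (q c d * p g h * s e f) := by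
        rw [← mul_assoc (s e f), c2, mul_assoc (q c d), c1, ← mul_assoc (q c d)]
      _ = (t a b * q c d) * p g h * s e f := by noncomm_ring
      _ = q c d * (t a b * p g h) * s e f := by rw [c4]; noncomm_ring
      _ = _ := by rw [c3]; noncomm_ring
  have l1 : (x - y) • ((∑ a, s a j * p i a) * ∑ b, t b l * q k b)
        - (∑ a, s a j * p k a) * ∑ b, t b l * q i b
      = ∑ a, ∑ b, ((x - y) • (q k b * p i a) - q k a * p i b) * (s a j * t b l) := by
    simp only [Finset.sum_mul_sum, e1, Finset.smul_sum, ← Finset.sum_sub_distrib]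
    refine Finset.sum_congr rfl fun a _ => Finset.sum_congr rfl fun b _ => ?_
    rw [← h1 i a k b, sub_mul, smul_mul_assoc]
  have l2 : (x - y) • ((∑ b, t b l * q k b) * ∑ a, s a j * p i a)
        - (∑ a, t a j * q k a) * ∑ b, s b l * p i b
      = ∑ a, ∑ b, (q k b * p i a) * ((x - y) • (s a j * t b l) - s b j * t a l) := by
    simp only [Finset.sum_mul_sum, e2, Finset.smul_sum]
    rw [Finset.sum_comm]
    rw [Finset.sum_comm (f := fun a b => q k a * p i b * (t a j * s b l))]
    simp only [← Finset.sum_sub_distrib]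
    refine Finset.sum_congr rfl fun a _ => Finset.sum_congr rfl fun b _ => ?_
    rw [h2 a j b l, mul_sub, mul_smul_comm]
  rw [l1, l2]
  simp only [sub_mul, mul_sub, Finset.sum_sub_distrib, smul_mul_assoc, mul_smul_comm]
  congr 1
  rw [Finset.sum_comm]

section box
variable {n : ℕ} {A : Type} [Ring A] [Algebra ℂ A] {κ : Type} [Fintype κ] [DecidableEq κ]

theorem sc_poly {ι κ : Type} {M : ℂ → Matrix ι κ ℂ} (h : PolyFun M) :
    PolyFun (fun u => (sc (M u) : Matrix ι κ A)) := by
  exact h.map (LinearMap.mapMatrix (Algebra.linearMap ℂ A))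

theorem dg_poly {f : ℂ → A} (h : PolyFun f) :
    PolyFun (fun u => (dg (f u) : Matrix κ κ A)) :=
  h.map (dg : A →ₐ[ℂ] Matrix κ κ A).toLinearMap

/-- Matrix multiplication as a bilinear map. -/
noncomputable def mmulB (ι κ μ A : Type) [Fintype κ] [Ring A] [Algebra ℂ A] :
    Matrix ι κ A →ₗ[ℂ] Matrix κ μ A →ₗ[ℂ] Matrix ι μ A :=
  LinearMap.mk₂ ℂ (fun M N => M * N) (fun _ _ _ => Matrix.add_mul _ _ _)
    (fun _ _ _ => Matrix.smul_mul _ _ _) (fun _ _ _ => Matrix.mul_add _ _ _)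
    (fun _ _ _ => Matrix.mul_smul _ _ _)

theorem PolyFun.mmul {ι κ μ : Type} [Fintype κ] {f : ℂ → Matrix ι κ A} {g : ℂ → Matrix κ μ A}
    (hf : PolyFun f) (hg : PolyFun g) : PolyFun (fun u => f u * g u) :=
  PolyFun.bilin (mmulB ι κ μ A) hf hg

/-- The tensor product of an RTT family with an evaluation module. -/
noncomputable def box (Z : YM n A) (H : MRep n κ) : YM n (Matrix κ κ A) where
  T x i j := ∑ a, sc (H.L x a j) * dg (Z.T x i a)
  poly i j := PolyFun.sum _ fun a _ => (sc_poly (H.L_poly a j)).mmul (dg_poly (Z.poly i a))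
  rtt x y i j k l := by
    refine rtt_prod (B := Matrix κ κ A) x y (fun i j => dg (Z.T x i j)) (fun i j => dg (Z.T y i j))
      (fun i j => sc (H.L x i j)) (fun i j => sc (H.L y i j)) ?_ ?_ ?_ ?_ ?_ ?_ i j k l
    · intro i j k l
      simp only [← map_mul, ← map_smul, ← map_sub]
      rw [Z.rtt]
    · intro i j k l
      simp only [← sc_mul, ← sc_smul, ← sc_sub]
      rw [H.L_rtt]
    all_goals exact fun a b c d => (dg_sc _ _).symm

theorem box_T (Z : YM n A) (H : MRep n κ) (x : ℂ) (i j : Fin n) :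
    (box Z H).T x i j = ∑ a, sc (H.L x a j) * dg (Z.T x i a) := rfl

/-- The trivial RTT family. -/
noncomputable def one (n : ℕ) : YM n ℂ where
  T x i j := if i = j then 1 else 0
  poly i j := PolyFun.const _
  rtt x y i j k l := by
    simp only [mul_comm]

theorem box_one_T (H : MRep n κ) (x : ℂ) (i j : Fin n) :
    (box (one n) H).T x i j = H.L x i j := by
  rw [box_T, Finset.sum_eq_single i]
  · simp [one, sc_complex]
  · intro b _ hb
    simp [one, Ne.symm hb]
  · simp

end box

section act
variable {A : Type} [Ring A] [Algebra ℂ A] {V : Type} [AddCommGroup V] [Module ℂ V]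
  {κ : Type} [Fintype κ] [DecidableEq κ]

/-- The action of matrices over `A` on `κ → V`. -/
noncomputable def mact (π : A →ₐ[ℂ] Module.End ℂ V) :
    Matrix κ κ A →ₐ[ℂ] Module.End ℂ (κ → V) :=
  AlgHom.ofLinearMap
    { toFun := fun m => LinearMap.pi fun β => ∑ γ, π (m β γ) ∘ₗ LinearMap.proj γ
      map_add' := by
        intro x y; ext w β
        simp [LinearMap.sum_apply, Finset.sum_add_distrib]
      map_smul' := by
        intro c x; ext w β
        simp [LinearMap.sum_apply, Finset.smul_sum] }
    (by
      apply LinearMap.ext; intro w; funext β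
      simp [LinearMap.sum_apply, Matrix.one_apply, apply_ite π, ite_apply, DFunLike.ite_apply])
    (by
      intro x y; apply LinearMap.ext; intro w; funext β
      simp only [LinearMap.coe_mk, AddHom.coe_mk, LinearMap.pi_apply, LinearMap.sum_apply,
        LinearMap.comp_apply, LinearMap.proj_apply, Matrix.mul_apply, map_sum, map_mul,
        Module.End.mul_apply]
      rw [Finset.sum_comm])

theorem mact_apply (π : A →ₐ[ℂ] Module.End ℂ V) (m : Matrix κ κ A) (w : κ → V) (β : κ) :
    mact π m w β = ∑ γ, π (m β γ) (w γ) := by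
  simp [mact, LinearMap.sum_apply]

def Inv {n : ℕ} (Z : YM n A) (π : A →ₐ[ℂ] Module.End ℂ V) (S : Submodule ℂ V) : Prop :=
  ∀ x i j v, v ∈ S → π (Z.T x i j) v ∈ S

def Irr {n : ℕ} (Z : YM n A) (π : A →ₐ[ℂ] Module.End ℂ V) : Prop :=
  ∀ S : Submodule ℂ V, Inv Z π S → S = ⊥ ∨ S = ⊤

end act

/-- A family of `R`-matrices with helper `M`. -/
structure RFam {n : ℕ} {ι : Type} [Fintype ι] [DecidableEq ι] (M : MRep n ι) where
  R : ∀ {A : Type} [Ring A] [Algebra ℂ A], YM n A → ℂ → Matrix ι ι A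
  poly : ∀ {A : Type} [Ring A] [Algebra ℂ A] (Y : YM n A), PolyFun (R Y)
  cs : List ℂ
  pres : ∀ {A : Type} [Ring A] [Algebra ℂ A] {V : Type} [AddCommGroup V] [Module ℂ V]
    (Y : YM n A) (π : A →ₐ[ℂ] Module.End ℂ V) (S : Submodule ℂ V), Inv Y π S →
    ∀ u α β v, v ∈ S → π (R Y u α β) v ∈ S
  nat : ∀ {A B : Type} [Ring A] [Algebra ℂ A] [Ring B] [Algebra ℂ B]
    {V W : Type} [AddCommGroup V] [Module ℂ V] [AddCommGroup W] [Module ℂ W]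
    (Y : YM n A) (Y' : YM n B) (π : A →ₐ[ℂ] Module.End ℂ V) (π' : B →ₐ[ℂ] Module.End ℂ W)
    (f : V →ₗ[ℂ] W) (s : ℂ → ℂ),
    (∀ x i j v, π' (Y'.T x i j) (f v) = s x • f (π (Y.T x i j) v)) →
    ∀ u α β v, π' (R Y' u α β) (f v) = (cs.map (fun c => s (c + u))).prod • f (π (R Y u α β) v)
  inter : ∀ {A : Type} [Ring A] [Algebra ℂ A] (Y : YM n A) (x u : ℂ) (i j : Fin n),
    R Y u * ∑ a, sc (M.L (x - u) a j) * dg (Y.T x i a)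
      = (∑ a, sc (M.L (x - u) i a) * dg (Y.T x a j)) * R Y u
  unit : ∀ u, R (one n) u = 1
  mult : ∀ {A : Type} [Ring A] [Algebra ℂ A] {κ : Type} [Fintype κ] [DecidableEq κ] (Y : YM n A) (H : MRep n κ)
    (u : ℂ), R (box Y H) u = (R Y u).map dg * (R (box (one n) H) u).map sc
  nondeg : ∀ {κ : Type} [Fintype κ] [DecidableEq κ] (H : MRep n κ), ∀ᶠ u in cofinite, IsUnit (R (box (one n) H) u)

end YG

namespace YG
open Filter

section fdalg
variable {D : Type} [Ring D] [Algebra ℂ D] [FiniteDimensional ℂ D]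

theorem isUnit_of_regular (a : D) (h : ∀ y, a * y = 0 → y = 0) : IsUnit a := by
  have h1 : Function.Injective (LinearMap.mulLeft ℂ a) := by
    rw [← LinearMap.ker_eq_bot, LinearMap.ker_eq_bot']
    intro y hy
    exact h y hy
  obtain ⟨y, hy⟩ := (LinearMap.injective_iff_surjective.1 h1) 1
  have hy : a * y = 1 := hy
  have h2 : y * a = 1 := by
    have := h (y * a - 1) (by rw [mul_sub, ← mul_assoc, hy]; simp)
    exact sub_eq_zero.1 this
  exact ⟨⟨a, y, hy, h2⟩, rfl⟩

theorem isUnit_of_left_inv (a b : D) (h : b * a = 1) : IsUnit a :=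
  isUnit_of_regular a fun y hy => by
    have : b * (a * y) = y := by rw [← mul_assoc, h, one_mul]
    rw [← this, hy, mul_zero]

theorem isUnit_of_right_inv (a b : D) (h : a * b = 1) : IsUnit a := by
  obtain ⟨⟨b', c, h1, h2⟩, hb⟩ := isUnit_of_left_inv b a h
  subst hb
  simp only at h
  have : a = c := by
    calc a = a * (b' * c) := by rw [h1, mul_one]
      _ = c := by rw [← mul_assoc, h, one_mul]
  subst this
  exact ⟨⟨a, b', h2, h1⟩, rfl⟩

theorem ev_isUnit (a : D) : ∀ᶠ x : ℂ in cofinite, IsUnit (x • (1 : D) + a) := by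
  rcases subsingleton_or_nontrivial D with hD | hD
  · exact Eventually.of_forall fun x => isUnit_of_subsingleton _
  obtain ⟨p, hp0, hp⟩ : ∃ p : Polynomial ℂ, p ≠ 0 ∧ Polynomial.aeval (-a) p = 0 := by
    have := (Algebra.IsAlgebraic.isAlgebraic (R := ℂ) (-a))
    exact this
  have hfin : ∀ᶠ x in cofinite, ¬ (p.eval x = 0) := by
    rw [Filter.eventually_cofinite]
    refine (p.roots.toFinset.finite_toSet).subset ?_
    intro u hu
    simp only [not_not, Set.mem_setOf_eq] at hu
    simp [hp0, hu]
  filter_upwards [hfin] with x hx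
  by_contra hu
  apply hx
  have hxs : x ∈ spectrum ℂ (-a) := by
    rw [spectrum.mem_iff, Algebra.algebraMap_eq_smul_one, sub_neg_eq_add]
    exact hu
  have := spectrum.subset_polynomial_aeval (-a) p ⟨x, hxs, rfl⟩
  rw [hp, spectrum.zero_eq] at this
  exact this

end fdalg

theorem MRep.ev_isUnit_L {n : ℕ} {κ : Type} [Fintype κ] [DecidableEq κ] (H : MRep n κ) :
    ∀ᶠ x in cofinite, IsUnit (Matrix.of (H.L x) : Matrix (Fin n) (Fin n) (Matrix κ κ ℂ)) := by
  have := ev_isUnit (Matrix.of H.e : Matrix (Fin n) (Fin n) (Matrix κ κ ℂ))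
  filter_upwards [this] with x hx
  convert hx using 1
  ext1 i j
  simp only [Matrix.of_apply, MRep.L, Matrix.add_apply, Matrix.smul_apply, Matrix.one_apply]
  split_ifs <;> simp

/-- The base case: scalar action. -/
noncomputable def baseFam {n : ℕ} {ι : Type} [Fintype ι] [DecidableEq ι] (M : MRep n ι) (c : ℂ)
    (h : ∀ i j, M.e i j = if i = j then c • 1 else 0) : RFam M where
  R _ _ := 1
  poly _ := PolyFun.const _
  cs := []
  pres Y π S hS u α β v hv := by
    rw [Matrix.one_apply]
    split_ifs <;> simp [hv]
  nat Y Y' π π' f s hf u α β v := by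
    rw [Matrix.one_apply, Matrix.one_apply]
    split_ifs <;> simp
  inter Y x u i j := by
    have hL : ∀ a b, M.L (x - u) a b = if a = b then (x - u + c) • 1 else 0 := by
      intro a b
      simp only [MRep.L, h]
      split_ifs <;> simp [add_smul]
    rw [one_mul, mul_one, Finset.sum_eq_single j, Finset.sum_eq_single i]
    · simp only [hL, if_true, sc_smul, sc_one]
    · intro b _ hb
      rw [hL, if_neg hb.symm, sc_zero, zero_mul]
    · simp
    · intro b _ hb
      rw [hL, if_neg hb, sc_zero, zero_mul]
    · simp
  unit _ := rfl
  mult Y H u := by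
    ext1 a b
    rw [Matrix.mul_apply, Finset.sum_eq_single b]
    · simp only [Matrix.map_apply, Matrix.one_apply, if_true, sc_one, mul_one]
      split_ifs <;> simp
    · intro d _ hd
      simp [Matrix.one_apply, hd, sc_zero]
    · simp
  nondeg H := Eventually.of_forall fun u => isUnit_one

/-- The dual vector representation. -/
noncomputable def xrep (n : ℕ) (c : ℂ) : MRep n (Fin n) where
  e i j := -(Matrix.single j i 1) - if i = j then c • 1 else 0
  comm i j k l := by
    have h1 : ∀ (a : ℂ) (P : Prop) [Decidable P] (B : Matrix (Fin n) (Fin n) ℂ),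
      (if P then a • (1 : Matrix (Fin n) (Fin n) ℂ) else 0) * B
        = B * (if P then a • (1 : Matrix (Fin n) (Fin n) ℂ) else 0) := by
      intro a P _ B
      split_ifs <;> simp
    have h2 : ∀ (S S' Z Z' : Matrix (Fin n) (Fin n) ℂ), (∀ B, Z * B = B * Z) →
        (∀ B, Z' * B = B * Z') → (-S - Z) * (-S' - Z') - (-S' - Z') * (-S - Z)
          = S * S' - S' * S := by
      intro S S' Z Z' hZ hZ'
      simp only [sub_mul, mul_sub, neg_mul, mul_neg, hZ S', hZ Z', hZ' S, neg_neg]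
      abel
    rw [h2 _ _ _ _ (h1 _ _) (h1 _ _)]
    have h3 : ∀ a b d f : Fin n, (Matrix.single a b 1 : Matrix (Fin n) (Fin n) ℂ)
        * Matrix.single d f 1 = if b = d then Matrix.single a f 1 else 0 := by
      intro a b d f
      split_ifs with h
      · subst h; simp
      · exact Matrix.single_mul_single_of_ne _ _ _ _ h _
    rw [h3, h3]
    simp only [eq_comm (a := i) (b := l), eq_comm (a := k) (b := j)]
    by_cases h4 : l = i <;> by_cases h5 : j = k <;> simp [h4, h5]
    abel

theorem xrep_L (n : ℕ) (c y : ℂ) (i j : Fin n) :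
    (xrep n c).L y i j = (if i = j then (y - c) • 1 else 0) - Matrix.single j i 1 := by
  simp only [MRep.L, xrep]
  split_ifs <;> simp [sub_smul]
  module

/-- The `R`-matrix family of the dual vector representation. -/
noncomputable def xFam (n : ℕ) (c : ℂ) : RFam (xrep n c) where
  R Y u := Matrix.of (Y.T (c + u))
  poly {A} _ _ Y := by
    have h : PolyFun (fun u => ∑ k : Fin n, ∑ l : Fin n, Matrix.single k l (Y.T (c + u) k l)) := by
      refine PolyFun.sum _ fun k _ => PolyFun.sum _ fun l _ => ?_
      have h1 : PolyFun (fun u => Y.T (c + u) k l) :=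
        (Y.poly k l).comp ((PolyFun.const c).add PolyFun.id)
      exact h1.map (Matrix.singleLinearMap ℂ k l)
    convert h using 1
    ext1 u
    exact Matrix.matrix_eq_sum_single _
  cs := [c]
  pres Y π S hS u α β v hv := hS _ _ _ _ hv
  nat Y Y' π π' f s hf u α β v := by
    simp [hf]
  inter Y x u i j := by
    ext k l
    rw [Finset.mul_sum, Finset.sum_mul, Matrix.sum_apply, Matrix.sum_apply]
    have e1 : ∀ a, ((Matrix.of (Y.T (c + u)) * (sc ((xrep n c).L (x - u) a j) * dg (Y.T x i a)) : Matrix (Fin n) (Fin n) _)) k l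
        = (if a = j then (x - u - c) • (Y.T (c + u) k l * Y.T x i a) else 0)
          - (if a = l then Y.T (c + u) k j * Y.T x i a else 0) := by
      intro a
      rw [← mul_assoc, mul_dg_apply, Matrix.mul_apply, xrep_L]
      simp only [sc_apply, Matrix.sub_apply, map_sub, mul_sub, Finset.sum_sub_distrib, sub_mul,
        Matrix.of_apply]
      congr 1
      · split_ifs with h
        · simp [Matrix.one_apply, Finset.sum_ite_eq, Algebra.algebraMap_eq_smul_one]
        · simp
      · rw [Finset.sum_eq_single j]
        · by_cases h : a = l <;> simp [h]
        · intro b _ hb; simp [Matrix.single_apply, hb.symm]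
        · simp
    have e2 : ∀ a, ((sc ((xrep n c).L (x - u) i a) * dg (Y.T x a j) * Matrix.of (Y.T (c + u)) : Matrix (Fin n) (Fin n) _)) k l
        = (if i = a then (x - u - c) • (Y.T x a j * Y.T (c + u) k l) else 0)
          - (if a = k then Y.T x a j * Y.T (c + u) i l else 0) := by
      intro a
      rw [mul_assoc, Matrix.mul_apply, xrep_L]
      simp only [dg_mul_apply, sc_apply, Matrix.sub_apply, map_sub, sub_mul, Finset.sum_sub_distrib,
        Matrix.of_apply]
      congr 1
      · split_ifs with h
        · rw [Finset.sum_eq_single k]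
          · simp [Matrix.one_apply, Algebra.algebraMap_eq_smul_one]
          · intro b _ hb; simp [Matrix.one_apply, hb.symm]
          · simp
        · simp
      · rw [Finset.sum_eq_single i]
        · by_cases h : a = k <;> simp [h]
        · intro b _ hb; simp [Matrix.single_apply, hb.symm]
        · simp
    simp only [e1, e2, Finset.sum_sub_distrib, Finset.sum_ite_eq, Finset.sum_ite_eq',
      Finset.mem_univ, if_true]
    have := Y.rtt x (c + u) i j k l
    rw [show x - u - c = x - (c + u) by ring]
    exact this.symm
  unit u := by
    ext i j
    simp [one, Matrix.one_apply]
  mult Y H u := by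
    ext1 i j
    rw [Matrix.mul_apply]
    simp only [Matrix.of_apply, Matrix.map_apply, box_one_T]
    rw [box_T]
    exact Finset.sum_congr rfl fun a _ => (dg_sc _ _).symm
  nondeg H := by
    have h := H.ev_isUnit_L
    have h2 : ∀ᶠ u in cofinite, IsUnit (Matrix.of (H.L (c + u))) :=
      ((add_right_injective c).tendsto_cofinite).eventually h
    filter_upwards [h2] with u hu
    convert hu using 1
    ext1 i j
    simp [box_one_T]

end YG

namespace YG
open Filter

section inLR
variable {κ ν A : Type} [Ring A] [Algebra ℂ A] [Fintype κ] [DecidableEq κ] [Fintype ν]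
  [DecidableEq ν]

/-- `X ⊗ 1`. -/
noncomputable def inL : Matrix κ κ A →ₐ[ℂ] Matrix (κ × ν) (κ × ν) A :=
  AlgHom.ofLinearMap
    { toFun := fun X => Matrix.of fun p q => if p.2 = q.2 then X p.1 q.1 else 0
      map_add' := by
        intro x y; ext p q
        simp only [Matrix.of_apply, Matrix.add_apply]; split_ifs <;> simp
      map_smul' := by
        intro c x; ext p q
        simp only [Matrix.of_apply, Matrix.smul_apply, RingHom.id_apply]; split_ifs <;> simp }
    (by
      ext ⟨a, b⟩ ⟨c, d⟩
      simp only [LinearMap.coe_mk, AddHom.coe_mk, Matrix.of_apply, Matrix.one_apply, Prod.mk.injEq]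
      split_ifs <;> simp_all)
    (by
      intro x y; ext ⟨a, b⟩ ⟨c, d⟩
      simp only [LinearMap.coe_mk, AddHom.coe_mk, Matrix.of_apply, Matrix.mul_apply,
        Fintype.sum_prod_type, ite_mul, zero_mul, mul_ite, mul_zero, Finset.sum_ite_eq,
        Finset.mem_univ, if_true]
      split_ifs <;> simp_all)

/-- `1 ⊗ Y`. -/
noncomputable def inR : Matrix ν ν A →ₐ[ℂ] Matrix (κ × ν) (κ × ν) A :=
  AlgHom.ofLinearMap
    { toFun := fun X => Matrix.of fun p q => if p.1 = q.1 then X p.2 q.2 else 0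
      map_add' := by
        intro x y; ext p q
        simp only [Matrix.of_apply, Matrix.add_apply]; split_ifs <;> simp
      map_smul' := by
        intro c x; ext p q
        simp only [Matrix.of_apply, Matrix.smul_apply, RingHom.id_apply]; split_ifs <;> simp }
    (by
      ext ⟨a, b⟩ ⟨c, d⟩
      simp only [LinearMap.coe_mk, AddHom.coe_mk, Matrix.of_apply, Matrix.one_apply, Prod.mk.injEq]
      split_ifs <;> simp_all)
    (by
      intro x y; ext ⟨a, b⟩ ⟨c, d⟩
      simp only [LinearMap.coe_mk, AddHom.coe_mk, Matrix.of_apply, Matrix.mul_apply,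
        Fintype.sum_prod_type_right, ite_mul, zero_mul, mul_ite, mul_zero, Finset.sum_ite_eq,
        Finset.mem_univ, if_true]
      split_ifs <;> simp_all)

theorem inL_apply (X : Matrix κ κ A) (p q : κ × ν) :
    (inL X : Matrix (κ × ν) (κ × ν) A) p q = if p.2 = q.2 then X p.1 q.1 else 0 := rfl

theorem inR_apply (X : Matrix ν ν A) (p q : κ × ν) :
    (inR X : Matrix (κ × ν) (κ × ν) A) p q = if p.1 = q.1 then X p.2 q.2 else 0 := rfl

theorem inL_mul_inR (X : Matrix κ κ A) (Y : Matrix ν ν A) (p q : κ × ν) :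
    (((inL X : Matrix (κ × ν) (κ × ν) A) * (inR Y : Matrix (κ × ν) (κ × ν) A) : Matrix (κ × ν) (κ × ν) A)) p q = X p.1 q.1 * Y p.2 q.2 := by
  rw [Matrix.mul_apply, Fintype.sum_prod_type]
  simp [inL_apply, inR_apply]

theorem inR_mul_inL (X : Matrix κ κ A) (Y : Matrix ν ν A) (p q : κ × ν) :
    (((inR Y : Matrix (κ × ν) (κ × ν) A) * (inL X : Matrix (κ × ν) (κ × ν) A) : Matrix (κ × ν) (κ × ν) A)) p q = Y p.2 q.2 * X p.1 q.1 := by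
  rw [Matrix.mul_apply, Fintype.sum_prod_type_right]
  simp [inL_apply, inR_apply]

theorem inLR_comm (X : Matrix κ κ A) (Y : Matrix ν ν A)
    (h : ∀ a b c d, X a b * Y c d = Y c d * X a b) :
    (inL X : Matrix (κ × ν) (κ × ν) A) * inR Y = inR Y * inL X := by
  ext p q
  rw [inL_mul_inR, inR_mul_inL, h]

theorem inL_dg (a : A) : (inL (dg a : Matrix κ κ A) : Matrix (κ × ν) (κ × ν) A) = dg a := by
  ext p q
  rw [inL_apply, dg_apply, dg_apply]
  obtain ⟨p1, p2⟩ := p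
  obtain ⟨q1, q2⟩ := q
  simp only [Prod.mk.injEq]
  split_ifs <;> simp_all

theorem inR_dg (a : A) : (inR (dg a : Matrix ν ν A) : Matrix (κ × ν) (κ × ν) A) = dg a := by
  ext p q
  rw [inR_apply, dg_apply, dg_apply]
  obtain ⟨p1, p2⟩ := p
  obtain ⟨q1, q2⟩ := q
  simp only [Prod.mk.injEq]
  split_ifs <;> simp_all

theorem inL_sc (M : Matrix κ κ ℂ) :
    (inL (sc M : Matrix κ κ A) : Matrix (κ × ν) (κ × ν) A) = sc (inL M) := by
  ext p q
  rw [inL_apply, sc_apply, sc_apply, inL_apply]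
  split_ifs <;> simp

theorem inR_sc (M : Matrix ν ν ℂ) :
    (inR (sc M : Matrix ν ν A) : Matrix (κ × ν) (κ × ν) A) = sc (inR M) := by
  ext p q
  rw [inR_apply, sc_apply, sc_apply, inR_apply]
  split_ifs <;> simp

theorem inL_map {B : Type} [Ring B] [Algebra ℂ B] (f : A →ₐ[ℂ] B) (M : Matrix κ κ A) :
    (inL (M.map f) : Matrix (κ × ν) (κ × ν) B) = (inL M : Matrix (κ × ν) (κ × ν) A).map f := by
  ext p q
  simp only [inL_apply, Matrix.map_apply]
  split_ifs <;> simp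

theorem inR_map {B : Type} [Ring B] [Algebra ℂ B] (f : A →ₐ[ℂ] B) (M : Matrix ν ν A) :
    (inR (M.map f) : Matrix (κ × ν) (κ × ν) B) = (inR M : Matrix (κ × ν) (κ × ν) A).map f := by
  ext p q
  simp only [inR_apply, Matrix.map_apply]
  split_ifs <;> simp

theorem sc_map {ι κ B : Type} [Ring B] [Algebra ℂ B] (f : A →ₐ[ℂ] B) (M : Matrix ι κ ℂ) :
    (sc M : Matrix ι κ A).map f = sc M := by
  ext p q
  simp [sc_apply]

theorem mem_entries_mul {ι κ μ : Type} [Fintype κ] (P : Subalgebra ℂ A) {M : Matrix ι κ A}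
    {N : Matrix κ μ A} (hM : ∀ a b, M a b ∈ P) (hN : ∀ a b, N a b ∈ P) (a : ι) (b : μ) :
    (M * N) a b ∈ P := by
  rw [Matrix.mul_apply]
  exact sum_mem fun c _ => mul_mem (hM _ _) (hN _ _)

end inLR

/-- The subalgebra preserving a subspace. -/
noncomputable def stab {A V : Type} [Ring A] [Algebra ℂ A] [AddCommGroup V] [Module ℂ V]
    (π : A →ₐ[ℂ] Module.End ℂ V) (S : Submodule ℂ V) : Subalgebra ℂ A where
  carrier := {a | ∀ v ∈ S, π a v ∈ S}
  mul_mem' := by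
    intro a b ha hb v hv
    rw [map_mul]
    exact ha _ (hb _ hv)
  add_mem' := by
    intro a b ha hb v hv
    rw [map_add]
    exact S.add_mem (ha _ hv) (hb _ hv)
  algebraMap_mem' := by
    intro r v hv
    rw [AlgHom.commutes]
    exact S.smul_mem r hv

theorem mem_stab {A V : Type} [Ring A] [Algebra ℂ A] [AddCommGroup V] [Module ℂ V]
    (π : A →ₐ[ℂ] Module.End ℂ V) (S : Submodule ℂ V) (a : A) :
    a ∈ stab π S ↔ ∀ v ∈ S, π a v ∈ S := Iff.rfl

section rel
variable {A B V W : Type} [Ring A] [Algebra ℂ A] [Ring B] [Algebra ℂ B] [AddCommGroup V]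
  [Module ℂ V] [AddCommGroup W] [Module ℂ W] (π : A →ₐ[ℂ] Module.End ℂ V)
  (π' : B →ₐ[ℂ] Module.End ℂ W) (f : V →ₗ[ℂ] W)

/-- Twisted intertwining. -/
def Rel (s : ℂ) (a : A) (b : B) : Prop := ∀ v, π' b (f v) = s • f (π a v)

theorem Rel.mul {s t : ℂ} {a a' : A} {b b' : B} (h : Rel π π' f s a b) (h' : Rel π π' f t a' b') :
    Rel π π' f (s * t) (a * a') (b * b') := by
  intro v
  rw [map_mul, map_mul, Module.End.mul_apply, Module.End.mul_apply, h', map_smul, h, smul_smul,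
    mul_comm]

theorem Rel.sum {σ : Type} (F : Finset σ) {s : ℂ} {a : σ → A} {b : σ → B}
    (h : ∀ i ∈ F, Rel π π' f s (a i) (b i)) : Rel π π' f s (∑ i ∈ F, a i) (∑ i ∈ F, b i) := by
  intro v
  rw [map_sum, map_sum, LinearMap.sum_apply, LinearMap.sum_apply, map_sum, Finset.smul_sum]
  exact Finset.sum_congr rfl fun i hi => h i hi v

theorem Rel.zero (s : ℂ) : Rel π π' f s 0 0 := by
  intro v; simp

theorem Rel.scal (c : ℂ) : Rel π π' f 1 (algebraMap ℂ A c) (algebraMap ℂ B c) := by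
  intro v
  rw [AlgHom.commutes, AlgHom.commutes]
  simp

theorem Rel.matmul {ι κ μ : Type} [Fintype κ] {s t : ℂ} {M : Matrix ι κ A} {M' : Matrix ι κ B}
    {N : Matrix κ μ A} {N' : Matrix κ μ B} (h : ∀ a b, Rel π π' f s (M a b) (M' a b))
    (h' : ∀ a b, Rel π π' f t (N a b) (N' a b)) (a : ι) (b : μ) :
    Rel π π' f (s * t) ((M * N) a b) ((M' * N') a b) := by
  rw [Matrix.mul_apply, Matrix.mul_apply]
  exact Rel.sum _ _ _ _ fun c _ => (h a c).mul _ _ _ (h' c b)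

end rel

theorem ring_inter {n : ℕ} {D : Type} [Ring D] (T0 RN : D) (LX LN t : Fin n → Fin n → D)
    (h1 : ∀ i j, T0 * ∑ a, LX a j * t i a = (∑ a, LX i a * t a j) * T0)
    (h2 : ∀ i j, RN * ∑ a, LN a j * t i a = (∑ a, LN i a * t a j) * RN)
    (c1 : ∀ i j, T0 * LN i j = LN i j * T0) (c2 : ∀ i j, RN * LX i j = LX i j * RN)
    (c3 : ∀ i j k l, LN i j * LX k l = LX k l * LN i j)
    (c4 : ∀ i j k l, t i j * LX k l = LX k l * t i j) (i j : Fin n) :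
    T0 * RN * ∑ a, (∑ b, LN a b * LX b j) * t i a
      = (∑ b, (∑ a, LN i a * LX a b) * t b j) * (T0 * RN) := by
  have e1 : ∑ a, (∑ b, LN a b * LX b j) * t i a = ∑ b, LX b j * ∑ a, LN a b * t i a := by
    simp only [Finset.sum_mul, Finset.mul_sum]
    rw [Finset.sum_comm]
    refine Finset.sum_congr rfl fun b _ => Finset.sum_congr rfl fun a _ => ?_
    rw [c3, mul_assoc]
  have e2 : RN * ∑ b, LX b j * ∑ a, LN a b * t i a = (∑ a, LN i a * ∑ b, LX b j * t a b) * RN := by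
    rw [Finset.mul_sum, Finset.sum_mul]
    have : ∀ b, RN * (LX b j * ∑ a, LN a b * t i a) = ∑ a, LN i a * (LX b j * t a b) * RN := by
      intro b
      rw [← mul_assoc, c2, mul_assoc, h2, ← mul_assoc, Finset.mul_sum, Finset.sum_mul]
      refine Finset.sum_congr rfl fun a _ => ?_
      rw [← mul_assoc, ← c3, mul_assoc (LN i a), ← mul_assoc (LN i a)]
    rw [Finset.sum_congr rfl fun b _ => this b, Finset.sum_comm]
    simp only [Finset.mul_sum, Finset.sum_mul]
  have e3 : T0 * ∑ a, LN i a * ∑ b, LX b j * t a b = (∑ b, (∑ a, LN i a * LX a b) * t b j) * T0 := by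
    rw [Finset.mul_sum]
    have : ∀ a, T0 * (LN i a * ∑ b, LX b j * t a b) = ∑ b, LN i a * LX a b * t b j * T0 := by
      intro a
      rw [← mul_assoc, c1, mul_assoc, h1, ← mul_assoc, Finset.mul_sum, Finset.sum_mul]
      refine Finset.sum_congr rfl fun a _ => ?_
      rw [← mul_assoc]
    simp only [this, Finset.sum_mul]
    rw [Finset.sum_comm]
  rw [e1, mul_assoc, e2, ← mul_assoc, e3, mul_assoc]

end YG

namespace YG
open Filter

section fuse
variable {n : ℕ} {ν μ : Type} [Fintype ν] [DecidableEq ν] [Fintype μ] [DecidableEq μ]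

/-- The operator `𝓐`, i.e. `L_N(c)` as a matrix on `ℂⁿ ⊗ N`. -/
noncomputable def Aop (N : MRep n ν) (c : ℂ) : Matrix (Fin n × ν) (Fin n × ν) ℂ :=
  Matrix.of fun p q => N.L c p.1 q.1 p.2 q.2

/-- Diagonal action of `gl_n` on `(ℂⁿ)* ⊗ N`. -/
noncomputable def Eop (N : MRep n ν) (i j : Fin n) : Matrix (Fin n × ν) (Fin n × ν) ℂ :=
  inR (N.e i j) - inL (Matrix.single j i 1)

/-- Fusion data. -/
structure Fuse (N : MRep n ν) (M : MRep n μ) (c : ℂ) where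
  φ : Matrix (Fin n × ν) μ ℂ
  ψ : Matrix μ (Fin n × ν) ℂ
  B : Matrix (Fin n × ν) (Fin n × ν) ℂ
  ψφ : ψ * φ = 1
  Aφ : Aop N c * φ = 0
  res : φ * ψ + B * Aop N c = 1
  Eφ : ∀ i j, Eop N i j * φ = φ * M.e i j

/-- The operator `τ`. -/
noncomputable def tauop (N : MRep n ν) (c y : ℂ) (i j : Fin n) :
    Matrix (Fin n × ν) (Fin n × ν) ℂ :=
  ∑ b, inR (N.L y i b) * inL ((xrep n c).L y b j)

theorem tauop_eq (N : MRep n ν) (c y : ℂ) (i j : Fin n) :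
    tauop N c y i j = (y - c) • ((if i = j then y • 1 else 0) + Eop N i j)
      - (inL (Matrix.single j i 1) : Matrix (Fin n × ν) (Fin n × ν) ℂ) * Aop N c := by
  ext ⟨k, α⟩ ⟨l, β⟩
  have hA : ((inL (Matrix.single j i 1) : Matrix (Fin n × ν) (Fin n × ν) ℂ) * Aop N c : Matrix (Fin n × ν) (Fin n × ν) ℂ) (k, α) (l, β)
      = if k = j then N.L c i l α β else 0 := by
    rw [Matrix.mul_apply, Fintype.sum_prod_type, Finset.sum_eq_single i]
    · simp only [inL_apply, Aop, Matrix.of_apply, Matrix.single_apply, and_true]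
      simp [eq_comm]
    · intro b _ hb
      simp [inL_apply, hb.symm]
    · simp
  have hL : ∀ b, N.L y i b α β = (y - c) * (if i = b ∧ α = β then 1 else 0) + N.L c i b α β := by
    intro b
    simp only [MRep.L]
    by_cases h : i = b <;> by_cases h' : α = β <;> simp [h, h', Matrix.one_apply] <;> ring
  rw [Matrix.sub_apply, hA, tauop, Matrix.sum_apply]
  have h1 : ∀ b, (((inR (N.L y i b) : Matrix (Fin n × ν) (Fin n × ν) ℂ) *
      (inL ((xrep n c).L y b j) : Matrix (Fin n × ν) (Fin n × ν) ℂ) : Matrix (Fin n × ν) (Fin n × ν) ℂ)) (k, α) (l, β)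
      = (if b = j then (if k = l then (y - c) * N.L y i b α β else 0) else 0)
        - (if b = l then (if k = j then N.L y i b α β else 0) else 0) := by
    intro b
    rw [inR_mul_inL, xrep_L]
    simp only [Matrix.sub_apply, mul_sub]
    congr 1
    · by_cases h : b = j <;> by_cases h' : k = l <;> simp [h, h', Matrix.one_apply, mul_comm]
    · by_cases h : b = l <;> by_cases h' : k = j <;> simp [h, h', Matrix.single_apply, eq_comm]
      intro h2; exact absurd h2.symm h'
  simp only [h1, Finset.sum_sub_distrib, Finset.sum_ite_eq', Finset.mem_univ, if_true]
  rw [hL l]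
  simp only [Eop, Matrix.smul_apply, Matrix.add_apply, Matrix.sub_apply, inR_apply, inL_apply,
    MRep.L, Matrix.single_apply, smul_eq_mul]
  by_cases h : i = j <;> by_cases h2 : k = l <;> by_cases h3 : α = β <;> by_cases h4 : k = j <;>
    by_cases h5 : i = l <;> simp_all [Matrix.one_apply, eq_comm] <;> ring_nf <;> simp_all

theorem Fuse.tau {N : MRep n ν} {M : MRep n μ} {c : ℂ} (f : Fuse N M c) (y : ℂ) (i j : Fin n) :
    tauop N c y i j * f.φ = (y - c) • (f.φ * M.L y i j) := by
  rw [tauop_eq, Matrix.sub_mul, Matrix.mul_assoc, f.Aφ, Matrix.mul_zero, sub_zero, Matrix.smul_mul,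
    Matrix.add_mul, f.Eφ]
  congr 1
  rw [MRep.L, Matrix.mul_add]
  congr 1
  split_ifs <;> simp

section
variable {A : Type} [Ring A] [Algebra ℂ A] {N : MRep n ν} {M : MRep n μ} {c : ℂ}
  (F : RFam N) (f : Fuse N M c)

/-- The product of `R`-matrices before restriction. -/
noncomputable def Qop (F : RFam N) (c : ℂ) (Y : YM n A) (u : ℂ) : Matrix (Fin n × ν) (Fin n × ν) A :=
  inL ((xFam n c).R Y u) * inR (F.R Y u)

theorem Qop_comm (Y : YM n A) (u : ℂ) :
    (sc (Aop N c) : Matrix (Fin n × ν) (Fin n × ν) A) * Qop F c Y u =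
      (inR (F.R Y u) : Matrix (Fin n × ν) (Fin n × ν) A) * inL ((xFam n c).R Y u) * sc (Aop N c) := by
  have h := fun i j => F.inter Y (c + u) u i j
  simp only [add_sub_cancel_right] at h
  ext ⟨i, α⟩ ⟨j, β⟩
  have h' := congrFun (congrFun (h i j) α) β
  have e1 : ((sc (Aop N c) : Matrix (Fin n × ν) (Fin n × ν) A) * Qop F c Y u) (i, α) (j, β)
     = (((∑ a, sc (N.L c i a) * dg (Y.T (c + u) a j) : Matrix ν ν A) * F.R Y u : Matrix ν ν A)) α β := by
    rw [Matrix.mul_apply, Fintype.sum_prod_type_right, Matrix.mul_apply]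
    have : ∀ β' a, (sc (Aop N c) : Matrix (Fin n × ν) (Fin n × ν) A) (i, α) (a, β') * Qop F c Y u (a, β') (j, β)
        = (sc (N.L c i a) * dg (Y.T (c + u) a j) : Matrix ν ν A) α β' * F.R Y u β' β := by
      intro β' a
      rw [mul_dg_apply, Qop, inL_mul_inR, ← mul_assoc]
      rfl
    refine Finset.sum_congr rfl fun β' _ => ?_
    rw [Matrix.sum_apply, Finset.sum_mul]
    exact Finset.sum_congr rfl fun a _ => this β' a
  have e2 : (((inR (F.R Y u) : Matrix (Fin n × ν) (Fin n × ν) A) * inL ((xFam n c).R Y u) * sc (Aop N c) : Matrix (Fin n × ν) (Fin n × ν) A)) (i, α) (j, β)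
     = ((F.R Y u * (∑ a, sc (N.L c a j) * dg (Y.T (c + u) i a) : Matrix ν ν A) : Matrix ν ν A)) α β := by
    rw [Matrix.mul_apply, Fintype.sum_prod_type_right, Matrix.mul_apply]
    refine Finset.sum_congr rfl fun β' _ => ?_
    rw [Matrix.sum_apply, Finset.mul_sum]
    refine Finset.sum_congr rfl fun a _ => ?_
    rw [inR_mul_inL, mul_dg_apply, mul_assoc, sc_apply, sc_apply, Algebra.commutes]
    rfl
  rw [e1, e2, h']

theorem Fuse.Q_phi (Y : YM n A) (u : ℂ) :
    ((Qop F c Y u : Matrix (Fin n × ν) (Fin n × ν) A) * (sc f.φ : Matrix (Fin n × ν) μ A) : Matrix (Fin n × ν) μ A)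
     = (sc f.φ : Matrix (Fin n × ν) μ A) * ((sc f.ψ : Matrix μ (Fin n × ν) A) * (Qop F c Y u : Matrix (Fin n × ν) (Fin n × ν) A)
      * (sc f.φ : Matrix (Fin n × ν) μ A) : Matrix μ μ A) := by
  have h0 : (sc (Aop N c) : Matrix (Fin n × ν) (Fin n × ν) A) * (Qop F c Y u : Matrix (Fin n × ν) (Fin n × ν) A)
      * (sc f.φ : Matrix (Fin n × ν) μ A) = 0 := by
    rw [Qop_comm, Matrix.mul_assoc, ← sc_mul, f.Aφ, sc_zero, Matrix.mul_zero]
  have h1 : ((sc f.φ : Matrix (Fin n × ν) μ A) * (sc f.ψ : Matrix μ (Fin n × ν) A) : Matrix (Fin n × ν) (Fin n × ν) A)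
      + (sc f.B : Matrix (Fin n × ν) (Fin n × ν) A) * (sc (Aop N c) : Matrix (Fin n × ν) (Fin n × ν) A) = 1 := by
    rw [← sc_mul, ← sc_mul, ← sc_add, f.res, sc_one]
  calc _ = (1 : Matrix (Fin n × ν) (Fin n × ν) A) * ((Qop F c Y u : Matrix (Fin n × ν) (Fin n × ν) A) * (sc f.φ : Matrix (Fin n × ν) μ A)) := by rw [Matrix.one_mul]
    _ = _ := by
      rw [← h1, Matrix.add_mul, Matrix.mul_assoc (sc f.B : Matrix (Fin n × ν) (Fin n × ν) A), ← Matrix.mul_assoc (sc (Aop N c) : Matrix (Fin n × ν) (Fin n × ν) A), h0]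
      simp only [Matrix.mul_zero, add_zero, Matrix.mul_assoc]

theorem Fuse.psi_phi : ((sc f.ψ : Matrix μ (Fin n × ν) A) * (sc f.φ : Matrix (Fin n × ν) μ A) : Matrix μ μ A) = 1 := by
  rw [← sc_mul, f.ψφ, sc_one]

theorem Fuse.cancel {σ : Type} {X Y : Matrix μ σ A}
    (h : (sc f.φ : Matrix (Fin n × ν) μ A) * X = (sc f.φ : Matrix (Fin n × ν) μ A) * Y) : X = Y := by
  have := congrArg (fun Z => (sc f.ψ : Matrix μ (Fin n × ν) A) * Z) h
  simp only [← Matrix.mul_assoc, f.psi_phi, Matrix.one_mul] at this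
  exact this

/-- The fused R matrix. -/
noncomputable def Fuse.R (Y : YM n A) (u : ℂ) : Matrix μ μ A :=
  (sc f.ψ : Matrix μ (Fin n × ν) A) * (Qop F c Y u : Matrix (Fin n × ν) (Fin n × ν) A)
      * (sc f.φ : Matrix (Fin n × ν) μ A)

theorem Fuse.phi_R (Y : YM n A) (u : ℂ) :
    ((sc f.φ : Matrix (Fin n × ν) μ A) * (f.R F Y u : Matrix μ μ A) : Matrix (Fin n × ν) μ A)
     = (Qop F c Y u : Matrix (Fin n × ν) (Fin n × ν) A) * (sc f.φ : Matrix (Fin n × ν) μ A) :=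
  (f.Q_phi F Y u).symm

theorem Qop_poly (Y : YM n A) : PolyFun (fun u => Qop F c Y u) := by
  refine PolyFun.mul ?_ ?_
  · exact ((xFam n c).poly Y).map (inL : Matrix (Fin n) (Fin n) A →ₐ[ℂ] Matrix (Fin n × ν) (Fin n × ν) A).toLinearMap
  · exact (F.poly Y).map (inR : Matrix ν ν A →ₐ[ℂ] Matrix (Fin n × ν) (Fin n × ν) A).toLinearMap

theorem Fuse.R_poly (Y : YM n A) : PolyFun (fun u => f.R F Y u) :=
  ((PolyFun.const _).mmul (Qop_poly F Y)).mmul (PolyFun.const _)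

theorem Qop_inter (Y : YM n A) (x u : ℂ) (i j : Fin n) :
    Qop F c Y u * ∑ a, sc (tauop N c (x - u) a j) * dg (Y.T x i a)
      = (∑ a, sc (tauop N c (x - u) i a) * dg (Y.T x a j)) * Qop F c Y u := by
  have := ring_inter (D := Matrix (Fin n × ν) (Fin n × ν) A) (inL ((xFam n c).R Y u)) (inR (F.R Y u))
    (fun i j => sc (inL ((xrep n c).L (x - u) i j))) (fun i j => sc (inR (N.L (x - u) i j)))
    (fun i j => dg (Y.T x i j)) ?_ ?_ ?_ ?_ ?_ ?_ i j
  · simp only [tauop, sc_sum, sc_mul]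
    exact this
  · intro i j
    have := congrArg (inL : Matrix (Fin n) (Fin n) A →ₐ[ℂ] Matrix (Fin n × ν) (Fin n × ν) A) ((xFam n c).inter Y x u i j)
    simp only [map_mul, map_sum, inL_sc, inL_dg] at this
    exact this
  · intro i j
    have := congrArg (inR : Matrix ν ν A →ₐ[ℂ] Matrix (Fin n × ν) (Fin n × ν) A) (F.inter Y x u i j)
    simp only [map_mul, map_sum, inR_sc, inR_dg] at this
    exact this
  · intro i j
    rw [← inR_sc]
    exact inLR_comm _ _ fun a b c d => by rw [sc_apply, Algebra.commutes]
  · intro i j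
    rw [← inL_sc]
    exact (inLR_comm _ _ fun a b c d => by rw [sc_apply, Algebra.commutes]).symm
  · intro i j k l
    rw [← inL_sc, ← inR_sc]
    exact (inLR_comm _ _ fun a b c d => by rw [sc_apply, Algebra.commutes]).symm
  · intro i j k l
    exact dg_sc _ _

end
end fuse
end YG

namespace YG
open Filter

section fuse2
variable {n : ℕ} {ν μ : Type} [Fintype ν] [DecidableEq ν] [Fintype μ] [DecidableEq μ]
  {N : MRep n ν} {M : MRep n μ} {c : ℂ}

theorem Fuse.sc_tau (f : Fuse N M c) {A : Type} [Ring A] [Algebra ℂ A] (y : ℂ) (i j : Fin n) :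
    ((sc (tauop N c y i j) : Matrix (Fin n × ν) (Fin n × ν) A) * (sc f.φ : Matrix (Fin n × ν) μ A)
      : Matrix (Fin n × ν) μ A) =
    (y - c) • ((sc f.φ : Matrix (Fin n × ν) μ A) * (sc (M.L y i j) : Matrix μ μ A) : Matrix (Fin n × ν) μ A) := by
  rw [← sc_mul, f.tau, sc_smul, sc_mul]

theorem Fuse.inter_aux (F : RFam N) (f : Fuse N M c) {A : Type} [Ring A] [Algebra ℂ A] (Y : YM n A)
    (x u : ℂ) (i j : Fin n) :
    (x - u - c) • (f.R F Y u * ∑ a, sc (M.L (x - u) a j) * dg (Y.T x i a))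
      = (x - u - c) • ((∑ a, sc (M.L (x - u) i a) * dg (Y.T x a j)) * f.R F Y u) := by
  have key : ∀ (p : Fin n → Fin n × Fin n) (q : Fin n → A),
      (((∑ a, sc (tauop N c (x - u) (p a).1 (p a).2) * dg (q a) : Matrix (Fin n × ν) (Fin n × ν) A)) *
        (sc f.φ : Matrix (Fin n × ν) μ A) : Matrix (Fin n × ν) μ A) =
      (x - u - c) • ((sc f.φ : Matrix (Fin n × ν) μ A) *
        ((∑ a, sc (M.L (x - u) (p a).1 (p a).2) * dg (q a) : Matrix μ μ A)) : Matrix (Fin n × ν) μ A) := by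
    intro p q
    rw [Matrix.sum_mul, Matrix.mul_sum, Finset.smul_sum]
    refine Finset.sum_congr rfl fun a _ => ?_
    rw [Matrix.mul_assoc, dg_sc, ← Matrix.mul_assoc, f.sc_tau, Matrix.smul_mul, Matrix.mul_assoc]
  apply f.cancel
  rw [Matrix.mul_smul, Matrix.mul_smul]
  rw [← Matrix.mul_assoc, f.phi_R, Matrix.mul_assoc, ← Matrix.mul_smul,
    ← key (fun a => (a, j)) (fun a => Y.T x i a), ← Matrix.mul_assoc]
  have := Qop_inter (N := N) (c := c) F Y x u i j
  rw [this, Matrix.mul_assoc, ← f.phi_R, ← Matrix.mul_assoc,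
    key (fun a => (i, a)) (fun a => Y.T x a j), ← Matrix.mul_assoc, Matrix.smul_mul]

theorem Fuse.inter (F : RFam N) (f : Fuse N M c) {A : Type} [Ring A] [Algebra ℂ A] (Y : YM n A)
    (x u : ℂ) (i j : Fin n) :
    f.R F Y u * ∑ a, sc (M.L (x - u) a j) * dg (Y.T x i a)
      = (∑ a, sc (M.L (x - u) i a) * dg (Y.T x a j)) * f.R F Y u := by
  have hp : ∀ (p : Fin n → Fin n × Fin n) (q : Fin n → Fin n × Fin n),
      PolyFun (fun x => (∑ a, sc (M.L (x - u) (p a).1 (p a).2) * dg (Y.T x (q a).1 (q a).2) : Matrix μ μ A)) := by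
    intro p q
    refine PolyFun.sum _ fun a _ => PolyFun.mul (sc_poly ?_) (dg_poly (Y.poly _ _))
    exact (M.L_poly _ _).comp (PolyFun.id.sub (PolyFun.const u))
  have h1 : PolyFun (fun x => (f.R F Y u * ∑ a, sc (M.L (x - u) a j) * dg (Y.T x i a) : Matrix μ μ A)) :=
    (PolyFun.const _).mul (hp (fun a => (a, j)) (fun a => (i, a)))
  have h2 : PolyFun (fun x => ((∑ a, sc (M.L (x - u) i a) * dg (Y.T x a j)) * f.R F Y u : Matrix μ μ A)) :=
    (hp (fun a => (i, a)) (fun a => (a, j))).mul (PolyFun.const _)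
  have := PolyFun.eq_of_ne h1 h2 (c + u) ?_ x
  · exact this
  · intro x hx
    have h3 := f.inter_aux F Y x u i j
    have h4 : x - u - c ≠ 0 := by
      intro h; apply hx; linear_combination h
    exact smul_right_injective _ h4 h3

theorem Qop_mult (F : RFam N) {A κ : Type} [Ring A] [Algebra ℂ A] [Fintype κ] [DecidableEq κ]
    (Y : YM n A) (H : MRep n κ) (u : ℂ) :
    Qop F c (box Y H) u = (Qop F c Y u).map dg * (Qop F c (box (one n) H) u).map sc := by
  rw [Qop, (xFam n c).mult, F.mult, Qop, Qop]
  have e1 : ∀ M : Matrix (Fin n) (Fin n) (Matrix κ κ ℂ), (M.map sc : Matrix (Fin n) (Fin n) (Matrix κ κ A)) = M.map (scA : Matrix κ κ ℂ →ₐ[ℂ] Matrix κ κ A) := fun _ => rfl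
  have e2 : ∀ M : Matrix ν ν (Matrix κ κ ℂ), (M.map sc : Matrix ν ν (Matrix κ κ A)) = M.map (scA : Matrix κ κ ℂ →ₐ[ℂ] Matrix κ κ A) := fun _ => rfl
  have e3 : ∀ M : Matrix (Fin n × ν) (Fin n × ν) (Matrix κ κ ℂ), (M.map sc : Matrix (Fin n × ν) (Fin n × ν) (Matrix κ κ A)) = M.map (scA : Matrix κ κ ℂ →ₐ[ℂ] Matrix κ κ A) := fun _ => rfl
  rw [e1, e2, e3, map_mul, map_mul, inL_map, inL_map, inR_map, inR_map, Matrix.map_mul, Matrix.map_mul]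
  have hc : (inL ((xFam n c).R (box (one n) H) u)).map (scA : Matrix κ κ ℂ →ₐ[ℂ] Matrix κ κ A)
      * (inR (F.R Y u)).map (dg : A →ₐ[ℂ] Matrix κ κ A)
     = (inR (F.R Y u)).map (dg : A →ₐ[ℂ] Matrix κ κ A) * (inL ((xFam n c).R (box (one n) H) u)).map (scA : Matrix κ κ ℂ →ₐ[ℂ] Matrix κ κ A) := by
    rw [← inL_map, ← inR_map]
    apply inLR_comm
    intro a b c d
    simp only [Matrix.map_apply, scA_eq]
    exact (dg_sc _ _).symm
  rw [mul_assoc, ← mul_assoc _ ((inR (F.R Y u)).map _), hc, mul_assoc, mul_assoc]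

/-- The fused family. -/
noncomputable def fuseFam (F : RFam N) (f : Fuse N M c) : RFam M where
  R Y u := f.R F Y u
  poly Y := f.R_poly F Y
  cs := c :: F.cs
  pres {A} _ _ {V} _ _ Y π S hS u α β v hv := by
    revert v
    change f.R F Y u α β ∈ stab π S
    refine mem_entries_mul (stab π S) (mem_entries_mul (stab π S) ?_
      (mem_entries_mul (stab π S) ?_ ?_)) ?_ α β
    · intro a b; exact Subalgebra.algebraMap_mem _ _
    · intro a b
      rw [inL_apply]
      split_ifs
      · exact (xFam n c).pres Y π S hS u _ _
      · exact zero_mem _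
    · intro a b
      rw [inR_apply]
      split_ifs
      · exact F.pres Y π S hS u _ _
      · exact zero_mem _
    · intro a b; exact Subalgebra.algebraMap_mem _ _
  nat {A B} _ _ _ _ {V W} _ _ _ _ Y Y' π π' f' s hf u α β v := by
    revert v
    change Rel π π' f' _ (f.R F Y u α β) (f.R F Y' u α β)
    have := Rel.matmul π π' f' (Rel.matmul π π' f' (s := 1) (M := (sc f.ψ : Matrix μ (Fin n × ν) A))
      (M' := (sc f.ψ : Matrix μ (Fin n × ν) B)) (N := (Qop F c Y u : Matrix (Fin n × ν) (Fin n × ν) A))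
      (N' := (Qop F c Y' u : Matrix (Fin n × ν) (Fin n × ν) B))
      (fun a b => Rel.scal _ _ _ _)
      (Rel.matmul π π' f' (s := s (c + u)) (t := (F.cs.map (fun c => s (c + u))).prod) ?_ ?_))
        (N := (sc f.φ : Matrix (Fin n × ν) μ A)) (N' := (sc f.φ : Matrix (Fin n × ν) μ B))
        (fun a b => Rel.scal _ _ _ _) α β
    · have h5 : (1 * (s (c + u) * (List.map (fun c => s (c + u)) F.cs).prod) * 1)
          = (List.map (fun c => s (c + u)) (c :: F.cs)).prod := by simp
      rw [h5] at this
      exact this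
    · intro a b
      rw [inL_apply, inL_apply]
      split_ifs
      · have := (xFam n c).nat Y Y' π π' f' s hf u a.1 b.1
        have h6 : (List.map (fun c => s (c + u)) (xFam n c).cs).prod = s (c + u) := by simp [xFam]
        rw [h6] at this
        exact this
      · exact Rel.zero _ _ _ _
    · intro a b
      rw [inR_apply, inR_apply]
      split_ifs
      · exact F.nat Y Y' π π' f' s hf u a.2 b.2
      · exact Rel.zero _ _ _ _
  inter Y x u i j := f.inter F Y x u i j
  unit u := by
    have : Qop F c (one n) u = 1 := by
      rw [Qop, (xFam n c).unit, F.unit, map_one, map_one, one_mul]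
    rw [Fuse.R, this, Matrix.mul_one, f.psi_phi]
  mult {A} _ _ {κ} _ _ Y H u := by
    have h1 := congrArg (fun X : Matrix (Fin n × ν) μ (Matrix κ κ ℂ) => X.map (scA : Matrix κ κ ℂ →ₐ[ℂ] Matrix κ κ A)) (f.phi_R F (box (one n) H) u)
    simp only [Matrix.map_mul, sc_map] at h1
    rw [Fuse.R, Qop_mult]
    have e3 : ∀ {ι : Type} (M : Matrix ι ι (Matrix κ κ ℂ)), (M.map sc : Matrix ι ι (Matrix κ κ A)) = M.map (scA : Matrix κ κ ℂ →ₐ[ℂ] Matrix κ κ A) := fun _ => rfl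
    rw [e3, e3, Matrix.mul_assoc, Matrix.mul_assoc, ← h1, Fuse.R.eq_1 F f Y u, Matrix.map_mul, Matrix.map_mul, sc_map, sc_map]
    simp only [Matrix.mul_assoc]
  nondeg {κ} _ _ H := by
    filter_upwards [(xFam n c).nondeg H, F.nondeg H] with u h1 h2
    have hQ : IsUnit (Qop F c (box (one n) H) u) :=
      (h1.map (inL : Matrix (Fin n) (Fin n) (Matrix κ κ ℂ) →ₐ[ℂ] Matrix (Fin n × ν) (Fin n × ν) _)).mul
        (h2.map (inR : Matrix ν ν (Matrix κ κ ℂ) →ₐ[ℂ] Matrix (Fin n × ν) (Fin n × ν) _))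
    apply isUnit_of_regular
    intro y hy
    apply f.cancel
    obtain ⟨q, hq⟩ := hQ.exists_left_inv
    have h3 : (Qop F c (box (one n) H) u : Matrix (Fin n × ν) (Fin n × ν) (Matrix κ κ ℂ)) *
        ((sc f.φ : Matrix (Fin n × ν) μ (Matrix κ κ ℂ)) * y : Matrix (Fin n × ν) μ (Matrix κ κ ℂ)) = 0 := by
      rw [← Matrix.mul_assoc, ← f.phi_R, Matrix.mul_assoc, hy, Matrix.mul_zero]
    have h4 := congrArg (fun X : Matrix (Fin n × ν) μ (Matrix κ κ ℂ) => q * X) h3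
    simp only [← Matrix.mul_assoc, hq, Matrix.one_mul, Matrix.mul_zero] at h4
    rw [h4, Matrix.mul_zero]

end fuse2
end YG

namespace YG
open Filter

theorem Lead.mem {E F : Type*} [AddCommGroup E] [Module ℂ E] [AddCommGroup F] [Module ℂ F]
    (L : E →ₗ[ℂ] F) (S : Submodule ℂ F) {f : ℂ → E} {r : E} (hf : Lead f r)
    (h : ∀ u, L (f u) ∈ S) : L r ∈ S := by
  obtain ⟨b, g, hg, hfg, rfl⟩ := hf
  refine PolyFun.mem_of_ne (hg.map L) S 0 ?_ 0
  intro u hu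
  have h1 := h u
  rw [hfg, map_smul] at h1
  exact (S.smul_mem_iff (pow_ne_zero b hu)).1 h1

theorem Lead.congr {E : Type*} [AddCommGroup E] [Module ℂ E] {f g : ℂ → E} {r : E}
    (hf : Lead f r) (h : ∀ u, g u = f u) : Lead g r := by
  rw [show g = f from funext h]; exact hf

section K
variable {n : ℕ} {A V : Type} [Ring A] [Algebra ℂ A] [AddCommGroup V] [Module ℂ V]
  (Z : YM n A) (π : A →ₐ[ℂ] Module.End ℂ V) {κ : Type} [Fintype κ] [DecidableEq κ] (H : MRep n κ)

theorem mact_dg_single (a : A) (k : κ) (z : V) :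
    mact π (dg a) (Pi.single k z) = Pi.single k (π a z) := by
  funext β
  rw [mact_apply, Finset.sum_eq_single β]
  · rw [dg_apply, if_pos rfl]
    by_cases h : β = k
    · subst h; simp
    · simp [h]
  · intro b _ hb
    rw [dg_apply, if_neg hb.symm]; simp
  · simp

theorem mact_sc_single (W : Matrix κ κ ℂ) (k : κ) (z : V) :
    mact π (sc W) (Pi.single k z) = ∑ β, W β k • Pi.single β z := by
  funext β
  rw [mact_apply, Finset.sum_apply, Finset.sum_eq_single k, Finset.sum_eq_single β]
  · simp [sc_apply]
  · intro b _ hb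
    simp [hb.symm]
  · simp
  · intro b _ hb
    simp [hb]
  · simp

/-- The largest `K` with `κ ⊗ K ⊆ S`. -/
def Ksub (S : Submodule ℂ (κ → V)) : Submodule ℂ V where
  carrier := {z | ∀ k, Pi.single k z ∈ S}
  add_mem' := by
    intro a b ha hb k
    rw [Pi.single_add]
    exact S.add_mem (ha k) (hb k)
  zero_mem' := by intro k; simp
  smul_mem' := by
    intro c a ha k
    rw [Pi.single_smul]
    exact S.smul_mem c (ha k)

theorem mem_Ksub (S : Submodule ℂ (κ → V)) (z : V) : z ∈ Ksub S ↔ ∀ k, Pi.single k z ∈ S := Iff.rfl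

theorem Ksub_inv (S : Submodule ℂ (κ → V)) (hS : Inv (box Z H) (mact π) S) : Inv Z π (Ksub S) := by
  intro x i b z hz k
  have hp : PolyFun (fun x => mact π (dg (Z.T x i b) : Matrix κ κ A) (Pi.single k z)) :=
    (dg_poly (Z.poly i b)).map ((LinearMap.applyₗ (Pi.single k z : κ → V)) ∘ₗ (mact π).toLinearMap)
  rw [← mact_dg_single]
  refine PolyFun.mem_of_cofinite hp S ?_ x
  filter_upwards [H.ev_isUnit_L] with x hx
  obtain ⟨W, hW⟩ := hx.exists_right_inv
  have e : (dg (Z.T x i b) : Matrix κ κ A) = ∑ j, (box Z H).T x i j * sc (W j b) := by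
    have h1 : ∀ j, (box Z H).T x i j * sc (W j b) = ∑ a, sc (H.L x a j * W j b) * dg (Z.T x i a) := by
      intro j
      rw [box_T, Finset.sum_mul]
      refine Finset.sum_congr rfl fun a _ => ?_
      rw [mul_assoc, dg_sc, ← mul_assoc, ← sc_mul]
    simp only [h1]
    rw [Finset.sum_comm, Finset.sum_eq_single b]
    · rw [← Finset.sum_mul, ← sc_sum]
      have := congrFun (congrFun hW b) b
      rw [Matrix.mul_apply] at this
      simp only [Matrix.of_apply, Matrix.one_apply, if_true] at this
      rw [this, sc_one, one_mul]
    · intro a _ ha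
      rw [← Finset.sum_mul, ← sc_sum]
      have := congrFun (congrFun hW a) b
      rw [Matrix.mul_apply] at this
      simp only [Matrix.of_apply, Matrix.one_apply, if_neg ha] at this
      rw [this, sc_zero, zero_mul]
    · simp
  rw [e, map_sum, LinearMap.sum_apply]
  refine S.sum_mem fun j _ => ?_
  rw [map_mul, Module.End.mul_apply]
  apply hS
  rw [mact_sc_single]
  exact S.sum_mem fun β _ => S.smul_mem _ (hz β)

theorem Ksub_top (S : Submodule ℂ (κ → V)) (h : Ksub S = ⊤) : S = ⊤ := by
  rw [eq_top_iff]
  intro w _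
  have : w = ∑ k, Pi.single k (w k) := by
    funext β; simp [Finset.sum_apply]
  rw [this]
  refine S.sum_mem fun k _ => ?_
  have : w k ∈ Ksub S := by rw [h]; trivial
  exact this k

/-- The permutation operator. -/
noncomputable def Flip (κ : Type) [Fintype κ] [DecidableEq κ] : Matrix κ κ (Matrix κ κ ℂ) :=
  Matrix.of fun γ β => Matrix.of fun k l => if γ = l ∧ k = β then 1 else 0

theorem Flip_apply (γ β k l : κ) : Flip κ γ β k l = if γ = l ∧ k = β then 1 else 0 := rfl

variable {H}
/-- Reality of `H`. -/
def Real (F : RFam H) : Prop := ∃ c : ℂ, c ≠ 0 ∧ Lead (F.R (box (one n) H)) (c • Flip κ)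

theorem thmA (F : RFam H) (hF : Real F) (hZ : Irr Z π) {r : Matrix κ κ A} (hr : Lead (F.R Z) r)
    (S : Submodule ℂ (κ → V)) (hS : Inv (box Z H) (mact π) S) :
    S = ⊤ ∨ ∀ s ∈ S, mact π r s = 0 := by
  obtain ⟨c, hc, hFl⟩ := hF
  have h1 : Lead (F.R (box Z H)) (r.map dg * (c • Flip κ).map sc) := by
    have a1 : Lead (fun u => (F.R Z u).map dg) (r.map (dg : A →ₐ[ℂ] Matrix κ κ A)) :=
      hr.map (LinearMap.mapMatrix (dg : A →ₐ[ℂ] Matrix κ κ A).toLinearMap)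
    have a2 : Lead (fun u => (F.R (box (one n) H) u).map (sc : _ → Matrix κ κ A)) ((c • Flip κ).map (sc : _ → Matrix κ κ A)) :=
      hFl.map (LinearMap.mapMatrix (scA : Matrix κ κ ℂ →ₐ[ℂ] Matrix κ κ A).toLinearMap)
    exact (a1.mul a2).congr fun u => F.mult Z H u
  have h2 : ∀ s ∈ S, ∀ α, mact π r s α ∈ Ksub S := by
    intro s hs α β
    have h3 := Lead.mem ((LinearMap.applyₗ s) ∘ₗ (mact π).toLinearMap ∘ₗ
      (Matrix.entryLinearMap ℂ (Matrix κ κ A) α β)) S h1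
      (fun u => F.pres (box Z H) (mact π) S hS u α β s hs)
    have h4 : ((LinearMap.applyₗ s) ∘ₗ (mact π).toLinearMap ∘ₗ
      (Matrix.entryLinearMap ℂ (Matrix κ κ A) α β)) (r.map dg * (c • Flip κ).map sc)
        = c • Pi.single β (mact π r s α) := by
      change mact π ((r.map dg * (c • Flip κ).map sc : Matrix κ κ (Matrix κ κ A)) α β) s = _
      have h5 : ∀ k l, (r.map dg * (c • Flip κ).map sc : Matrix κ κ (Matrix κ κ A)) α β k l
          = if k = β then c • r α l else 0 := by
        intro k l
        rw [Matrix.mul_apply, Matrix.sum_apply]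
        simp only [Matrix.map_apply, dg_mul_apply, sc_apply, Matrix.smul_apply, Flip_apply]
        rw [Finset.sum_eq_single l]
        · by_cases h : k = β <;> simp [h, Algebra.algebraMap_eq_smul_one]
        · intro b _ hb
          simp [hb]
        · simp
      funext k
      rw [mact_apply]
      simp only [h5]
      by_cases h : k = β
      · subst h
        simp [mact_apply, Finset.smul_sum]
      · simp [h]
    rw [h4] at h3
    exact (S.smul_mem_iff hc).1 h3
  rcases hZ _ (Ksub_inv Z π H S hS) with h | h
  · right
    intro s hs
    funext α
    have := h2 s hs α
    rw [h] at this
    simpa using this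
  · left
    exact Ksub_top S h

theorem lead_inter (F : RFam H) {r : Matrix κ κ A} (hr : Lead (F.R Z) r) (x : ℂ) (i j : Fin n) :
    r * (box Z H).T x i j = (∑ a, sc (H.L x i a) * dg (Z.T x a j)) * r := by
  obtain ⟨b, g, hg, hfg, rfl⟩ := hr
  have hL : ∀ i j, PolyFun (fun u => (sc (H.L (x - u) i j) : Matrix κ κ A)) := fun i j =>
    sc_poly ((H.L_poly i j).comp ((PolyFun.const x).sub PolyFun.id))
  have p1 : PolyFun (fun u => g u * ∑ a, sc (H.L (x - u) a j) * dg (Z.T x i a)) :=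
    hg.mul (PolyFun.sum _ fun a _ => (hL a j).mul (PolyFun.const _))
  have p2 : PolyFun (fun u => (∑ a, sc (H.L (x - u) i a) * dg (Z.T x a j)) * g u) :=
    (PolyFun.sum _ fun a _ => (hL i a).mul (PolyFun.const _)).mul hg
  have := PolyFun.eq_of_ne p1 p2 0 ?_ 0
  · simpa [box_T] using this
  · intro u hu
    have h := F.inter Z x u i j
    rw [hfg, Matrix.smul_mul, Matrix.mul_smul] at h
    exact smul_right_injective _ (pow_ne_zero b hu) h

theorem ker_inv (F : RFam H) {r : Matrix κ κ A} (hr : Lead (F.R Z) r) :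
    Inv (box Z H) (mact π) (LinearMap.ker (mact π r)) := by
  intro x i j v hv
  rw [LinearMap.mem_ker] at hv ⊢
  rw [← Module.End.mul_apply, ← map_mul, lead_inter Z F hr, map_mul, Module.End.mul_apply, hv, map_zero]

theorem thmA1 (F : RFam H) (hF : Real F) (hZ : Irr Z π) {r : Matrix κ κ A} (hr : Lead (F.R Z) r)
    (hu : IsUnit r) : Irr (box Z H) (mact π) := by
  intro S hS
  rcases thmA Z π F hF hZ hr S hS with h | h
  · exact Or.inr h
  · left
    rw [eq_bot_iff]
    intro s hs
    obtain ⟨q, hq⟩ := hu.exists_left_inv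
    have : mact π (q * r) s = 0 := by
      rw [map_mul, Module.End.mul_apply, h s hs, map_zero]
    rw [hq, map_one] at this
    simpa using this

theorem mact_injective (hπ : Function.Injective π) :
    Function.Injective (mact π : Matrix κ κ A →ₐ[ℂ] _) := by
  rw [injective_iff_map_eq_zero]
  intro m hm
  ext a b
  apply hπ
  rw [Matrix.zero_apply, map_zero]
  ext z
  have := congrFun (LinearMap.congr_fun hm (Pi.single b z)) a
  rw [mact_apply, Finset.sum_eq_single b] at this
  · simpa using this
  · intro c _ hc; simp [hc]
  · simp

theorem isUnit_of_mact_inj [FiniteDimensional ℂ A] (hπ : Function.Injective π) (r : Matrix κ κ A)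
    (h : LinearMap.ker (mact π r) = ⊥) : IsUnit r := by
  apply isUnit_of_regular
  intro y hy
  apply mact_injective π hπ
  rw [map_zero]
  refine LinearMap.ext fun v => ?_
  have : mact π r (mact π y v) = 0 := by
    rw [← Module.End.mul_apply, ← map_mul, hy]; simp
  rw [← LinearMap.mem_ker, h] at this
  simpa using this

theorem thmA2 [FiniteDimensional ℂ A] (hπ : Function.Injective π) (F : RFam H)
    (hI : Irr (box Z H) (mact π)) {r : Matrix κ κ A} (hr : Lead (F.R Z) r) (h0 : r ≠ 0) :
    IsUnit r := by
  apply isUnit_of_mact_inj π hπ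
  rcases hI _ (ker_inv Z π F hr) with h | h
  · exact h
  · exfalso
    apply h0
    apply mact_injective π hπ
    rw [map_zero]
    exact LinearMap.ker_eq_top.1 h

end K

/-- The standard module of the trivial family. -/
noncomputable def π0 : ℂ →ₐ[ℂ] Module.End ℂ ℂ := Algebra.ofId _ _

theorem π0_inj : Function.Injective π0 := (algebraMap ℂ (Module.End ℂ ℂ)).injective

section real
variable {n : ℕ} {κ : Type} [Fintype κ] [DecidableEq κ] {H : MRep n κ}

theorem Flip_mul_apply (r : Matrix κ κ (Matrix κ κ ℂ)) (a b k l : κ) :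
    ((Flip κ * r : Matrix κ κ (Matrix κ κ ℂ))) a b k l = r k b a l := by
  rw [Matrix.mul_apply, Matrix.sum_apply]
  rw [Finset.sum_eq_single k]
  · rw [Matrix.mul_apply, Finset.sum_eq_single a]
    · simp [Flip_apply]
    · intro c _ hc; simp [Flip_apply, hc.symm]
    · simp
  · intro c _ hc
    rw [Matrix.mul_apply]
    apply Finset.sum_eq_zero
    intro d _
    simp [Flip_apply, hc.symm]
  · simp

theorem Flip_sq : (Flip κ * Flip κ : Matrix κ κ (Matrix κ κ ℂ)) = 1 := by
  ext a b k l
  rw [Flip_mul_apply, Flip_apply, Matrix.one_apply]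
  by_cases h : a = b <;> by_cases h' : k = l <;> simp [h, h', Matrix.one_apply]

theorem Flip_sc (X : Matrix κ κ ℂ) : (Flip κ * sc X : Matrix κ κ (Matrix κ κ ℂ)) = dg X * Flip κ := by
  ext a b k l
  rw [Flip_mul_apply, dg_mul_apply, sc_apply, Matrix.mul_apply]
  rw [Finset.sum_eq_single b]
  · by_cases h : a = l <;> simp [Flip_apply, h, Matrix.algebraMap_matrix_apply]
  · intro c _ hc; simp [Flip_apply, hc]
  · simp

theorem Flip_dg (X : Matrix κ κ ℂ) : (Flip κ * dg X : Matrix κ κ (Matrix κ κ ℂ)) = sc X * Flip κ := by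
  have h := Flip_sc X
  have h1 : (Flip κ * (Flip κ * sc X) * Flip κ : Matrix κ κ (Matrix κ κ ℂ)) = Flip κ * (dg X * Flip κ) * Flip κ := by rw [h]
  rw [← mul_assoc, Flip_sq, one_mul, mul_assoc, mul_assoc, Flip_sq, mul_one] at h1
  exact h1.symm

theorem schur {n : ℕ} {A V : Type} [Ring A] [Algebra ℂ A] [AddCommGroup V] [Module ℂ V]
    [FiniteDimensional ℂ V] (Z : YM n A) (π : A →ₐ[ℂ] Module.End ℂ V) (hπ : Function.Injective π)
    (hI : Irr Z π) (a : A) (ha : ∀ x i j, a * Z.T x i j = Z.T x i j * a) : ∃ c : ℂ, a = c • 1 := by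
  rcases subsingleton_or_nontrivial V with hV | hV
  · refine ⟨0, hπ ?_⟩
    ext v
    exact Subsingleton.elim _ _
  · obtain ⟨c, hc⟩ := Module.End.exists_eigenvalue (π a)
    refine ⟨c, hπ ?_⟩
    have hinv : Inv Z π (Module.End.eigenspace (π a) c) := by
      intro x i j v hv
      rw [Module.End.mem_eigenspace_iff] at hv ⊢
      rw [← Module.End.mul_apply, ← map_mul, ha, map_mul, Module.End.mul_apply, hv, map_smul]
    rcases hI _ hinv with h | h
    · exact absurd h hc
    · ext v
      have : v ∈ Module.End.eigenspace (π a) c := by rw [h]; trivial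
      rw [Module.End.mem_eigenspace_iff] at this
      rw [this]; simp

theorem real_of_irr (F : RFam H)
    (hI : Irr (V := κ → κ → ℂ) (box (box (one n) H) H) (mact (mact π0))) : Real F := by
  rcases isEmpty_or_nonempty κ with hκ | hκ
  · exact ⟨1, one_ne_zero, 0, F.R (box (one n) H), F.poly _, by simp, Subsingleton.elim _ _⟩
  obtain ⟨u, hu⟩ := (F.nondeg H).exists
  obtain ⟨r, hr0, hr⟩ := exists_lead (F.poly (box (one n) H)) hu.ne_zero
  have hcomm : ∀ x i j, (Flip κ * r) * (box (box (one n) H) H).T x i j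
      = (box (box (one n) H) H).T x i j * (Flip κ * r) := by
    intro x i j
    rw [mul_assoc, lead_inter _ F hr, ← mul_assoc, ← mul_assoc]
    congr 1
    rw [box_T, Finset.mul_sum, Finset.sum_mul]
    refine Finset.sum_congr rfl fun a _ => ?_
    rw [box_one_T, box_one_T, ← mul_assoc, Flip_sc, mul_assoc, Flip_dg, ← mul_assoc, dg_sc]
  obtain ⟨c, hc⟩ := schur _ _ (mact_injective _ (mact_injective _ π0_inj)) hI _ hcomm
  have hr' : r = c • Flip κ := by
    have : Flip κ * (Flip κ * r) = Flip κ * (c • 1) := by rw [hc]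
    rw [← mul_assoc, Flip_sq, one_mul, mul_smul_comm, mul_one] at this
    exact this
  refine ⟨c, ?_, hr' ▸ hr⟩
  rintro rfl
  apply hr0
  rw [hr', zero_smul]

end real
end YG

namespace YG
open Filter

section multi
variable {n : ℕ} {A V : Type} [Ring A] [Algebra ℂ A] [AddCommGroup V] [Module ℂ V]

theorem box_T_apply {κ : Type} [Fintype κ] [DecidableEq κ] (Z : YM n A) (H : MRep n κ) (x : ℂ)
    (i j : Fin n) (β β' : κ) :
    (box Z H).T x i j β β' = ∑ b, H.L x b j β β' • Z.T x i b := by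
  rw [box_T, Matrix.sum_apply]
  refine Finset.sum_congr rfl fun b _ => ?_
  rw [mul_dg_apply, sc_apply, Algebra.smul_def]

theorem irr_left_part {κ : Type} [Fintype κ] [DecidableEq κ] [Nonempty κ] (Z : YM n A) (H : MRep n κ)
    (π : A →ₐ[ℂ] Module.End ℂ V) (h : Irr (box Z H) (mact π)) : Irr Z π := by
  intro S hS
  have hinv : Inv (box Z H) (mact π) (Submodule.pi Set.univ fun _ : κ => S) := by
    intro x i j v hv β _
    rw [mact_apply]
    refine S.sum_mem fun γ _ => ?_
    rw [box_T_apply, map_sum, LinearMap.sum_apply]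
    refine S.sum_mem fun b _ => ?_
    rw [map_smul, LinearMap.smul_apply]
    exact S.smul_mem _ (hS _ _ _ _ (hv γ trivial))
  obtain ⟨k⟩ := ‹Nonempty κ›
  rcases h _ hinv with h | h
  · left
    rw [eq_bot_iff]
    intro s hs
    have : (fun _ => s : κ → V) ∈ Submodule.pi Set.univ fun _ : κ => S := fun _ _ => hs
    rw [h] at this
    have := congrFun ((Submodule.mem_bot ℂ).1 this) k
    simpa using this
  · right
    rw [eq_top_iff]
    intro s _
    have : (fun _ => s : κ → V) ∈ Submodule.pi Set.univ fun _ : κ => S := by rw [h]; trivial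
    exact this k trivial

theorem irr_suffix [Nontrivial V] {κ μ : Type} [Fintype κ] [DecidableEq κ] [Fintype μ]
    [DecidableEq μ] (Z : YM n A) (H : MRep n κ) (M : MRep n μ) (π : A →ₐ[ℂ] Module.End ℂ V)
    (h : Irr (V := μ → κ → V) (box (box Z H) M) (mact (mact π))) :
    Irr (V := μ → κ → ℂ) (box (box (one n) H) M) (mact (mact π0)) := by
  intro U hU
  have key : ∀ x i j β β' α α', (box (box Z H) M).T x i j β β' α α'
      = ∑ c, (box (box (one n) H) M).T x c j β β' α α' • Z.T x i c := by
    intro x i j β β' α α'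
    rw [box_T_apply, Matrix.sum_apply]
    simp only [Matrix.smul_apply, box_T_apply, box_one_T, Matrix.sum_apply, Finset.smul_sum,
      Finset.sum_smul]
    rw [Finset.sum_comm]
    refine Finset.sum_congr rfl fun c _ => Finset.sum_congr rfl fun b _ => ?_
    simp [one, smul_smul]
  let S : Submodule ℂ (μ → κ → V) :=
    { carrier := {w | ∀ φ : V →ₗ[ℂ] ℂ, (fun β α => φ (w β α)) ∈ U}
      add_mem' := by
        intro a b ha hb φ
        have := U.add_mem (ha φ) (hb φ)
        convert this using 1
        funext β α
        simp
      zero_mem' := by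
        intro φ
        convert U.zero_mem using 1
        funext β α
        simp
      smul_mem' := by
        intro c a ha φ
        have := U.smul_mem c (ha φ)
        convert this using 1
        funext β α
        simp }
  have hS : Inv (box (box Z H) M) (mact (mact π)) S := by
    intro x i j w hw φ
    have h2 : (fun β α => φ ((mact (mact π) ((box (box Z H) M).T x i j) w) β α))
        = ∑ c, mact (mact π0) ((box (box (one n) H) M).T x c j) (fun β α => (φ ∘ₗ π (Z.T x i c)) (w β α)) := by
      funext β α
      rw [Finset.sum_apply, Finset.sum_apply]
      simp only [mact_apply, Finset.sum_apply, map_sum, key, LinearMap.sum_apply, map_smul,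
        LinearMap.smul_apply, LinearMap.comp_apply]
      conv_rhs => rw [Finset.sum_comm]
      refine Finset.sum_congr rfl fun β' _ => ?_
      conv_rhs => rw [Finset.sum_comm]
      refine Finset.sum_congr rfl fun α' _ => ?_
      refine Finset.sum_congr rfl fun c _ => ?_
      simp [π0, Algebra.ofId_apply]
    rw [h2]
    exact U.sum_mem fun c _ => hU x c j _ (hw (φ ∘ₗ π (Z.T x i c)))
  obtain ⟨v, hv⟩ := exists_ne (0 : V)
  obtain ⟨φ, hφ⟩ : ∃ φ : V →ₗ[ℂ] ℂ, φ v ≠ 0 := by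
    by_contra hcon
    push Not at hcon
    exact hv ((Module.forall_dual_apply_eq_zero_iff ℂ v).1 hcon)
  have hmem : ∀ u ∈ U, (fun β α => u β α • v : μ → κ → V) ∈ S := by
    intro u hu ψ
    have := U.smul_mem (ψ v) hu
    convert this using 1
    funext β α
    simp [mul_comm]
  rcases h S hS with h1 | h1
  · left
    rw [eq_bot_iff]
    intro u hu
    have := hmem u hu
    rw [h1, Submodule.mem_bot] at this
    rw [Submodule.mem_bot]
    funext β α
    have := congrFun (congrFun this β) α
    simpa [hv] using this
  · right
    rw [eq_top_iff]
    intro u _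
    have : (fun β α => u β α • v : μ → κ → V) ∈ S := by rw [h1]; trivial
    have := U.smul_mem (φ v)⁻¹ (this φ)
    convert this using 1
    funext β α
    simp
    field_simp

end multi

/-- An irreducible evaluation module together with its `R`-matrices. -/
structure Helper (n : ℕ) where
  m : ℕ
  H : MRep n (Fin m)
  F : RFam H
  real : Real F
  pos : 0 < m

instance {n : ℕ} (h : Helper n) : Nonempty (Fin h.m) := ⟨⟨0, h.pos⟩⟩

/-- A bundled RTT module. -/
structure BY (n : ℕ) where
  A : Type
  [ringA : Ring A]
  [algA : Algebra ℂ A]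
  [fdA : FiniteDimensional ℂ A]
  V : Type
  [addV : AddCommGroup V]
  [modV : Module ℂ V]
  [fdV : FiniteDimensional ℂ V]
  [ntV : Nontrivial V]
  π : A →ₐ[ℂ] Module.End ℂ V
  inj : Function.Injective π
  Y : YM n A

attribute [instance] BY.ringA BY.algA BY.fdA BY.addV BY.modV BY.fdV BY.ntV

noncomputable def BY.one (n : ℕ) : BY n where
  A := ℂ
  V := ℂ
  π := π0
  inj := π0_inj
  Y := YG.one n

noncomputable def BY.box {n m : ℕ} (Z : BY n) (H : MRep n (Fin m)) (hm : 0 < m) : BY n where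
  A := Matrix (Fin m) (Fin m) Z.A
  V := Fin m → Z.V
  ntV := haveI : Nonempty (Fin m) := ⟨⟨0, hm⟩⟩; Function.nontrivial
  π := mact Z.π
  inj := mact_injective _ Z.inj
  Y := YG.box Z.Y H

def BY.Irr {n : ℕ} (Z : BY n) : Prop := YG.Irr Z.Y Z.π

/-- The tensor product (list in reversed order). -/
noncomputable def prodL {n : ℕ} : List (Helper n) → BY n
  | [] => BY.one n
  | h :: t => (prodL t).box h.H h.pos

theorem isUnit_outer {A κ μ : Type} [Ring A] [Algebra ℂ A] [FiniteDimensional ℂ A] [Fintype κ]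
    [DecidableEq κ] [Fintype μ] [DecidableEq μ] [Nonempty κ] (r : Matrix μ μ A)
    (h : IsUnit (r.map (dg : A →ₐ[ℂ] Matrix κ κ A))) : IsUnit r := by
  obtain ⟨W, hW⟩ := h.exists_right_inv
  obtain ⟨k⟩ := ‹Nonempty κ›
  apply isUnit_of_right_inv r (Matrix.of fun γ β => W γ β k k)
  ext a b
  have := congrFun (congrFun (congrFun (congrFun hW a) b) k) k
  rw [Matrix.mul_apply, Matrix.sum_apply] at this
  simp only [Matrix.map_apply, dg_mul_apply] at this
  rw [Matrix.mul_apply]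
  simp only [Matrix.of_apply]
  rw [this, Matrix.one_apply, Matrix.one_apply]
  split_ifs <;> simp

section
variable {n : ℕ}

theorem lead_mult {A κ μ : Type} [Ring A] [Algebra ℂ A] [Fintype κ] [DecidableEq κ] [Fintype μ]
    [DecidableEq μ] {M : MRep n μ} (F : RFam M) (Z : YM n A) (H : MRep n κ) {r : Matrix μ μ A}
    {s : Matrix μ μ (Matrix κ κ ℂ)} (hr : Lead (F.R Z) r) (hs : Lead (F.R (box (one n) H)) s) :
    Lead (F.R (box Z H)) (r.map (dg : A →ₐ[ℂ] Matrix κ κ A) * s.map (scA : Matrix κ κ ℂ →ₐ[ℂ] Matrix κ κ A)) := by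
  have a1 : Lead (fun u => (F.R Z u).map dg) (r.map (dg : A →ₐ[ℂ] Matrix κ κ A)) :=
    hr.map (LinearMap.mapMatrix (dg : A →ₐ[ℂ] Matrix κ κ A).toLinearMap)
  have a2 : Lead (fun u => (F.R (box (one n) H) u).map (sc : _ → Matrix κ κ A)) (s.map (scA : Matrix κ κ ℂ →ₐ[ℂ] Matrix κ κ A)) :=
    hs.map (LinearMap.mapMatrix (scA : Matrix κ κ ℂ →ₐ[ℂ] Matrix κ κ A).toLinearMap)
  exact (a1.mul a2).congr fun u => F.mult Z H u

theorem isUnit_mapM {A B μ : Type} [Ring A] [Algebra ℂ A] [Ring B] [Algebra ℂ B] [Fintype μ]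
    [DecidableEq μ] (f : A →ₐ[ℂ] B) {r : Matrix μ μ A} (h : IsUnit r) : IsUnit (r.map f) :=
  h.map f.mapMatrix

theorem lead_unit_pair (h a : Helper n) (hI : (prodL [h, a]).Irr) :
    ∃ r, IsUnit r ∧ Lead (h.F.R (box (one n) a.H)) r := by
  obtain ⟨u, hu⟩ := (h.F.nondeg a.H).exists
  obtain ⟨r, hr0, hr⟩ := exists_lead (h.F.poly (box (one n) a.H)) hu.ne_zero
  exact ⟨r, thmA2 _ _ (mact_injective _ π0_inj) h.F hI hr hr0, hr⟩

theorem lead_unit_list (h : Helper n) (t : List (Helper n)) (hI : ∀ a ∈ t, (prodL [h, a]).Irr) :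
    ∃ r, IsUnit r ∧ Lead (h.F.R (prodL t).Y) r := by
  induction t with
  | nil =>
    refine ⟨1, isUnit_one, ?_⟩
    exact (Lead.const 1).congr fun u => h.F.unit u
  | cons a t ih =>
    obtain ⟨r, hru, hr⟩ := ih fun b hb => hI b (List.mem_cons_of_mem _ hb)
    obtain ⟨s, hsu, hs⟩ := lead_unit_pair h a (hI a List.mem_cons_self)
    exact ⟨_, (isUnit_mapM _ hru).mul (isUnit_mapM _ hsu), lead_mult h.F (prodL t).Y a.H hr hs⟩

theorem irr_cons_of (h : Helper n) (t : List (Helper n)) (hI : ∀ a ∈ t, (prodL [h, a]).Irr)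
    (ht : (prodL t).Irr) : (prodL (h :: t)).Irr := by
  obtain ⟨r, hru, hr⟩ := lead_unit_list h t hI
  exact thmA1 _ _ h.F h.real ht hr hru

theorem irr_cons_tail (h : Helper n) (t : List (Helper n)) (hI : (prodL (h :: t)).Irr) :
    (prodL t).Irr := irr_left_part _ _ _ hI

instance (Z : BY n) : Nontrivial Z.A := by
  refine ⟨1, 0, fun h => ?_⟩
  have h1 : (1 : Module.End ℂ Z.V) = 0 := by
    rw [← map_one Z.π, h, map_zero]
  obtain ⟨v, hv⟩ := exists_ne (0 : Z.V)
  exact hv (by simpa using LinearMap.congr_fun h1 v)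

theorem nondeg_list (h : Helper n) (t : List (Helper n)) :
    ∀ᶠ u in cofinite, IsUnit (h.F.R (prodL t).Y u) := by
  induction t with
  | nil =>
    refine Eventually.of_forall fun u => ?_
    have := h.F.unit u
    change IsUnit (h.F.R (one n) u)
    rw [this]
    exact isUnit_one
  | cons a t ih =>
    filter_upwards [ih, h.F.nondeg a.H] with u h1 h2
    change IsUnit (h.F.R (box (prodL t).Y a.H) u)
    rw [h.F.mult]
    have h3 : IsUnit ((h.F.R (box (one n) a.H) u).map
        (scA : Matrix (Fin a.m) (Fin a.m) ℂ →ₐ[ℂ] Matrix (Fin a.m) (Fin a.m) (prodL t).A)) :=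
      isUnit_mapM (scA : Matrix (Fin a.m) (Fin a.m) ℂ →ₐ[ℂ] Matrix (Fin a.m) (Fin a.m) (prodL t).A) h2
    exact (isUnit_mapM _ h1).mul h3

theorem irr_cons_pair (h : Helper n) (t : List (Helper n)) (hI : (prodL (h :: t)).Irr) :
    ∀ a ∈ t, (prodL [h, a]).Irr := by
  induction t with
  | nil => simp
  | cons a t ih =>
    have ha : (prodL [h, a]).Irr := irr_suffix (prodL t).Y a.H h.H (prodL t).π hI
    have ht : (prodL (h :: t)).Irr := by
      have hirr : (prodL t).Irr := irr_cons_tail a t (irr_cons_tail h _ hI)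
      obtain ⟨s, hsu, hs⟩ := lead_unit_pair h a ha
      have hsu' : IsUnit (s.map (scA : Matrix (Fin a.m) (Fin a.m) ℂ →ₐ[ℂ] Matrix (Fin a.m) (Fin a.m) (prodL t).A)) := isUnit_mapM _ hsu
      by_cases hz : ∀ u, h.F.R (prodL t).Y u = 0
      · exfalso
        obtain ⟨u, hu⟩ := (nondeg_list h t).exists
        exact hu.ne_zero (hz u)
      · push Not at hz
        obtain ⟨u, hu⟩ := hz
        obtain ⟨r, hr0, hr⟩ := exists_lead (h.F.poly (prodL t).Y) hu
        have hl := lead_mult h.F (prodL t).Y a.H hr hs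
        have hne : r.map (dg : (prodL t).A →ₐ[ℂ] Matrix (Fin a.m) (Fin a.m) (prodL t).A) ≠ 0 := by
          intro h0
          apply hr0
          ext b c
          have := congrFun (congrFun (congrFun (congrFun h0 b) c) ⟨0, a.pos⟩) ⟨0, a.pos⟩
          simpa [dg_apply] using this
        have hun := thmA2 _ _ (prodL (a :: t)).inj h.F hI hl (by
          intro h0
          exact hne ((hsu'.mul_left_eq_zero).1 h0))
        have hun2 : IsUnit (r.map (dg : (prodL t).A →ₐ[ℂ] Matrix (Fin a.m) (Fin a.m) (prodL t).A)) := by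
          obtain ⟨q, hq⟩ := hsu'
          rw [← hq] at hun
          exact (Units.isUnit_mul_units _ q).1 hun
        exact thmA1 _ _ h.F h.real hirr hr (isUnit_outer _ hun2)
    intro b hb
    rcases List.mem_cons.1 hb with rfl | hb
    · exact ha
    · exact ih ht b hb

theorem irr_list (t : List (Helper n)) :
    (prodL t).Irr ↔ t.Pairwise fun h a => (prodL [h, a]).Irr := by
  induction t with
  | nil =>
    simp only [List.Pairwise.nil, iff_true]
    intro S hS
    exact eq_bot_or_eq_top (α := Submodule ℂ ℂ) S
  | cons h t ih =>
    rw [List.pairwise_cons]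
    constructor
    · intro hI
      exact ⟨irr_cons_pair h t hI, ih.1 (irr_cons_tail h t hI)⟩
    · rintro ⟨h1, h2⟩
      exact irr_cons_of h t h1 (ih.2 h2)

end
end YG

namespace YG
open Filter

/-- Divided differences. -/
theorem exists_divdiff {D : Type} [Ring D] [Algebra ℂ D] (a : D) (m : Polynomial ℂ) :
    ∃ s : ℂ → D, PolyFun s ∧ (∀ u : ℂ, (a - u • 1) * s u = Polynomial.aeval a m - (m.eval u) • 1) ∧
      s 0 = Polynomial.aeval a m.divX := by
  induction m using Polynomial.induction_on' with
  | add p q hp hq =>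
    obtain ⟨s, h1, h2, h3⟩ := hp
    obtain ⟨t, k1, k2, k3⟩ := hq
    refine ⟨fun u => s u + t u, h1.add k1, fun u => ?_, ?_⟩
    · rw [mul_add, h2, k2, map_add, Polynomial.eval_add, add_smul]; abel
    · beta_reduce; rw [h3, k3, Polynomial.divX_add, map_add]
  | monomial k c =>
    refine ⟨fun u => c • ∑ i ∈ Finset.range k, u ^ (k - 1 - i) • a ^ i, ?_, ?_, ?_⟩
    · exact (PolyFun.sum _ fun i _ => PolyFun.mono _ _).csmul c
    · intro u
      have h := (Commute.smul_right (Commute.one_right a) u).mul_geom_sum₂ k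
      have e : ∑ i ∈ Finset.range k, a ^ i * (u • (1 : D)) ^ (k - 1 - i)
          = ∑ i ∈ Finset.range k, u ^ (k - 1 - i) • a ^ i := by
        refine Finset.sum_congr rfl fun i _ => ?_
        rw [smul_pow, one_pow, mul_smul_comm, mul_one]
      rw [e] at h
      rw [mul_smul_comm, h, Polynomial.aeval_monomial, Polynomial.eval_monomial, smul_pow, one_pow,
        smul_sub, smul_smul, Algebra.smul_def c]
    · cases k with
      | zero => simp
      | succ k =>
        have : (Polynomial.monomial (k + 1) c : Polynomial ℂ).divX = Polynomial.monomial k c := by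
          ext i
          rw [Polynomial.coeff_divX, Polynomial.coeff_monomial, Polynomial.coeff_monomial]
          simp
        beta_reduce
        rw [this, Polynomial.aeval_monomial, Finset.sum_eq_single k, Algebra.smul_def c]
        · simp
        · intro b hb hbk
          have : k - b ≠ 0 := by
            have := Finset.mem_range.1 hb
            omega
          simp [this]
        · simp

section swp
variable {ι ν A : Type} [Ring A] [Algebra ℂ A] [Fintype ι] [DecidableEq ι] [Fintype ν]
  [DecidableEq ν]

/-- Exchange of the order of tensor factors. -/
noncomputable def swp : Matrix ι ι (Matrix ν ν A) →ₐ[ℂ] Matrix ν ν (Matrix ι ι A) :=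
  AlgHom.ofLinearMap
    { toFun := fun m => Matrix.of fun α β => Matrix.of fun k l => m k l α β
      map_add' := by intro x y; rfl
      map_smul' := by intro x y; rfl }
    (by
      ext a b c d
      change (1 : Matrix ι ι (Matrix ν ν A)) c d a b = (1 : Matrix ν ν (Matrix ι ι A)) a b c d
      by_cases h : c = d <;> by_cases h' : a = b <;> simp [h, h', Matrix.one_apply])
    (by
      intro x y
      ext a b c d
      change (x * y) c d a b = ((Matrix.of fun α β => Matrix.of fun k l => x k l α β) *
        (Matrix.of fun α β => Matrix.of fun k l => y k l α β) : Matrix ν ν (Matrix ι ι A)) a b c d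
      simp only [Matrix.of_apply, Matrix.mul_apply, Matrix.sum_apply]
      rw [Finset.sum_comm])

theorem swp_apply (m : Matrix ι ι (Matrix ν ν A)) (a b : ν) (k l : ι) :
    swp m a b k l = m k l a b := rfl

theorem swp_sc (X : Matrix ι ι ℂ) : (swp (sc X : Matrix ι ι (Matrix ν ν ℂ)) : Matrix ν ν (Matrix ι ι ℂ)) = dg X := by
  ext a b k l
  rw [swp_apply, sc_apply, dg_apply, Matrix.algebraMap_matrix_apply]
  split_ifs <;> simp

theorem swp_dg (X : Matrix ν ν ℂ) : (swp (dg X : Matrix ι ι (Matrix ν ν ℂ)) : Matrix ν ν (Matrix ι ι ℂ)) = sc X := by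
  ext a b k l
  rw [swp_apply, sc_apply, dg_apply, Matrix.algebraMap_matrix_apply]
  split_ifs <;> simp

end swp

section sch
variable {n : ℕ} {ν : Type} [Fintype ν] [DecidableEq ν] (N : MRep n ν) (c : ℂ)

theorem commutant_scalar (hN : Irr (V := ν → ℂ) (box (one n) N) (mact π0)) (d : Matrix ν ν (Matrix (Fin n) (Fin n) ℂ))
    (h1 : ∀ i j, Commute d (dg (Matrix.single j i 1))) (h2 : ∀ i j, Commute d (sc (N.e i j))) :
    ∃ z : ℂ, d = z • 1 := by
  rcases isEmpty_or_nonempty (Fin n) with hn | hn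
  · refine ⟨0, ?_⟩
    ext a b k l
    exact hn.elim k
  obtain ⟨k0⟩ := hn
  have h3 : ∀ α β, ∃ z : ℂ, d α β = z • 1 := by
    intro α β
    have : d α β ∈ Set.range (Matrix.scalar (Fin n)) := by
      apply Matrix.mem_range_scalar_of_commute_single
      intro i j hij
      have h := congrFun (congrFun (h1 j i).eq α) β
      rw [mul_dg_apply, dg_mul_apply] at h
      exact h.symm
    obtain ⟨z, hz⟩ := this
    refine ⟨z, ?_⟩
    rw [← hz]
    ext a b
    simp [Matrix.scalar_apply, Matrix.diagonal_apply, Matrix.one_apply]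
  choose z hz using h3
  have hd : d = sc (Matrix.of z) := by
    ext1 a b
    rw [hz, sc_apply, Algebra.algebraMap_eq_smul_one, Matrix.of_apply]
  have hcomm : ∀ i j, Matrix.of z * N.e i j = N.e i j * Matrix.of z := by
    intro i j
    have h := (h2 i j).eq
    rw [hd, ← sc_mul, ← sc_mul] at h
    ext a b
    have := congrFun (congrFun (congrFun (congrFun h a) b) k0) k0
    rw [sc_apply, sc_apply, Matrix.algebraMap_matrix_apply, Matrix.algebraMap_matrix_apply, if_pos rfl] at this
    simpa using this
  obtain ⟨q, hq⟩ := schur (V := ν → ℂ) _ _ (mact_injective _ π0_inj) hN (Matrix.of z) (by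
    intro x i j
    rw [box_one_T, MRep.L, mul_add, add_mul, hcomm]
    split_ifs <;> simp)
  refine ⟨q, ?_⟩
  rw [hd, hq, sc_smul, sc_one]

theorem sch_poly (hN : Irr (V := ν → ℂ) (box (one n) N) (mact π0))
    (W : Fin n → Fin n → Matrix ν ν (Matrix (Fin n) (Fin n) ℂ)) (m : ℕ) :
    ∀ (d : ℕ → Matrix ν ν (Matrix (Fin n) (Fin n) ℂ)),
    (∀ (u : ℂ) i j, Commute (∑ r ∈ Finset.range m, u ^ r • d r) (sc (N.e i j) - dg (Matrix.single j i 1))) →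
    (∀ (u : ℂ) i j, Commute (∑ r ∈ Finset.range m, u ^ r • d r) ((c - u) • dg (Matrix.single j i 1) + W i j)) →
    ∃ g : ℂ → ℂ, PolyFun g ∧ ∀ u : ℂ, ∑ r ∈ Finset.range m, u ^ r • d r = g u • 1 := by
  induction m with
  | zero =>
    intro d _ _
    exact ⟨fun _ => 0, PolyFun.const _, by simp⟩
  | succ m ih =>
    intro d h1 h2
    have hp : PolyFun (fun v : ℂ => ∑ r ∈ Finset.range (m + 1), v ^ (m - r) • d r) :=
      PolyFun.sum _ fun i _ => PolyFun.mono _ _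
    have h0 : ∑ r ∈ Finset.range (m + 1), (0 : ℂ) ^ (m - r) • d r = d m := by
      rw [Finset.sum_eq_single m]
      · simp
      · intro b hb hbk
        have : m - b ≠ 0 := by
          have := Finset.mem_range.1 hb
          omega
        simp [this]
      · simp
    have hrev : ∀ v : ℂ, v ≠ 0 → ∑ r ∈ Finset.range (m + 1), v ^ (m - r) • d r
        = v ^ m • ∑ r ∈ Finset.range (m + 1), (v⁻¹) ^ r • d r := by
      intro v hv
      rw [Finset.smul_sum]
      refine Finset.sum_congr rfl fun r hr => ?_
      have := Finset.mem_range.1 hr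
      rw [smul_smul]
      congr 1
      rw [pow_sub₀ _ hv (by omega), inv_pow]
    have c1 : ∀ i j, Commute (d m) (sc (N.e i j) - dg (Matrix.single j i 1)) := by
      intro i j
      have p1 := hp.mul (PolyFun.const (sc (N.e i j) - dg (Matrix.single j i 1)))
      have p2 := (PolyFun.const (sc (N.e i j) - dg (Matrix.single j i 1))).mul hp
      have := PolyFun.eq_of_ne p1 p2 0 (fun v hv => by
        beta_reduce
        rw [hrev v hv]
        exact ((h1 v⁻¹ i j).smul_left _).eq) 0
      beta_reduce at this
      rw [h0] at this
      exact this
    have c2 : ∀ i j, Commute (d m) (dg (Matrix.single j i 1)) := by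
      intro i j
      have p0 : PolyFun (fun v : ℂ => (v * c - 1) • (dg (Matrix.single j i 1) : Matrix ν ν (Matrix (Fin n) (Fin n) ℂ)) + v • W i j) := by
        refine PolyFun.add (PolyFun.smul ?_ (PolyFun.const _)) (PolyFun.id_smul _)
        exact (PolyFun.id.mul (PolyFun.const c)).sub (PolyFun.const 1)
      have p1 := hp.mul p0
      have p2 := p0.mul hp
      have := PolyFun.eq_of_ne p1 p2 0 (fun v hv => by
        beta_reduce
        rw [hrev v hv]
        have e : (v * c - 1) • (dg (Matrix.single j i 1) : Matrix ν ν (Matrix (Fin n) (Fin n) ℂ)) + v • W i j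
          = v • ((c - v⁻¹) • dg (Matrix.single j i 1) + W i j) := by
          rw [smul_add, smul_smul, mul_sub, mul_inv_cancel₀ hv]
        rw [e]
        exact (((h2 v⁻¹ i j).smul_left _).smul_right _).eq) 0
      beta_reduce at this
      rw [h0] at this
      simp only [zero_mul, zero_sub, neg_smul, one_smul, zero_smul, add_zero, mul_neg, neg_mul, neg_inj] at this
      exact this
    have c3 : ∀ i j, Commute (d m) (sc (N.e i j)) := by
      intro i j
      have := (c1 i j).add_right (c2 i j)
      rwa [sub_add_cancel] at this
    obtain ⟨z, hz⟩ := commutant_scalar N hN (d m) c2 c3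
    have hcz : ∀ (u : ℂ) (y : Matrix ν ν (Matrix (Fin n) (Fin n) ℂ)), Commute (u ^ m • d m) y := by
      intro u y
      rw [hz]
      exact ((Commute.one_left y).smul_left z).smul_left _
    obtain ⟨g, hg, hg'⟩ := ih d (fun u i j => by
        have := (h1 u i j).sub_left (hcz u _)
        rwa [Finset.sum_range_succ, add_sub_cancel_right] at this) (fun u i j => by
        have := (h2 u i j).sub_left (hcz u _)
        rwa [Finset.sum_range_succ, add_sub_cancel_right] at this)
    refine ⟨fun u => g u + u ^ m * z, hg.add ((PolyFun.id.pow m).mul (PolyFun.const z)), fun u => ?_⟩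
    rw [Finset.sum_range_succ, hg', hz, add_smul, smul_smul]

theorem commute_of_eq {B : Type} [Ring B] {a x y : B} (h : Commute a x) (e : x = y) : Commute a y := e ▸ h

set_option maxHeartbeats 1000000 in
theorem G_scalar (hN : Irr (V := ν → ℂ) (box (one n) N) (mact π0)) (F : RFam N) :
    ∃ g : ℂ → ℂ, PolyFun g ∧ ∀ u : ℂ,
      F.R (box (one n) (xrep n c)) u * swp (Matrix.of (N.L (c - u))) = g u • 1 := by
  have hpL : PolyFun (fun u => swp (Matrix.of (N.L (c - u)))) := by
    have := ((xFam n c).poly (box (one n) N)).map (swp : _ →ₐ[ℂ] Matrix ν ν (Matrix (Fin n) (Fin n) ℂ)).toLinearMap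
    have h2 := this.comp PolyFun.id.neg
    refine (congrArg PolyFun (funext fun u => ?_)).mp h2
    refine congrArg (swp : _ →ₐ[ℂ] Matrix ν ν (Matrix (Fin n) (Fin n) ℂ)) (Eq.symm ?_)
    change _ = (xFam n c).R (box (one n) N) (-u)
    ext1 i j
    change _ = (box (one n) N).T (c + -u) i j
    rw [box_one_T, ← sub_eq_add_neg]
    rfl
  have hp := (F.poly (box (one n) (xrep n c))).mul hpL
  obtain ⟨m, d, hd⟩ := hp.exists_sum
  let tt : ℂ → ℂ → Fin n → Fin n → Matrix ν ν (Matrix (Fin n) (Fin n) ℂ) := fun u x i j =>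
    ∑ a, sc (N.L (x - u) i a) * dg ((xrep n c).L x a j)
  have hc : ∀ u x i j, Commute (F.R (box (one n) (xrep n c)) u * swp (Matrix.of (N.L (c - u)))) (tt u x i j) := by
    intro u x i j
    have e1 : swp (Matrix.of (N.L (c - u))) * tt u x i j = (∑ a, sc (N.L (x - u) a j) * dg ((xrep n c).L x i a)) * swp (Matrix.of (N.L (c - u))) := by
      have h := congrArg (swp : _ →ₐ[ℂ] Matrix ν ν (Matrix (Fin n) (Fin n) ℂ)) ((xFam n c).inter (box (one n) N) (x - u) (-u) i j)
      have e : (xFam n c).R (box (one n) N) (-u) = Matrix.of (N.L (c - u)) := by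
        ext1 i j
        change (box (one n) N).T (c + -u) i j = _
        rw [box_one_T, ← sub_eq_add_neg]
        rfl
      simp only [e, map_mul, map_sum, swp_sc, swp_dg, box_one_T, sub_neg_eq_add, sub_add_cancel] at h
      simp only [tt]
      simp only [dg_sc] at h
      exact h
    have e2 : F.R (box (one n) (xrep n c)) u * (∑ a, sc (N.L (x - u) a j) * dg ((xrep n c).L x i a))
        = tt u x i j * F.R (box (one n) (xrep n c)) u := by
      have h := F.inter (box (one n) (xrep n c)) x u i j
      simp only [box_one_T] at h
      exact h
    rw [Commute, SemiconjBy, mul_assoc, e1, ← mul_assoc, e2, mul_assoc]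
  have htt : ∀ u x i j, tt u x i j = (if i = j then ((x - u) * (x - c)) • 1 else 0)
      + (x - c) • sc (N.e i j) - (x - u) • dg (Matrix.single j i 1)
      - ∑ a, sc (N.e i a) * dg (Matrix.single j a 1) := by
    intro u x i j
    have e : ∀ a, (sc (N.L (x - u) i a) * dg ((xrep n c).L x a j) : Matrix ν ν (Matrix (Fin n) (Fin n) ℂ))
        = (if i = a then (if a = j then ((x - u) * (x - c)) • 1 else 0) else 0)
         + (if a = j then (x - c) • sc (N.e i a) else 0) - (if i = a then (x - u) • dg (Matrix.single j a 1) else 0)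
         - sc (N.e i a) * dg (Matrix.single j a 1) := by
      intro a
      rw [xrep_L, MRep.L]
      rcases eq_or_ne a j with h2 | h2
      · subst h2
        by_cases h1 : i = a <;>
        simp only [h1, if_true, if_false, sc_add, sc_smul, sc_one, sc_zero, map_sub, map_smul, map_one, map_zero,
          add_mul, mul_sub, smul_mul_assoc, mul_smul_comm, one_mul, mul_one, zero_mul, mul_zero] <;> module
      by_cases h1 : i = a <;>
        simp only [h1, h2, if_true, if_false, sc_add, sc_smul, sc_one, sc_zero, map_sub, map_smul, map_one, map_zero,
          add_mul, mul_sub, smul_mul_assoc, mul_smul_comm, one_mul, mul_one, zero_mul, mul_zero] <;> module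
    simp only [tt, e, Finset.sum_sub_distrib, Finset.sum_add_distrib, Finset.sum_ite_eq, Finset.sum_ite_eq',
      Finset.mem_univ, if_true]
  have hone : ∀ (y : Matrix ν ν (Matrix (Fin n) (Fin n) ℂ)) (z : ℂ) (i j : Fin n), Commute y (if i = j then z • 1 else 0) := by
    intro y z i j
    split_ifs
    · exact (Commute.one_right y).smul_right z
    · exact Commute.zero_right y
  have hA : ∀ u i j, Commute (F.R (box (one n) (xrep n c)) u * swp (Matrix.of (N.L (c - u))))
      ((c - u) • dg (Matrix.single j i 1) + ∑ a, sc (N.e i a) * dg (Matrix.single j a 1)) := by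
    intro u i j
    have h1 := hc u c i j
    have h2 := ((hone _ ((c - u) * (c - c)) i j).sub_right h1)
    rw [htt] at h2
    refine commute_of_eq h2 ?_
    rw [sub_self, zero_smul]
    abel
  obtain ⟨g, hg, hg'⟩ := sch_poly N c hN (fun i j => ∑ a, sc (N.e i a) * dg (Matrix.single j a 1)) m d
    (fun u i j => by
      rw [← hd]
      have h1 := hc u (c + 1) i j
      rw [htt] at h1
      have h2 := (h1.sub_right (hone _ ((c + 1 - u) * (c + 1 - c)) i j)).add_right (hA u i j)
      have e5 : c + 1 - c = 1 := by ring
      rw [e5] at h2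
      refine commute_of_eq h2 ?_
      module) (fun u i j => by rw [← hd]; exact hA u i j)
  exact ⟨g, hg, fun u => by rw [← hg', ← hd]⟩

end sch
end YG

namespace YG
open Filter

section lact
variable {I J K V : Type} [Fintype I] [Fintype J] [Fintype K] [DecidableEq I] [DecidableEq J] [AddCommGroup V] [Module ℂ V]

/-- Action of scalar matrices on tuples. -/
noncomputable def lact (V : Type) [AddCommGroup V] [Module ℂ V] (X : Matrix I J ℂ) : (J → V) →ₗ[ℂ] (I → V) :=
  LinearMap.pi fun i => ∑ j, X i j • LinearMap.proj j

theorem lact_apply (X : Matrix I J ℂ) (w : J → V) (i : I) : lact V X w i = ∑ j, X i j • w j := by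
  simp [lact, LinearMap.sum_apply]

theorem lact_mul (X : Matrix I J ℂ) (Y : Matrix J K ℂ) (w : K → V) :
    lact V (X * Y) w = lact V X (lact V Y w) := by
  funext i
  simp only [lact_apply, Matrix.mul_apply, Finset.sum_smul, Finset.smul_sum, smul_smul]
  rw [Finset.sum_comm]

theorem lact_one (w : I → V) : lact V (1 : Matrix I I ℂ) w = w := by
  funext i
  simp [lact_apply, Matrix.one_apply]

theorem lact_zero (w : J → V) : lact V (0 : Matrix I J ℂ) w = 0 := by
  funext i
  simp [lact_apply]

theorem lact_smul (c : ℂ) (X : Matrix I J ℂ) (w : J → V) : lact V (c • X) w = c • lact V X w := by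
  funext i
  simp [lact_apply, Finset.smul_sum, smul_smul]

theorem lact_comp {W : Type} [AddCommGroup W] [Module ℂ W] (T : V →ₗ[ℂ] W) (X : Matrix I J ℂ) (w : J → V) :
    lact W X (fun j => T (w j)) = fun i => T (lact V X w i) := by
  funext i
  simp [lact_apply, map_sum]

end lact

section ofB
variable {ι ν V : Type} [Fintype ι] [DecidableEq ι] [Fintype ν] [DecidableEq ν] [AddCommGroup V] [Module ℂ V]

/-- Flattening. -/
noncomputable def unc (ι ν V : Type) [AddCommGroup V] [Module ℂ V] : (ν → ι → V) ≃ₗ[ℂ] (ι × ν → V) where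
  toFun w p := w p.2 p.1
  invFun w α k := w (k, α)
  map_add' x y := rfl
  map_smul' x y := rfl
  left_inv w := rfl
  right_inv w := rfl

theorem unc_apply (w : ν → ι → V) (p : ι × ν) : unc ι ν V w p = w p.2 p.1 := rfl

/-- Flattening of block matrices. -/
noncomputable def ofB : Matrix ν ν (Matrix ι ι ℂ) →ₐ[ℂ] Matrix (ι × ν) (ι × ν) ℂ :=
  AlgHom.ofLinearMap
    { toFun := fun m => Matrix.of fun p q => m p.2 q.2 p.1 q.1
      map_add' := by intro x y; rfl
      map_smul' := by intro x y; rfl }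
    (by
      ext ⟨k, α⟩ ⟨l, β⟩
      change (1 : Matrix ν ν (Matrix ι ι ℂ)) α β k l = (1 : Matrix (ι × ν) (ι × ν) ℂ) (k, α) (l, β)
      by_cases h : α = β <;> by_cases h' : k = l <;> simp [h, h', Matrix.one_apply])
    (by
      intro x y
      ext ⟨k, α⟩ ⟨l, β⟩
      change (x * y) α β k l = ((Matrix.of fun p q => x p.2 q.2 p.1 q.1) *
        (Matrix.of fun p q => y p.2 q.2 p.1 q.1) : Matrix (ι × ν) (ι × ν) ℂ) (k, α) (l, β)
      simp only [Matrix.of_apply, Matrix.mul_apply, Matrix.sum_apply, Fintype.sum_prod_type]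
      rw [Finset.sum_comm])

theorem ofB_apply (m : Matrix ν ν (Matrix ι ι ℂ)) (p q : ι × ν) :
    ofB m p q = m p.2 q.2 p.1 q.1 := rfl

theorem ofB_inj : Function.Injective (ofB : Matrix ν ν (Matrix ι ι ℂ) →ₐ[ℂ] _) := by
  intro x y h
  ext α β k l
  exact congrFun (congrFun h (k, α)) (l, β)

theorem ofB_sc (X : Matrix ν ν ℂ) : ofB (sc X : Matrix ν ν (Matrix ι ι ℂ)) = inR X := by
  ext ⟨k, α⟩ ⟨l, β⟩
  rw [ofB_apply, inR_apply, sc_apply, Matrix.algebraMap_matrix_apply]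
  rfl

theorem ofB_dg (X : Matrix ι ι ℂ) : ofB (dg X : Matrix ν ν (Matrix ι ι ℂ)) = inL X := by
  ext ⟨k, α⟩ ⟨l, β⟩
  rw [ofB_apply, inL_apply, dg_apply]
  by_cases h : α = β <;> simp [h]

theorem unc_mact {A : Type} [Ring A] [Algebra ℂ A] (π : A →ₐ[ℂ] Module.End ℂ V) (X : Matrix ν ν (Matrix ι ι ℂ)) (w : ν → ι → V) :
    unc ι ν V (mact (mact π) (X.map (scA : Matrix ι ι ℂ →ₐ[ℂ] Matrix ι ι A)) w) = lact V (ofB X) (unc ι ν V w) := by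
  funext ⟨k, α⟩
  rw [unc_apply, mact_apply, Finset.sum_apply, lact_apply, Fintype.sum_prod_type, Finset.sum_comm]
  refine Finset.sum_congr rfl fun β _ => ?_
  rw [mact_apply]
  refine Finset.sum_congr rfl fun l _ => ?_
  simp [scA_eq, sc_apply, ofB_apply, unc_apply]

end ofB

section spec
variable {n : ℕ} {ν μ : Type} [Fintype ν] [DecidableEq ν] [Fintype μ] [DecidableEq μ]
  {N : MRep n ν} {M : MRep n μ} {c : ℂ} (f : Fuse N M c)

theorem ofB_swp (N : MRep n ν) (c : ℂ) : ofB (swp (Matrix.of (N.L c))) = Aop N c := rfl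

theorem swp_shift (N : MRep n ν) (c u : ℂ) :
    swp (Matrix.of (N.L (c - u))) = swp (Matrix.of (N.L c)) - u • (1 : Matrix ν ν (Matrix (Fin n) (Fin n) ℂ)) := by
  ext α β k l
  simp only [swp_apply, Matrix.sub_apply, Matrix.smul_apply, Matrix.of_apply, MRep.L]
  by_cases h : α = β <;> by_cases h' : k = l <;> simp [h, h', Matrix.one_apply]
  ring

theorem exists_spec (P : Polynomial ℂ) (hP : Aop N c * Polynomial.aeval (Aop N c) P = 0) :
    ∃ s : ℂ → Matrix ν ν (Matrix (Fin n) (Fin n) ℂ), PolyFun s ∧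
      (∀ u, (swp (Matrix.of (N.L c)) - u • (1 : Matrix ν ν (Matrix (Fin n) (Fin n) ℂ))) * s u = (-(u * P.eval u)) • 1) ∧
      ofB (s 0) = Polynomial.aeval (Aop N c) P := by
  obtain ⟨s, h1, h2, h3⟩ := exists_divdiff (swp (Matrix.of (N.L c)) : Matrix ν ν (Matrix (Fin n) (Fin n) ℂ)) (Polynomial.X * P)
  refine ⟨s, h1, fun u => ?_, ?_⟩
  · rw [h2, map_mul, Polynomial.aeval_X]
    have : (swp (Matrix.of (N.L c)) : Matrix ν ν (Matrix (Fin n) (Fin n) ℂ)) * Polynomial.aeval (swp (Matrix.of (N.L c)) : Matrix ν ν (Matrix (Fin n) (Fin n) ℂ)) P = 0 := by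
      apply ofB_inj
      rw [map_mul, map_zero, ← Polynomial.aeval_algHom_apply, ofB_swp]
      exact hP
    rw [this, zero_sub, neg_smul]
    simp
  · have : (Polynomial.X * P).divX = P := by
      ext i
      rw [Polynomial.coeff_divX, Polynomial.coeff_X_mul]
    rw [h3, ← Polynomial.aeval_algHom_apply, ofB_swp, this]

theorem Fuse.aeval_phi (P : Polynomial ℂ) : Polynomial.aeval (Aop N c) P * f.φ = P.eval 0 • f.φ := by
  conv_lhs => rw [← Polynomial.divX_mul_X_add P]
  rw [map_add, map_mul, Polynomial.aeval_X, Matrix.add_mul, Matrix.mul_assoc, f.Aφ, Matrix.mul_zero, zero_add,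
    Polynomial.aeval_C, Algebra.algebraMap_eq_smul_one, Matrix.smul_mul, Matrix.one_mul, Polynomial.coeff_zero_eq_eval_zero]

/-- The fundamental helper is real. -/
theorem xreal (n : ℕ) (c : ℂ) : Real (xFam n c) := by
  refine ⟨-1, by simp, 0, _, (xFam n c).poly (box (one n) (xrep n c)), by simp, ?_⟩
  ext i j k l
  change (box (one n) (xrep n c)).T (c + 0) i j k l = _
  rw [box_one_T, xrep_L]
  simp only [add_zero, sub_self, zero_smul, Matrix.smul_apply, Flip_apply, Matrix.single_apply, Matrix.sub_apply]
  by_cases h : i = l <;> by_cases h' : j = k <;> by_cases h2 : i = j <;> simp [h, h', h2, eq_comm] <;> split_ifs <;> simp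

end spec
end YG

namespace YG
open Filter

section step
variable {n : ℕ} {ν μ : Type} [Fintype ν] [DecidableEq ν] [Fintype μ] [DecidableEq μ]
  {N : MRep n ν} {M : MRep n μ} {c : ℂ} (f : Fuse N M c)

theorem Fuse.phi_ne [Nonempty μ] : f.φ ≠ 0 := by
  intro h
  have := f.ψφ
  rw [h, Matrix.mul_zero] at this
  exact zero_ne_one this

theorem Fuse.nonempty {N : MRep n ν} {M : MRep n μ} {c : ℂ} (f : Fuse N M c) [Nonempty μ] : Nonempty (Fin n) := by
  by_contra h
  rw [not_nonempty_iff] at h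
  apply f.phi_ne
  ext ⟨k, _⟩ _
  exact h.elim k

/-- The data of the `R`-matrix on `X ⊗ N`. -/
structure SD (F : RFam N) (c : ℂ) (P : Polynomial ℂ) where
  s : ℂ → Matrix ν ν (Matrix (Fin n) (Fin n) ℂ)
  g : ℂ → ℂ
  sp : PolyFun s
  gp : PolyFun g
  as : ∀ u, (swp (Matrix.of (N.L c)) - u • (1 : Matrix ν ν (Matrix (Fin n) (Fin n) ℂ))) * s u = (-(u * P.eval u)) • 1
  s0 : ofB (s 0) = Polynomial.aeval (Aop N c) P
  rel : ∀ u, (-(u * P.eval u)) • F.R (box (one n) (xrep n c)) u = g u • s u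
  u₁ : ℂ
  g1 : g u₁ ≠ 0

theorem exists_SD [Nonempty ν] [Nonempty (Fin n)] (F : RFam N) (hN : Irr (V := ν → ℂ) (box (one n) N) (mact π0))
    (P : Polynomial ℂ) (hP : Aop N c * Polynomial.aeval (Aop N c) P = 0) : Nonempty (SD F c P) := by
  obtain ⟨s, hs, h2, h3⟩ := exists_spec P hP
  obtain ⟨g, hg, hg2⟩ := G_scalar N c hN F
  obtain ⟨u, hu1, hu2⟩ := ((F.nondeg (xrep n c)).and (ev_isUnit (-(swp (Matrix.of (N.L c)) : Matrix ν ν (Matrix (Fin n) (Fin n) ℂ))))).exists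
  refine ⟨⟨s, g, hs, hg, h2, h3, fun u => ?_, u, ?_⟩⟩
  · have h := hg2 u
    rw [swp_shift] at h
    have h4 := congrArg (· * s u) h
    beta_reduce at h4
    rw [mul_assoc, h2, mul_smul_comm, mul_one, smul_mul_assoc, one_mul] at h4
    exact h4
  · intro h0
    have h := hg2 u
    rw [h0, zero_smul, swp_shift] at h
    have h5 : IsUnit (swp (Matrix.of (N.L c)) - u • (1 : Matrix ν ν (Matrix (Fin n) (Fin n) ℂ))) := by
      have := hu2.neg
      rwa [neg_add, neg_neg, ← sub_eq_neg_add] at this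
    have h6 := hu1.mul h5
    rw [h] at h6
    exact not_isUnit_zero h6

variable {F : RFam N} {P : Polynomial ℂ} (D : SD F c P)

theorem SD.poly_q (P : Polynomial ℂ) : PolyFun (fun u => P.eval u) := by
  have : (fun u => P.eval u) = fun u => ∑ i ∈ Finset.range (P.natDegree + 1), P.coeff i * u ^ i := by
    funext u
    rw [Polynomial.eval_eq_sum_range]
  rw [this]
  exact PolyFun.sum _ fun i _ => (PolyFun.const _).mul (PolyFun.id.pow i)

theorem SD.poly_p (P : Polynomial ℂ) : PolyFun (fun u => -(u * P.eval u)) :=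
  (PolyFun.id.mul (SD.poly_q P)).neg

theorem SD.exists_p (P : Polynomial ℂ) (hP0 : P.eval 0 ≠ 0) : ∀ᶠ u in cofinite, -(u * P.eval u) ≠ 0 := by
  filter_upwards [ev_ne 0, (SD.poly_q P).cofinite_ne hP0] with u h1 h2
  exact neg_ne_zero.2 (mul_ne_zero h1 h2)

theorem SD.s0_ne {F : RFam N} {P : Polynomial ℂ} (D : SD F c P) (f : Fuse N M c) [Nonempty μ] (hP0 : P.eval 0 ≠ 0) : D.s 0 ≠ 0 := by
  intro h
  have h1 := f.aeval_phi P
  rw [← D.s0, h, map_zero, Matrix.zero_mul] at h1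
  exact smul_ne_zero hP0 f.phi_ne h1.symm

theorem SD.leadG {F : RFam N} {P : Polynomial ℂ} (D : SD F c P) (f : Fuse N M c) [Nonempty μ] [Nonempty ν] (hP0 : P.eval 0 ≠ 0) :
    ∃ κ : ℂ, κ ≠ 0 ∧ Lead (F.R (box (one n) (xrep n c))) (κ • D.s 0) := by
  haveI := f.nonempty
  obtain ⟨u, hu⟩ := (F.nondeg (xrep n c)).exists
  obtain ⟨r, hr0, hr⟩ := exists_lead (F.poly (box (one n) (xrep n c))) hu.ne_zero
  have hs : Lead D.s (D.s 0) := ⟨0, D.s, D.sp, by simp, rfl⟩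
  obtain ⟨u2, hu2⟩ := (SD.exists_p P hP0).exists
  obtain ⟨κ, h1, h2⟩ := hr.unique hs hr0 (D.s0_ne f hP0) (SD.poly_p P) D.gp hu2 D.g1 D.rel
  exact ⟨κ, h1, h2 ▸ hr⟩

/-- The embedding of `M`. -/
noncomputable def Fuse.Phi : (μ → ℂ) →ₗ[ℂ] (Fin n → ν → ℂ) :=
  LinearMap.pi fun k => LinearMap.pi fun α => ∑ γ, f.φ (k, α) γ • LinearMap.proj γ

theorem Fuse.Phi_apply (v : μ → ℂ) (k : Fin n) (α : ν) : f.Phi v k α = ∑ γ, f.φ (k, α) γ * v γ := by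
  simp [Fuse.Phi, LinearMap.sum_apply]

theorem Fuse.Phi_inj (v : μ → ℂ) (h : f.Phi v = 0) : v = 0 := by
  have h1 : lact ℂ f.φ v = 0 := by
    funext ⟨k, α⟩
    rw [lact_apply]
    have := congrFun (congrFun h k) α
    rw [f.Phi_apply] at this
    exact this
  have h2 := lact_mul (V := ℂ) f.ψ f.φ v
  rwa [h1, map_zero, f.ψφ, lact_one] at h2

theorem Fuse.A_Phi (v : μ → ℂ) (k : Fin n) (α : ν) :
    ∑ β, ∑ l, N.L c k l α β * f.Phi v l β = 0 := by
  have h2 := congrFun (lact_mul (V := ℂ) (Aop N c) f.φ v) (k, α)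
  rw [f.Aφ, lact_zero, lact_apply, Fintype.sum_prod_type, Finset.sum_comm] at h2
  rw [← Pi.zero_apply (M := fun _ => ℂ) (k, α), h2]
  refine Finset.sum_congr rfl fun β _ => Finset.sum_congr rfl fun l _ => ?_
  rw [f.Phi_apply, lact_apply]
  rfl

theorem Fuse.Phi_inter (x : ℂ) (i j : Fin n) (v : μ → ℂ) :
    mact (mact π0) ((box (box (one n) N) (xrep n c)).T x i j) (f.Phi v)
      = (x - c) • f.Phi (mact π0 ((box (one n) M).T x i j) v) := by
  have h := congrArg (fun X => lact ℂ X v) (f.tau x i j)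
  beta_reduce at h
  rw [lact_mul, lact_smul, lact_mul] at h
  funext k α
  have h2 := congrFun h (k, α)
  rw [lact_apply, Fintype.sum_prod_type] at h2
  rw [mact_apply, Finset.sum_apply]
  have e1 : ∑ l, ∑ β, tauop N c x i j (k, α) (l, β) • lact ℂ f.φ v (l, β)
      = ∑ l, mact π0 ((box (box (one n) N) (xrep n c)).T x i j k l) (f.Phi v l) α := by
    refine Finset.sum_congr rfl fun l _ => ?_
    rw [mact_apply]
    refine Finset.sum_congr rfl fun β _ => ?_
    have e2 : (box (box (one n) N) (xrep n c)).T x i j k l α β = tauop N c x i j (k, α) (l, β) := by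
      rw [box_T_apply, Matrix.sum_apply, tauop, Matrix.sum_apply]
      refine Finset.sum_congr rfl fun b _ => ?_
      rw [inR_mul_inL, box_one_T, Matrix.smul_apply, smul_eq_mul, mul_comm]
    rw [e2, f.Phi_apply, lact_apply]
    rfl
  rw [← e1]
  refine h2.trans ?_
  rw [Pi.smul_apply, Pi.smul_apply, Pi.smul_apply, f.Phi_apply, lact_apply]
  congr 1
  refine Finset.sum_congr rfl fun γ _ => ?_
  rw [lact_apply, mact_apply, box_one_T]
  rfl

end step
end YG

namespace YG
open Filter

section step2
variable {n : ℕ} {ν μ : Type} [Fintype ν] [DecidableEq ν] [Fintype μ] [DecidableEq μ]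

/-- Auxiliary algebra morphism. -/
noncomputable def mdg (n : ℕ) (ν : Type) [Fintype ν] [DecidableEq ν] :
    Matrix ν ν (Matrix ν ν ℂ) →ₐ[ℂ] Matrix ν ν (Matrix (Fin n) (Fin n) (Matrix ν ν ℂ)) :=
  (dg : Matrix ν ν ℂ →ₐ[ℂ] Matrix (Fin n) (Fin n) (Matrix ν ν ℂ)).mapMatrix

/-- Auxiliary algebra morphism. -/
noncomputable def msc (n : ℕ) (ν : Type) [Fintype ν] [DecidableEq ν] :
    Matrix ν ν (Matrix (Fin n) (Fin n) ℂ) →ₐ[ℂ] Matrix ν ν (Matrix (Fin n) (Fin n) (Matrix ν ν ℂ)) :=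
  (scA : Matrix (Fin n) (Fin n) ℂ →ₐ[ℂ] Matrix (Fin n) (Fin n) (Matrix ν ν ℂ)).mapMatrix

/-- Auxiliary representation. -/
noncomputable def rho (n : ℕ) (ν : Type) [Fintype ν] [DecidableEq ν] :
    Matrix ν ν (Matrix (Fin n) (Fin n) (Matrix ν ν ℂ)) →ₐ[ℂ] Module.End ℂ (ν → Fin n → ν → ℂ) :=
  mact (mact (mact π0))

theorem rho_flip (w : ν → Fin n → ν → ℂ) (α β : ν) (k : Fin n) :
    rho n ν (mdg n ν (Flip ν)) w α k β = w β k α := by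
  change mact (mact (mact π0)) ((Flip ν).map dg) w α k β = _
  rw [mact_apply, Finset.sum_apply, Finset.sum_apply, Finset.sum_eq_single β]
  · rw [mact_apply, Finset.sum_apply, Finset.sum_eq_single k]
    · rw [mact_apply, Finset.sum_eq_single α]
      · simp [dg_apply, Flip_apply, π0]
      · intro b _ hb
        simp [dg_apply, Flip_apply, π0, hb.symm]
      · simp
    · intro b _ hb
      rw [Matrix.map_apply, dg_apply, if_neg hb.symm, map_zero]; rfl
    · simp
  · intro b _ hb
    rw [mact_apply, Finset.sum_apply, Finset.sum_eq_zero]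
    intro l _
    rw [mact_apply, Finset.sum_eq_zero]
    intro d _
    by_cases h : k = l
    · simp [dg_apply, Flip_apply, π0, hb.symm, h]
    · simp [dg_apply, h]
  · simp

theorem rho_msc (X : Matrix ν ν (Matrix (Fin n) (Fin n) ℂ)) (w : ν → Fin n → ν → ℂ) (α γ : ν) (k : Fin n) :
    rho n ν (msc n ν X) w α k γ = ∑ β, ∑ l, X α β k l * w β l γ := by
  have h := congrFun (congrFun (unc_mact (V := ν → ℂ) (mact π0) X w) (k, α)) γ
  rw [lact_apply, Finset.sum_apply, Fintype.sum_prod_type, Finset.sum_comm] at h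
  exact h

variable {N : MRep n ν} {M : MRep n μ} {c : ℂ}

theorem rho_A_flip (f : Fuse N M c) (y : ν → Fin n → ν → ℂ) (v : ν → μ → ℂ)
    (h : rho n ν (mdg n ν (Flip ν)) y = fun γ => f.Phi (v γ)) :
    rho n ν (msc n ν (swp (Matrix.of (N.L c)))) y = 0 := by
  funext α k γ
  rw [rho_msc]
  refine Eq.trans ?_ (f.A_Phi (v γ) k α)
  refine Finset.sum_congr rfl fun β _ => Finset.sum_congr rfl fun l _ => ?_
  rw [swp_apply, ← rho_flip y γ β l, h]
  rfl

theorem rho_nat (f : Fuse N M c) (F : RFam N) (u : ℂ) (v : ν → μ → ℂ) :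
    rho n ν (F.R (box (box (one n) N) (xrep n c)) u) (f.Phi.compLeft ν v)
      = (F.cs.map (fun c' => (c' + u - c))).prod • f.Phi.compLeft ν (mact (mact π0) (F.R (box (one n) M) u) v) := by
  have h := F.nat (V := μ → ℂ) (W := Fin n → ν → ℂ) (box (one n) M) (box (box (one n) N) (xrep n c)) (mact π0) (mact (mact π0)) f.Phi (fun x => x - c)
      (fun x i j v => f.Phi_inter x i j v) u
  refine funext fun α => ?_
  have e1 := mact_apply (mact (mact π0)) (F.R (box (box (one n) N) (xrep n c)) u) (f.Phi.compLeft ν v) α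
  have e2 := mact_apply (mact π0) (F.R (box (one n) M) u) v α
  refine e1.trans ?_
  rw [Pi.smul_apply, LinearMap.compLeft_apply, Function.comp_apply, e2, map_sum, Finset.smul_sum]
  exact Finset.sum_congr rfl fun β _ => h α β (v β)

set_option maxHeartbeats 1000000 in
theorem r_MN_unit (f : Fuse N M c) {F : RFam N} {P : Polynomial ℂ} (D : SD F c P) (hP0 : P.eval 0 ≠ 0)
    (hF : Real F) [Nonempty ν] [Nonempty μ] {r : Matrix ν ν (Matrix μ μ ℂ)} (hr : Lead (F.R (box (one n) M)) r) (hr0 : r ≠ 0) :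
    IsUnit r := by
  haveI := f.nonempty
  obtain ⟨c0, hc0, b, R, hR, hRN, hR0⟩ := hF
  let Ph : (ν → μ → ℂ) →ₗ[ℂ] (ν → Fin n → ν → ℂ) := f.Phi.compLeft ν
  have hPh : ∀ v, Ph v = 0 → v = 0 := by
    intro v hv
    funext γ
    exact f.Phi_inj _ (congrFun hv γ)
  let σ : ℂ → ℂ := fun u => (F.cs.map (fun c' => (c' + u - c))).prod
  have hnat : ∀ u v, rho n ν (F.R (box (box (one n) N) (xrep n c)) u) (Ph v)
      = σ u • Ph (mact (mact π0) (F.R (box (one n) M) u) v) := by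
    exact fun u v => rho_nat f F u v
  let f1 : ℂ → ((ν → μ → ℂ) →ₗ[ℂ] (ν → Fin n → ν → ℂ)) := fun u =>
    (rho n ν (mdg n ν (R u) * msc n ν (D.s u))) ∘ₗ Ph
  let f2 : ℂ → ((ν → μ → ℂ) →ₗ[ℂ] (ν → Fin n → ν → ℂ)) := fun u =>
    Ph ∘ₗ (mact (mact π0) (F.R (box (one n) M) u))
  have hrel : ∀ u, (u ^ b * D.g u) • f1 u = (-(u * P.eval u) * σ u) • f2 u := by
    intro u
    refine LinearMap.ext fun v => ?_
    have h1 := hnat u v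
    rw [F.mult, hRN] at h1
    have h2 : rho n ν ((u ^ b • R u).map dg * (F.R (box (one n) (xrep n c)) u).map sc)
       = u ^ b • rho n ν (mdg n ν (R u) * msc n ν (F.R (box (one n) (xrep n c)) u)) := by
      change rho n ν (mdg n ν (u ^ b • R u) * msc n ν (F.R (box (one n) (xrep n c)) u)) = _
      rw [map_smul, smul_mul_assoc, map_smul]
    rw [h2] at h1
    have h3 := congrArg (fun z => (-(u * P.eval u)) • z) h1
    beta_reduce at h3
    have h4 : (-(u * P.eval u)) • rho n ν (mdg n ν (R u) * msc n ν (F.R (box (one n) (xrep n c)) u))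
        = D.g u • rho n ν (mdg n ν (R u) * msc n ν (D.s u)) := by
      rw [← map_smul, ← mul_smul_comm, ← map_smul, D.rel, map_smul, mul_smul_comm, map_smul]
    have h5 := LinearMap.congr_fun h4 (Ph v)
    rw [LinearMap.smul_apply, LinearMap.smul_apply] at h5
    rw [LinearMap.smul_apply, smul_comm, h5, smul_smul, smul_smul] at h3
    exact h3
  have hσ : PolyFun σ := by
    have : ∀ l : List ℂ, PolyFun (fun u => (l.map (fun c' => (c' + u - c))).prod) := by
      intro l
      induction l with
      | nil => simpa using PolyFun.const (1 : ℂ)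
      | cons a l ih =>
        simp only [List.map_cons, List.prod_cons]
        exact (((PolyFun.const a).add PolyFun.id).sub (PolyFun.const c)).mul ih
    exact this _
  have hσ1 : ∀ᶠ u in cofinite, σ u ≠ 0 := by
    have : ∀ l : List ℂ, ∀ᶠ u in cofinite, (l.map (fun c' => (c' + u - c))).prod ≠ 0 := by
      intro l
      induction l with
      | nil => simp
      | cons a l ih =>
        filter_upwards [ih, ev_ne (c - a)] with u h1 h2
        simp only [List.map_cons, List.prod_cons]
        refine mul_ne_zero (fun h => h2 ?_) h1
        linear_combination h
    exact this _
  have hp0 : ∀ᶠ u in cofinite, u ^ b * D.g u ≠ 0 := by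
    filter_upwards [ev_ne 0, D.gp.cofinite_ne D.g1] with u h1 h2
    exact mul_ne_zero (pow_ne_zero _ h1) h2
  have hf1p : PolyFun f1 := by
    have h1 := (hR.map (mdg n ν).toLinearMap).mul (D.sp.map (msc n ν).toLinearMap)
    exact (h1.map (rho n ν).toLinearMap).map (LinearMap.lcomp ℂ _ Ph)
  have hinj : ∀ v, f1 0 v = 0 → v = 0 := by
    intro v hv
    have hv1 : rho n ν (msc n ν (D.s 0)) (Ph v) = 0 := by
      have h1 : rho n ν (mdg n ν (R 0) * msc n ν (D.s 0)) (Ph v) = 0 := hv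
      have h2 := congrArg (rho n ν (mdg n ν (Flip ν))) h1
      rw [map_zero, ← Module.End.mul_apply, ← map_mul, ← mul_assoc, ← map_mul, hR0, mul_smul_comm, Flip_sq,
        map_smul, map_one, smul_mul_assoc, one_mul, map_smul, LinearMap.smul_apply] at h2
      exact (smul_eq_zero.1 h2).resolve_left hc0
    have hsp : PolyFun (fun u => rho n ν (msc n ν (D.s u)) (Ph v)) :=
      ((D.sp.map (msc n ν).toLinearMap).map (rho n ν).toLinearMap).map (LinearMap.applyₗ (Ph v))
    obtain ⟨y, hy, hy2⟩ := hsp.step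
    beta_reduce at hy2
    simp only [hv1, zero_add] at hy2
    -- first relation
    have r1 : ∀ u, rho n ν (msc n ν (swp (Matrix.of (N.L c)) - u • (1 : Matrix ν ν (Matrix (Fin n) (Fin n) ℂ)))) (y u) = (-(P.eval u)) • Ph v := by
      have p1 : PolyFun (fun u => rho n ν (msc n ν (swp (Matrix.of (N.L c)) - u • (1 : Matrix ν ν (Matrix (Fin n) (Fin n) ℂ)))) (y u)) := by
        have q1 : PolyFun (fun u : ℂ => swp (Matrix.of (N.L c)) - u • (1 : Matrix ν ν (Matrix (Fin n) (Fin n) ℂ))) :=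
          (PolyFun.const _).sub (PolyFun.id_smul _)
        exact PolyFun.bilin LinearMap.id ((q1.map (msc n ν).toLinearMap).map (rho n ν).toLinearMap) hy
      have p2 : PolyFun (fun u => (-(P.eval u)) • Ph v) := (SD.poly_q P).neg.smul (PolyFun.const _)
      refine fun u => p1.eq_of_ne p2 0 (fun u hu => ?_) u
      have h1 := congrArg (fun X => rho n ν (msc n ν X) (Ph v)) (D.as u)
      beta_reduce at h1
      rw [map_mul, map_mul, Module.End.mul_apply, hy2, map_smul, map_smul, map_smul, map_one, map_one,
        LinearMap.smul_apply, Module.End.one_apply, ← mul_neg, ← smul_smul] at h1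
      exact smul_right_injective _ hu h1
    -- second relation
    have r2 : ∀ u, rho n ν (mdg n ν (R u)) (y u) ∈ LinearMap.range Ph := by
      have p1 : PolyFun (fun u => rho n ν (mdg n ν (R u)) (y u)) :=
        PolyFun.bilin LinearMap.id ((hR.map (mdg n ν).toLinearMap).map (rho n ν).toLinearMap) hy
      refine p1.mem_of_cofinite _ ?_
      filter_upwards [ev_ne 0, hp0] with u h1 h2
      have h3 := LinearMap.congr_fun (hrel u) v
      have h4 : f1 u v = u • rho n ν (mdg n ν (R u)) (y u) := by
        change rho n ν (mdg n ν (R u) * msc n ν (D.s u)) (Ph v) = _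
        rw [map_mul, Module.End.mul_apply, hy2, map_smul]
      rw [LinearMap.smul_apply, h4, smul_smul] at h3
      rw [← Submodule.smul_mem_iff _ (mul_ne_zero h2 h1), h3]
      exact Submodule.smul_mem _ _ ⟨_, rfl⟩
    obtain ⟨v', hv'⟩ := r2 0
    rw [hR0, map_smul, map_smul, LinearMap.smul_apply] at hv'
    have h7 : rho n ν (mdg n ν (Flip ν)) (y 0) = fun γ => f.Phi ((c0⁻¹ • v') γ) := by
      have : rho n ν (mdg n ν (Flip ν)) (y 0) = Ph (c0⁻¹ • v') := by
        rw [map_smul, hv', smul_smul, inv_mul_cancel₀ hc0, one_smul]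
      exact this
    have h8 := rho_A_flip f (y 0) _ h7
    have h9 := r1 0
    rw [zero_smul, sub_zero, h8] at h9
    exact hPh v ((smul_eq_zero.1 h9.symm).resolve_left (neg_ne_zero.2 hP0))
  have hne : f1 0 ≠ 0 := by
    intro h
    obtain ⟨α⟩ := ‹Nonempty ν›
    obtain ⟨γ⟩ := ‹Nonempty μ›
    have := hinj (fun _ _ => 1) (by rw [h]; rfl)
    exact one_ne_zero (congrFun (congrFun this α) γ)
  have hl1 : Lead f1 (f1 0) := ⟨0, f1, hf1p, by simp, rfl⟩
  have hl2 : Lead f2 (Ph ∘ₗ (mact (mact π0) r)) :=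
    (hr.map (mact (mact π0) : Matrix ν ν (Matrix μ μ ℂ) →ₐ[ℂ] _).toLinearMap).map (LinearMap.compRight ℂ Ph)
  have hne2 : Ph ∘ₗ (mact (mact π0) r) ≠ 0 := by
    intro h
    apply hr0
    apply mact_injective _ (mact_injective _ π0_inj)
    rw [map_zero]
    refine LinearMap.ext fun v => ?_
    exact hPh _ (LinearMap.congr_fun h v)
  obtain ⟨u1, hu1⟩ := hp0.exists
  obtain ⟨u2, hu2⟩ := ((SD.exists_p P hP0).and hσ1).exists
  obtain ⟨κ, hκ, he⟩ := hl1.unique hl2 hne hne2 ((PolyFun.id.pow b).mul D.gp) ((SD.poly_p P).mul hσ) hu1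
    (mul_ne_zero hu2.1 hu2.2) hrel
  apply isUnit_of_mact_inj _ (mact_injective _ π0_inj)
  rw [eq_bot_iff]
  intro v hv
  rw [LinearMap.mem_ker] at hv
  refine hinj v ?_
  rw [he, LinearMap.smul_apply, LinearMap.comp_apply, hv, map_zero, smul_zero]

end step2
end YG

namespace YG
open Filter

section step3
variable {n : ℕ} {ν μ : Type} [Fintype ν] [DecidableEq ν] [Fintype μ] [DecidableEq μ]

theorem mact_box {A V κ : Type} [Ring A] [Algebra ℂ A] [AddCommGroup V] [Module ℂ V] [Fintype κ] [DecidableEq κ]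
    (π : A →ₐ[ℂ] Module.End ℂ V) (Z : YM n A) (H : MRep n κ) (x : ℂ) (i j : Fin n) (w : κ → V) (γ : κ) :
    mact π ((box Z H).T x i j) w γ = ∑ a, π (Z.T x i a) (lact V (H.L x a j) w γ) := by
  rw [mact_apply]
  simp only [box_T_apply, lact_apply, map_sum, map_smul, LinearMap.sum_apply, LinearMap.smul_apply]
  rw [Finset.sum_comm]

theorem lact_inRL {V κ : Type} [AddCommGroup V] [Module ℂ V] [Fintype κ] [DecidableEq κ] (X : Matrix κ κ ℂ) (Y : Matrix ν ν ℂ)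
    (w : ν → κ → V) (k : κ) (α : ν) :
    lact V X (lact (κ → V) Y w α) k
      = lact V ((inR Y : Matrix (κ × ν) (κ × ν) ℂ) * (inL X : Matrix (κ × ν) (κ × ν) ℂ)) (unc κ ν V w) (k, α) := by
  rw [lact_apply, lact_apply, lact_apply, Fintype.sum_prod_type]
  refine Finset.sum_congr rfl fun l _ => ?_
  rw [Finset.sum_apply, Finset.smul_sum]
  refine Finset.sum_congr rfl fun β _ => ?_
  rw [inR_mul_inL, Pi.smul_apply, smul_smul, unc_apply, mul_comm]

theorem lact_sum {I J V σ : Type} [Fintype I] [Fintype J] [DecidableEq I] [DecidableEq J] [AddCommGroup V] [Module ℂ V] (s : Finset σ) (X : σ → Matrix I J ℂ) (w : J → V) (i : I) :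
    lact V (∑ b ∈ s, X b) w i = ∑ b ∈ s, lact V (X b) w i := by
  simp only [lact_apply, Matrix.sum_apply, Finset.sum_smul]
  rw [Finset.sum_comm]

variable {N : MRep n ν} {M : MRep n μ} {c : ℂ}

/-- The projection. -/
noncomputable def SD.Q {F : RFam N} {P : Polynomial ℂ} (D : SD F c P) (f : Fuse N M c) : Matrix μ (Fin n × ν) ℂ :=
  f.ψ * ofB (D.s 0)

theorem SD.Q_phi {F : RFam N} {P : Polynomial ℂ} (D : SD F c P) (f : Fuse N M c) :
    D.Q f * f.φ = P.eval 0 • (1 : Matrix μ μ ℂ) := by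
  rw [SD.Q, Matrix.mul_assoc, D.s0, f.aeval_phi, Matrix.mul_smul, f.ψφ]

theorem SD.phi_Q {F : RFam N} {P : Polynomial ℂ} (D : SD F c P) (f : Fuse N M c)
    (hP : Aop N c * Polynomial.aeval (Aop N c) P = 0) : f.φ * D.Q f = ofB (D.s 0) := by
  have h := congrArg (· * ofB (D.s 0)) f.res
  beta_reduce at h
  rw [Matrix.add_mul, Matrix.mul_assoc, Matrix.mul_assoc f.B, D.s0, hP, Matrix.mul_zero, add_zero, Matrix.one_mul] at h
  rw [SD.Q, D.s0]
  exact h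

theorem SD.Q_inter {F : RFam N} {P : Polynomial ℂ} (D : SD F c P) (f : Fuse N M c) [Nonempty ν] [Nonempty μ]
    (hP0 : P.eval 0 ≠ 0) (hP : Aop N c * Polynomial.aeval (Aop N c) P = 0) (x : ℂ) (a j : Fin n) :
    D.Q f * (∑ b, (inR (N.L x b j) : Matrix (Fin n × ν) (Fin n × ν) ℂ) * inL ((xrep n c).L x a b))
      = (x - c) • (M.L x a j * D.Q f) := by
  obtain ⟨κ, hκ, hl⟩ := D.leadG f hP0
  have h := congrArg (ofB : Matrix ν ν (Matrix (Fin n) (Fin n) ℂ) →ₐ[ℂ] _) (lead_inter _ F hl x a j)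
  rw [box_T] at h
  simp only [map_mul, map_smul, map_sum, ofB_sc, ofB_dg, box_one_T] at h
  rw [smul_mul_assoc, mul_smul_comm] at h
  have h1 := smul_right_injective _ hκ h
  beta_reduce at h1
  have h2 : ofB (D.s 0) * (∑ b, (inR (N.L x b j) : Matrix (Fin n × ν) (Fin n × ν) ℂ) * inL ((xrep n c).L x a b))
    = tauop N c x a j * ofB (D.s 0) := h1
  rw [SD.Q, Matrix.mul_assoc, h2, ← D.phi_Q f hP, ← Matrix.mul_assoc (tauop N c x a j), f.tau,
    Matrix.smul_mul, Matrix.mul_smul, Matrix.mul_assoc f.φ, ← Matrix.mul_assoc f.ψ, f.ψφ, Matrix.one_mul]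
  rw [← Matrix.mul_assoc f.ψ f.φ, f.ψφ, Matrix.one_mul]

theorem mact_box2 {A V κ : Type} [Ring A] [Algebra ℂ A] [AddCommGroup V] [Module ℂ V] [Fintype κ] [DecidableEq κ]
    (π : A →ₐ[ℂ] Module.End ℂ V) (Z : YM n A) (X : MRep n κ) (N : MRep n ν) (x : ℂ) (i j : Fin n) (w : ν → κ → V) :
    unc κ ν V (mact (mact π) ((box (box Z X) N).T x i j) w)
      = ∑ a, fun p => π (Z.T x i a)
        (lact V (∑ b, (inR (N.L x b j) : Matrix (κ × ν) (κ × ν) ℂ) * inL (X.L x a b)) (unc κ ν V w) p) := by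
  refine funext fun ⟨k, α⟩ => ?_
  rw [Finset.sum_apply, unc_apply]
  have e0 := mact_box (V := κ → V) (mact π) (box Z X) N x i j w α
  refine (congrFun e0 k).trans ?_
  rw [Finset.sum_apply]
  have e : ∀ b, mact π ((box Z X).T x i b) (lact (κ → V) (N.L x b j) w α) k
      = ∑ a, π (Z.T x i a) (lact V ((inR (N.L x b j) : Matrix (κ × ν) (κ × ν) ℂ) * inL (X.L x a b))
        (unc κ ν V w) (k, α)) := by
    intro b
    refine (mact_box π Z X x i b _ k).trans ?_
    refine Finset.sum_congr rfl fun a _ => ?_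
    rw [lact_inRL]
  refine (Finset.sum_congr rfl fun b _ => e b).trans ?_
  rw [Finset.sum_comm]
  refine Finset.sum_congr rfl fun a _ => ?_
  rw [lact_sum, map_sum]

/-- The projection, acting. -/
noncomputable def SD.Qh {F : RFam N} {P : Polynomial ℂ} (D : SD F c P) (f : Fuse N M c) (V : Type) [AddCommGroup V] [Module ℂ V] :
    (ν → Fin n → V) →ₗ[ℂ] (μ → V) :=
  lact V (D.Q f) ∘ₗ (unc (Fin n) ν V).toLinearMap

theorem SD.Qh_inter {F : RFam N} {P : Polynomial ℂ} (D : SD F c P) (f : Fuse N M c) [Nonempty ν] [Nonempty μ]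
    (hP0 : P.eval 0 ≠ 0) (hP : Aop N c * Polynomial.aeval (Aop N c) P = 0)
    {A V : Type} [Ring A] [Algebra ℂ A] [AddCommGroup V] [Module ℂ V]
    (π : A →ₐ[ℂ] Module.End ℂ V) (Z : YM n A) (x : ℂ) (i j : Fin n)
    (w : ν → Fin n → V) :
    D.Qh f V (mact (mact π) ((box (box Z (xrep n c)) N).T x i j) w)
      = (x - c) • mact π ((box Z M).T x i j) (D.Qh f V w) := by
  have h1 := mact_box2 π Z (xrep n c) N x i j w
  rw [SD.Qh, LinearMap.comp_apply, LinearMap.comp_apply]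
  refine (congrArg (lact V (D.Q f)) h1).trans ?_
  rw [map_sum]
  refine funext fun γ => ?_
  rw [Finset.sum_apply, Pi.smul_apply, mact_box, Finset.smul_sum]
  refine Finset.sum_congr rfl fun a _ => ?_
  rw [lact_comp, ← lact_mul, D.Q_inter f hP0 hP, lact_smul, lact_mul]
  beta_reduce
  rw [Pi.smul_apply, map_smul]
  rfl

theorem irr_MM {F : RFam N} (hF : Real F) (f : Fuse N M c) [Nonempty ν] [Nonempty μ]
    (hN : Irr (V := ν → ℂ) (box (one n) N) (mact π0)) (hM : Irr (V := μ → ℂ) (box (one n) M) (mact π0))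
    (P : Polynomial ℂ) (hP0 : P.eval 0 ≠ 0) (hP : Aop N c * Polynomial.aeval (Aop N c) P = 0)
    (hu : IsUnit (Matrix.of (M.L c) : Matrix (Fin n) (Fin n) (Matrix μ μ ℂ))) :
    Irr (V := μ → μ → ℂ) (box (box (one n) M) M) (mact (mact π0)) := by
  haveI := f.nonempty
  obtain ⟨D⟩ := exists_SD F hN P hP
  have hX : Irr (V := Fin n → μ → ℂ) (box (box (one n) M) (xrep n c)) (mact (mact π0)) := by
    refine thmA1 (V := μ → ℂ) (box (one n) M) (mact π0) (xFam n c) (xreal n c) hM (r := Matrix.of (M.L c)) ?_ hu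
    refine ⟨0, _, (xFam n c).poly (box (one n) M), by simp, ?_⟩
    ext1 i j
    change (box (one n) M).T (c + 0) i j = _
    rw [box_one_T, add_zero]
    rfl
  obtain ⟨u, huu⟩ := (F.nondeg M).exists
  obtain ⟨r, hr0, hr⟩ := exists_lead (F.poly (box (one n) M)) huu.ne_zero
  have hru := r_MN_unit f D hP0 hF hr hr0
  obtain ⟨κ, hκ, hl⟩ := D.leadG f hP0
  have hlead := lead_mult F (box (one n) M) (xrep n c) hr hl
  intro S' hS'
  have hS : Inv (V := ν → Fin n → μ → ℂ) (box (box (box (one n) M) (xrep n c)) N) (mact (mact (mact π0))) (S'.comap (D.Qh f (μ → ℂ))) := by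
    intro x i j w hw
    rw [Submodule.mem_comap, D.Qh_inter f hP0 hP]
    exact S'.smul_mem _ (hS' x i j _ hw)
  have hsur : ∀ v, ∃ w, D.Qh f (μ → ℂ) w = v := by
    intro v
    refine ⟨(P.eval 0)⁻¹ • (unc (Fin n) ν (μ → ℂ)).symm (lact (μ → ℂ) f.φ v), ?_⟩
    rw [map_smul, SD.Qh, LinearMap.comp_apply, LinearEquiv.coe_coe, LinearEquiv.apply_symm_apply, ← lact_mul, D.Q_phi,
      lact_smul, lact_one, smul_smul, inv_mul_cancel₀ hP0, one_smul]
  rcases thmA (V := Fin n → μ → ℂ) _ _ F hF hX hlead _ hS with h | h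
  · right
    rw [eq_top_iff]
    intro v _
    obtain ⟨w, rfl⟩ := hsur v
    have : w ∈ S'.comap (D.Qh f (μ → ℂ)) := by rw [h]; trivial
    exact this
  · left
    rw [eq_bot_iff]
    intro v hv
    obtain ⟨w, rfl⟩ := hsur v
    have h1 := h w hv
    have h2 := isUnit_mapM (dg : Matrix μ μ ℂ →ₐ[ℂ] Matrix (Fin n) (Fin n) (Matrix μ μ ℂ)) hru
    obtain ⟨q, hq⟩ := h2.exists_left_inv
    have h3 := congrArg (mact (mact (mact π0)) q) h1
    rw [map_zero, ← Module.End.mul_apply, ← map_mul, ← mul_assoc, hq, one_mul] at h3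
    have h4 := unc_mact (V := μ → ℂ) (mact π0) (κ • D.s 0) w
    rw [h3, map_zero, map_smul, lact_smul] at h4
    have h5 := (smul_eq_zero.1 h4.symm).resolve_left hκ
    change D.Qh f (μ → ℂ) w = 0
    rw [SD.Qh, LinearMap.comp_apply, SD.Q, lact_mul]
    refine (congrArg (lact (μ → ℂ) f.ψ) h5).trans ?_
    rw [map_zero]

end step3
end YG

namespace YG
open Filter

section gl
variable {n : ℕ} {V : Type} [AddCommGroup V] [Module ℂ V]

/-- The defining relations of `gl_n`. -/
def GLc (E : Fin n → Fin n → Module.End ℂ V) : Prop := ∀ i j k l : Fin n,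
  E i j * E k l - E k l * E i j = (if j = k then E i l else 0) - (if l = i then E k j else 0)

/-- Highest weight vectors. -/
def HW (E : Fin n → Fin n → Module.End ℂ V) (lam : Fin n → ℂ) (v : V) : Prop :=
  (∀ i j : Fin n, i < j → E i j v = 0) ∧ ∀ i, E i i v = lam i • v

/-- Invariant subspaces. -/
def GInv (E : Fin n → Fin n → Module.End ℂ V) (U : Submodule ℂ V) : Prop := ∀ i j, ∀ v ∈ U, E i j v ∈ U

/-- Irreducible modules. -/
def GIrr (E : Fin n → Fin n → Module.End ℂ V) : Prop := ∀ U, GInv E U → U = ⊥ ∨ U = ⊤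

theorem GLc.ap {E : Fin n → Fin n → Module.End ℂ V} (hE : GLc E) (i j k l : Fin n) (v : V) :
    E i j (E k l v) = E k l (E i j v) + (if j = k then E i l v else 0) - (if l = i then E k j v else 0) := by
  have h := LinearMap.congr_fun (hE i j k l) v
  simp only [LinearMap.sub_apply, Module.End.mul_apply] at h
  rw [sub_eq_iff_eq_add] at h
  rw [h]
  by_cases h1 : j = k <;> by_cases h2 : l = i <;> simp only [h1, h2, if_true, if_false, LinearMap.zero_apply, LinearMap.sub_apply] <;> abel

theorem lower_span {E : Fin n → Fin n → Module.End ℂ V} (hE : GLc E) (hI : GIrr E) {lam : Fin n → ℂ} {ξ : V}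
    (hξ : HW E lam ξ) (h0 : ξ ≠ 0) (U : Submodule ℂ V) (hU : ξ ∈ U)
    (hl : ∀ i j, j < i → ∀ v ∈ U, E i j v ∈ U) : U = ⊤ := by
  let C : Set (Submodule ℂ V) := {W | ξ ∈ W ∧ ∀ i j, j < i → ∀ v ∈ W, E i j v ∈ W}
  let S : Submodule ℂ V := sInf C
  have hS1 : ξ ∈ S := by
    rw [Submodule.mem_sInf]; exact fun W hW => hW.1
  have hS2 : ∀ i j, j < i → ∀ v ∈ S, E i j v ∈ S := by
    intro i j hij v hv
    rw [Submodule.mem_sInf] at hv ⊢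
    exact fun W hW => hW.2 i j hij v (hv W hW)
  let T : Submodule ℂ V := S ⊓ ⨅ i, ⨅ j, S.comap (E i j)
  have hT : ∀ v, v ∈ T ↔ v ∈ S ∧ ∀ i j, E i j v ∈ S := by
    intro v
    simp [T, Submodule.mem_inf, Submodule.mem_iInf]
  have hTC : T ∈ C := by
    refine ⟨(hT _).2 ⟨hS1, ?_⟩, ?_⟩
    · intro i j
      rcases lt_trichotomy i j with h | h | h
      · rw [hξ.1 i j h]; exact S.zero_mem
      · subst h; rw [hξ.2]; exact S.smul_mem _ hS1
      · exact hS2 i j h _ hS1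
    · intro k l hkl v hv
      rw [hT] at hv ⊢
      refine ⟨hv.2 k l, fun i j => ?_⟩
      rw [hE.ap]
      refine S.sub_mem (S.add_mem (hS2 k l hkl _ (hv.2 i j)) ?_) ?_
      · split_ifs
        · exact hv.2 _ _
        · exact S.zero_mem
      · split_ifs
        · exact hv.2 _ _
        · exact S.zero_mem
  have hST : S ≤ T := sInf_le hTC
  have hSU : S ≤ U := sInf_le ⟨hU, hl⟩
  have hinv : GInv E S := fun i j v hv => ((hT v).1 (hST hv)).2 i j
  rcases hI S hinv with h | h
  · rw [h] at hS1; exact absurd ((Submodule.mem_bot ℂ).1 hS1) h0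
  · rw [h] at hSU; exact top_le_iff.1 hSU

/-- The grading operator. -/
noncomputable def Hgr (E : Fin n → Fin n → Module.End ℂ V) : Module.End ℂ V := ∑ i : Fin n, (-(i.val : ℂ)) • E i i

theorem Hgr_comm {E : Fin n → Fin n → Module.End ℂ V} (hE : GLc E) (k l : Fin n) (v : V) :
    Hgr E (E k l v) = E k l (Hgr E v) + ((l.val : ℂ) - k.val) • E k l v := by
  simp only [Hgr, LinearMap.sum_apply, LinearMap.smul_apply, map_sum, map_smul]
  have : ∀ i : Fin n, (-(i.val : ℂ)) • (E i i (E k l v)) = (-(i.val : ℂ)) • E k l (E i i v)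
     + ((if i = k then (-(k.val : ℂ)) • E k l v else 0) - (if l = i then (-(l.val:ℂ)) • E k l v else 0)) := by
    intro i
    rw [hE.ap]
    by_cases h1 : i = k <;> by_cases h2 : l = i
    · subst h1; subst h2; simp
    · subst h1; simp [h2]
    · subst h2; simp [h1, smul_sub, sub_eq_add_neg]
    · simp [h1, h2]
  simp only [this, Finset.sum_add_distrib, Finset.sum_sub_distrib, Finset.sum_ite_eq, Finset.sum_ite_eq', Finset.mem_univ, if_true]
  module

theorem hw_decomp {E : Fin n → Fin n → Module.End ℂ V} (hE : GLc E) (hI : GIrr E) {lam : Fin n → ℂ} {ξ : V}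
    (hξ : HW E lam ξ) (h0 : ξ ≠ 0) : ∃ h : ℂ, Hgr E ξ = h • ξ ∧
      (Submodule.span ℂ {ξ} ⊔ ⨆ m : ℕ, (Hgr E).eigenspace (h - (m + 1))) = ⊤ := by
  have hh : Hgr E ξ = (∑ i : Fin n, (-(i.val : ℂ)) * lam i) • ξ := by
    simp only [Hgr, LinearMap.sum_apply, LinearMap.smul_apply, hξ.2, smul_smul, Finset.sum_smul]
  refine ⟨_, hh, lower_span hE hI hξ h0 _ (Submodule.mem_sup_left (Submodule.mem_span_singleton_self ξ)) ?_⟩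
  generalize (∑ i : Fin n, (-(i.val : ℂ)) * lam i) = h at hh
  intro i j hij
  have key : ∀ (a : ℂ) v, Hgr E v = a • v → E i j v ∈ (Hgr E).eigenspace (a - (i.val - j.val : ℂ)) := by
    intro a v hv
    rw [Module.End.mem_eigenspace_iff, Hgr_comm hE, hv, map_smul]
    module
  have hd : ((i.val : ℂ) - j.val) = ((i.val - j.val - 1 : ℕ) : ℂ) + 1 := by
    have : i.val = (i.val - j.val - 1) + 1 + j.val := by have := Fin.lt_def.1 hij; omega
    conv_lhs => rw [this]
    push_cast; ring
  suffices hs : (Submodule.span ℂ {ξ} ⊔ ⨆ m : ℕ, (Hgr E).eigenspace (h - (m + 1))) ≤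
      (⨆ m : ℕ, (Hgr E).eigenspace (h - (m + 1))).comap (E i j) by
    intro v hv
    exact Submodule.mem_sup_right (hs hv)
  refine sup_le ?_ (iSup_le fun m => ?_)
  · rw [Submodule.span_singleton_le_iff_mem, Submodule.mem_comap]
    refine Submodule.mem_iSup_of_mem (i.val - j.val - 1) ?_
    rw [← hd]
    exact key _ _ hh
  · intro v hv
    rw [Submodule.mem_comap]
    refine Submodule.mem_iSup_of_mem (m + (i.val - j.val - 1) + 1) ?_
    have h2 := key _ v (Module.End.mem_eigenspace_iff.1 hv)
    rw [hd] at h2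
    convert h2 using 2
    push_cast; ring

theorem hw_eig {E : Fin n → Fin n → Module.End ℂ V} {h a : ℂ} {ξ v : V} (hh : Hgr E ξ = h • ξ)
      (ht : (Submodule.span ℂ {ξ} ⊔ ⨆ m : ℕ, (Hgr E).eigenspace (h - (m + 1))) = ⊤) (hv : Hgr E v = a • v) (h0 : v ≠ 0) :
    (a = h ∧ ∃ c : ℂ, v = c • ξ) ∨ ∃ m : ℕ, a = h - (m + 1) := by
  have hind := (Hgr E).eigenspaces_iSupIndep
  by_contra hcon
  push Not at hcon
  obtain ⟨hc1, hc2⟩ := hcon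
  have hvt : v ∈ (⊤ : Submodule ℂ V) := trivial
  rw [← ht, Submodule.mem_sup] at hvt
  obtain ⟨y, hy, z, hz, hyz⟩ := hvt
  obtain ⟨c, rfl⟩ := Submodule.mem_span_singleton.1 hy
  by_cases hah : a = h
  · refine hc1 hah c ?_
    have hz1 : z ∈ (Hgr E).eigenspace h := by
      rw [Module.End.mem_eigenspace_iff]
      have : z = v - c • ξ := by rw [← hyz]; abel
      rw [this, map_sub, map_smul, hh, hv, hah]
      module
    have hz2 : z ∈ ⨆ j, ⨆ (_ : j ≠ h), (Hgr E).eigenspace j := by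
      refine (iSup_le fun m => ?_ : (⨆ m : ℕ, (Hgr E).eigenspace (h - (m + 1))) ≤ _) hz
      refine le_iSup₂_of_le (h - (m + 1)) ?_ le_rfl
      rw [← hah]; exact fun e => hc2 m (by rw [← hah]; exact e.symm)
    have := Submodule.disjoint_def.1 (hind h) z hz1 hz2
    rw [← hyz, this, add_zero]
  · have hz2 : v ∈ ⨆ j, ⨆ (_ : j ≠ a), (Hgr E).eigenspace j := by
      rw [← hyz]
      refine Submodule.add_mem _ ?_ ((iSup_le fun m => ?_ : (⨆ m : ℕ, (Hgr E).eigenspace (h - (m + 1))) ≤ _) hz)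
      · refine Submodule.mem_iSup_of_mem h (Submodule.mem_iSup_of_mem (Ne.symm hah) ?_)
        exact Submodule.smul_mem _ _ (Module.End.mem_eigenspace_iff.2 hh)
      · exact le_iSup₂_of_le (h - (m + 1)) (fun e => hc2 m e.symm) le_rfl
    exact h0 (Submodule.disjoint_def.1 (hind a) v (Module.End.mem_eigenspace_iff.2 hv) hz2)

theorem hw_unique {E : Fin n → Fin n → Module.End ℂ V} (hE : GLc E) (hI : GIrr E) {lam mu : Fin n → ℂ} {ξ v : V}
    (hξ : HW E lam ξ) (h0 : ξ ≠ 0) (hv : HW E mu v) (hv0 : v ≠ 0) : mu = lam ∧ ∃ c : ℂ, v = c • ξ := by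
  obtain ⟨h, hh, ht⟩ := hw_decomp hE hI hξ h0
  obtain ⟨a, ha, hta⟩ := hw_decomp hE hI hv hv0
  have key : ∃ c : ℂ, v = c • ξ := by
    rcases hw_eig hh ht ha hv0 with h1 | ⟨m, h1⟩
    · exact h1.2
    · exfalso
      rcases hw_eig ha hta hh h0 with h2 | ⟨m', h2⟩
      · rw [h2.1] at h1
        have : ((m + 1 : ℕ) : ℂ) = 0 := by push_cast; linear_combination h1
        exact Nat.succ_ne_zero m (Nat.cast_eq_zero.1 this)
      · have : ((m + m' + 2 : ℕ) : ℂ) = 0 := by push_cast; linear_combination h1 + h2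
        have := Nat.cast_eq_zero.1 this
        omega
  refine ⟨?_, key⟩
  obtain ⟨c, rfl⟩ := key
  funext i
  have h1 := hv.2 i
  rw [map_smul, hξ.2, smul_comm] at h1
  exact (smul_left_injective ℂ hv0 h1).symm

end gl
end YG

namespace YG
open Filter

section gl2
variable {n : ℕ} {V : Type} [AddCommGroup V] [Module ℂ V]

theorem hw_dom [FiniteDimensional ℂ V] {E : Fin n → Fin n → Module.End ℂ V} (hE : GLc E) {lam : Fin n → ℂ} {ξ : V}
    (hξ : HW E lam ξ) (h0 : ξ ≠ 0) {i j : Fin n} (hij : i < j) : ∃ m : ℕ, lam i - lam j = m := by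
  have hv : (E i i - E j j) ξ = (lam i - lam j) • ξ := by
    rw [LinearMap.sub_apply, hξ.2, hξ.2, sub_smul]
  by_cases hh : E i i - E j j = 0
  · refine ⟨0, ?_⟩
    rw [hh, LinearMap.zero_apply] at hv
    simpa using (smul_eq_zero.1 hv.symm).resolve_right h0
  have hne : i ≠ j := hij.ne
  letI : LieRing (Module.End ℂ V) := LieRing.ofAssociativeRing
  have t : IsSl2Triple (E i i - E j j) (E i j) (E j i) := by
    refine ⟨hh, ?_, ?_, ?_⟩
    · rw [LieRing.of_associative_ring_bracket, hE]; simp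
    · have h1 := hE i i i j
      have h2 := hE j j i j
      simp only [hne, hne.symm, if_true, if_false] at h1 h2
      rw [LieRing.of_associative_ring_bracket, sub_mul, mul_sub]
      have : E i i * E i j - E j j * E i j - (E i j * E i i - E i j * E j j)
        = (E i i * E i j - E i j * E i i) - (E j j * E i j - E i j * E j j) := by abel
      rw [this, h1, h2, two_smul]; abel
    · have h1 := hE i i j i
      have h2 := hE j j j i
      simp only [hne, hne.symm, if_true, if_false] at h1 h2
      rw [LieRing.of_associative_ring_bracket, sub_mul, mul_sub]
      have : E i i * E j i - E j j * E j i - (E j i * E i i - E j i * E j j)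
        = (E i i * E j i - E j i * E i i) - (E j j * E j i - E j i * E j j) := by abel
      rw [this, h1, h2, two_smul]; abel
  have P : IsSl2Triple.HasPrimitiveVectorWith t ξ (lam i - lam j) := ⟨h0, hv, hξ.1 i j hij⟩
  exact P.exists_nat

/-- shifted weights -/
def ell (lam : Fin n → ℂ) (j : Fin n) : ℂ := lam j + ((n : ℂ) - 1 - j.val)

theorem ell_inj {lam : Fin n → ℂ} (hd : ∀ i j : Fin n, i < j → ∃ m : ℕ, lam i - lam j = m) {i j : Fin n} (h : i ≠ j) :
    ell lam i ≠ ell lam j := by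
  have key : ∀ i j : Fin n, i < j → ell lam i ≠ ell lam j := by
    intro i j hij e
    obtain ⟨m, hm⟩ := hd i j hij
    unfold ell at e
    have h1 : ((m + (j.val - i.val) : ℕ) : ℂ) = 0 := by
      rw [Nat.cast_add, Nat.cast_sub (Fin.lt_def.1 hij).le]
      linear_combination e - hm
    have := Nat.cast_eq_zero.1 h1
    have := Fin.lt_def.1 hij
    omega
  rcases lt_or_gt_of_ne h with h | h
  · exact key _ _ h
  · exact (key _ _ h).symm

/-- The action on the dual natural module tensored with `V`. -/
noncomputable def dE (E : Fin n → Fin n → Module.End ℂ V) (i j : Fin n) : Module.End ℂ (Fin n → V) where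
  toFun w k := E i j (w k) - if k = j then w i else 0
  map_add' w w' := by
    funext k
    simp only [Pi.add_apply, map_add]
    split_ifs <;> abel
  map_smul' c w := by
    funext k
    simp only [Pi.smul_apply, map_smul, RingHom.id_apply]
    split_ifs <;> simp [smul_sub]

theorem dE_apply (E : Fin n → Fin n → Module.End ℂ V) (i j : Fin n) (w : Fin n → V) (k : Fin n) :
    dE E i j w k = E i j (w k) - if k = j then w i else 0 := rfl

/-- The Casimir-type operator. -/
noncomputable def cE (E : Fin n → Fin n → Module.End ℂ V) : Module.End ℂ (Fin n → V) where
  toFun w k := ∑ a, E k a (w a)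
  map_add' w w' := by
    funext k
    simp only [Pi.add_apply, map_add, Finset.sum_add_distrib]
  map_smul' c w := by
    funext k
    simp only [Pi.smul_apply, map_smul, RingHom.id_apply, Finset.smul_sum]

theorem cE_apply (E : Fin n → Fin n → Module.End ℂ V) (w : Fin n → V) (k : Fin n) :
    cE E w k = ∑ a, E k a (w a) := rfl

theorem cE_dE {E : Fin n → Fin n → Module.End ℂ V} (hE : GLc E) (i j : Fin n) (w : Fin n → V) :
    cE E (dE E i j w) = dE E i j (cE E w) := by
  funext k
  rw [cE_apply, dE_apply, cE_apply, cE_apply, map_sum]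
  simp only [dE_apply, map_sub]
  have h1 : ∀ a, E i j (E k a (w a)) = E k a (E i j (w a)) + (if j = k then E i a (w a) else 0) - (if a = i then E k j (w a) else 0) :=
    fun a => hE.ap i j k a (w a)
  simp only [h1, Finset.sum_sub_distrib, Finset.sum_add_distrib, Finset.sum_ite_eq', Finset.mem_univ, if_true, eq_comm (a := j)]
  have h2 : ∀ a, E k a (if a = j then w i else 0) = if a = j then E k a (w i) else 0 := by
    intro a; split_ifs <;> simp
  simp only [h2, Finset.sum_ite_eq', Finset.mem_univ, if_true]
  by_cases h : k = j <;> simp [h] <;> abel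

theorem cE_pow_dE {E : Fin n → Fin n → Module.End ℂ V} (hE : GLc E) (p : Polynomial ℂ) (i j : Fin n) (w : Fin n → V) :
    Polynomial.aeval (cE E) p (dE E i j w) = dE E i j (Polynomial.aeval (cE E) p w) := by
  have h : Commute (cE E) (dE E i j) := LinearMap.ext fun w => cE_dE hE i j w
  have h2 : Commute (Polynomial.aeval (cE E) p) (dE E i j) := by
    induction p using Polynomial.induction_on' with
    | add p q hp hq => rw [map_add]; exact hp.add_left hq
    | monomial m a =>
      rw [Polynomial.aeval_monomial]
      exact Commute.mul_left (Algebra.commutes a _) (h.pow_left m)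
  exact LinearMap.congr_fun h2.eq w

theorem dE_single (E : Fin n → Fin n → Module.End ℂ V) (i j b : Fin n) (m : V) :
    dE E i j (Pi.single b m) = Pi.single b (E i j m) - if i = b then Pi.single j m else 0 := by
  funext k
  rw [dE_apply, Pi.sub_apply]
  by_cases h1 : k = b <;> by_cases h2 : i = b <;> by_cases h3 : k = j <;> simp_all [Pi.single_apply]

theorem cE_single {E : Fin n → Fin n → Module.End ℂ V} {lam : Fin n → ℂ} {ξ : V}
    (hξ : HW E lam ξ) (l : Fin n) :
    cE E (Pi.single l ξ) = ell lam l • (Pi.single l ξ : Fin n → V) + ∑ k ∈ Finset.univ.filter (fun k => l < k), dE E k l (Pi.single k ξ) := by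
  have h1 : cE E (Pi.single l ξ) = ∑ k, Pi.single k (E k l ξ) := by
    funext k
    rw [cE_apply, Finset.sum_apply, Finset.sum_eq_single l]
    · simp [Pi.single_apply]
    · intro b _ hb; simp [Pi.single_apply, hb]
    · simp
  have h2 : ∀ k, (Pi.single k (E k l ξ) : Fin n → V) = (if k = l then lam l • (Pi.single l ξ : Fin n → V) else 0) + (if l < k then dE E k l (Pi.single k ξ) + Pi.single l ξ else 0) := by
    intro k
    rcases lt_trichotomy k l with h | h | h
    · rw [hξ.1 k l h]; simp [h.ne, h.not_gt]
    · subst h; rw [hξ.2]; simp [Pi.single_smul]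
    · rw [dE_single]; simp [h, h.ne']
  rw [h1, Finset.sum_congr rfl fun k _ => h2 k, Finset.sum_add_distrib, Finset.sum_ite_eq' , if_pos (Finset.mem_univ _),
    ← Finset.sum_filter, Finset.sum_add_distrib, Finset.sum_const]
  have hc : (Finset.univ.filter (fun k : Fin n => l < k)).card = n - 1 - l.val := by
    have : (Finset.univ.filter (fun k : Fin n => l < k)) = Finset.Ioi l := by ext; simp
    rw [this, Fin.card_Ioi]
  rw [hc, ell, ← Nat.cast_smul_eq_nsmul ℂ, Nat.cast_sub (by have := l.2; omega), Nat.cast_sub (by have := l.2; omega)]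
  push_cast
  module

theorem dspan {E : Fin n → Fin n → Module.End ℂ V} (hI : GIrr E) {ξ : V} (h0 : ξ ≠ 0)
    (U : Submodule ℂ (Fin n → V)) (hU : GInv (dE E) U) (hf : ∀ l, Pi.single l ξ ∈ U) : U = ⊤ := by
  let S : Submodule ℂ V := ⨅ l, U.comap (LinearMap.single ℂ (fun _ : Fin n => V) l)
  have hS : ∀ m, m ∈ S ↔ ∀ l : Fin n, (Pi.single l m : Fin n → V) ∈ U := by
    intro m; simp [S, Submodule.mem_iInf]
  have hinv : GInv E S := by
    intro i j m hm
    rw [hS] at hm ⊢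
    intro l
    have h1 := hU i j _ (hm l)
    rw [dE_single] at h1
    have h2 : (Pi.single l (E i j m) : Fin n → V) = (Pi.single l (E i j m) - if i = l then Pi.single j m else 0) + if i = l then Pi.single j m else 0 := by abel
    rw [h2]
    refine U.add_mem h1 ?_
    split_ifs
    · exact hm j
    · exact U.zero_mem
  rcases hI S hinv with h | h
  · exfalso
    have : ξ ∈ S := (hS ξ).2 hf
    rw [h] at this
    exact h0 ((Submodule.mem_bot ℂ).1 this)
  · rw [eq_top_iff]
    intro w _
    rw [← Finset.univ_sum_single w]
    refine U.sum_mem fun l _ => ?_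
    refine (hS (w l)).1 ?_ l
    rw [h]; trivial

/-- The product polynomial. -/
noncomputable def ppoly (lam : Fin n → ℂ) (S : Finset (Fin n)) : Polynomial ℂ :=
  ∏ j ∈ S, (Polynomial.X - Polynomial.C (ell lam j))

theorem ppoly_single {E : Fin n → Fin n → Module.End ℂ V} (hE : GLc E) {lam : Fin n → ℂ} {ξ : V}
    (hξ : HW E lam ξ) : ∀ (d : ℕ) (l : Fin n), n - l.val = d → ∀ S : Finset (Fin n), (∀ j, l ≤ j → j ∈ S) →
    Polynomial.aeval (cE E) (ppoly lam S) (Pi.single l ξ) = 0 := by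
  intro d
  induction d using Nat.strong_induction_on with
  | _ d ih =>
    intro l hl S hS
    have hlS := hS l le_rfl
    have h1 : ppoly lam S = ppoly lam (S.erase l) * (Polynomial.X - Polynomial.C (ell lam l)) :=
      (Finset.prod_erase_mul S _ hlS).symm
    rw [h1, map_mul, Module.End.mul_apply, map_sub, Polynomial.aeval_X, Polynomial.aeval_C, LinearMap.sub_apply,
      cE_single hξ, Module.algebraMap_end_apply, add_sub_cancel_left, map_sum]
    refine Finset.sum_eq_zero fun k hk => ?_
    have hk' : l < k := (Finset.mem_filter.1 hk).2
    rw [cE_pow_dE hE, ih (n - k.val) (by have := Fin.lt_def.1 hk'; have := k.2; omega) k rfl, map_zero]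
    intro j hj
    exact Finset.mem_erase.2 ⟨(hk'.trans_le hj).ne', hS j (hk'.le.trans hj)⟩

theorem char_id {E : Fin n → Fin n → Module.End ℂ V} (hE : GLc E) (hI : GIrr E) {lam : Fin n → ℂ} {ξ : V}
    (hξ : HW E lam ξ) (h0 : ξ ≠ 0) : Polynomial.aeval (cE E) (ppoly lam Finset.univ) = 0 := by
  have h : LinearMap.ker (Polynomial.aeval (cE E) (ppoly lam Finset.univ)) = ⊤ := by
    refine dspan hI h0 _ ?_ ?_
    · intro i j w hw
      rw [LinearMap.mem_ker] at hw ⊢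
      rw [cE_pow_dE hE, hw, map_zero]
    · intro l
      exact ppoly_single hE hξ _ l rfl _ fun j _ => Finset.mem_univ j
  exact LinearMap.ker_eq_top.1 h

theorem comp_hw {E : Fin n → Fin n → Module.End ℂ V} (hE : GLc E) (hI : GIrr E) {nu : Fin n → ℂ} {ξ : V}
    (hξ : HW E nu ξ) (h0 : ξ ≠ 0) {mu : Fin n → ℂ} {w : Fin n → V} (hw : HW (dE E) mu w) (hw0 : w ≠ 0) :
    ∃ k : Fin n, (∀ l, l < k → w l = 0) ∧ w k ≠ 0 ∧ (∃ c : ℂ, w k = c • ξ) ∧ mu = nu - Pi.single k 1 := by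
  have hex : ∃ k, w k ≠ 0 := by
    by_contra hc
    push Not at hc
    exact hw0 (funext hc)
  have hne : (Finset.univ.filter (fun k => w k ≠ 0)).Nonempty := by
    obtain ⟨k, hk⟩ := hex
    exact ⟨k, by simp [hk]⟩
  obtain ⟨k, hk1, hk2⟩ := Finset.exists_min_image _ id hne
  have hk : w k ≠ 0 := (Finset.mem_filter.1 hk1).2
  have hlt : ∀ l, l < k → w l = 0 := by
    intro l hl
    by_contra hc
    exact absurd (hk2 l (by simp [hc])) (not_le.2 hl)
  have hwk : HW E (mu + Pi.single k 1) (w k) := by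
    constructor
    · intro i j hij
      have h1 := congrFun (hw.1 i j hij) k
      rw [dE_apply, Pi.zero_apply, sub_eq_zero] at h1
      rw [h1]
      split_ifs with h
      · exact hlt i (h ▸ hij)
      · rfl
    · intro i
      have h1 := congrFun (hw.2 i) k
      rw [dE_apply, Pi.smul_apply, sub_eq_iff_eq_add] at h1
      rw [h1, Pi.add_apply, add_smul]
      congr 1
      by_cases h : k = i
      · subst h; simp
      · simp [h, Pi.single_apply, eq_comm]
  obtain ⟨e1, e2⟩ := hw_unique hE hI hξ h0 hwk hk
  exact ⟨k, hlt, hk, e2, by rw [← e1]; abel⟩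

theorem single_inj_one {k l : Fin n} (h : (Pi.single k 1 : Fin n → ℂ) = Pi.single l 1) : k = l := by
  by_contra hc
  have := congrFun h k
  simp [Pi.single_apply, hc] at this

theorem HW.sub_smul {E : Fin n → Fin n → Module.End ℂ V} {mu : Fin n → ℂ} {w w' : V}
    (hw : HW E mu w) (hw' : HW E mu w') (c : ℂ) : HW E mu (w' - c • w) := by
  constructor
  · intro i j hij
    rw [map_sub, map_smul, hw.1 i j hij, hw'.1 i j hij, smul_zero, sub_zero]
  · intro i
    rw [map_sub, map_smul, hw.2, hw'.2]
    module

theorem dhw_unique {E : Fin n → Fin n → Module.End ℂ V} (hE : GLc E) (hI : GIrr E) {nu : Fin n → ℂ} {ξ : V}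
    (hξ : HW E nu ξ) (h0 : ξ ≠ 0) {mu : Fin n → ℂ} {w w' : Fin n → V} (hw : HW (dE E) mu w) (hw0 : w ≠ 0)
    (hw' : HW (dE E) mu w') : ∃ c : ℂ, w' = c • w := by
  obtain ⟨k, hk, hk0, ⟨a, ha⟩, hmu⟩ := comp_hw hE hI hξ h0 hw hw0
  by_cases hw'0 : w' = 0
  · exact ⟨0, by rw [hw'0, zero_smul]⟩
  obtain ⟨k', hk', hk'0, ⟨b, hb⟩, hmu'⟩ := comp_hw hE hI hξ h0 hw' hw'0
  have hkk : k' = k := by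
    refine single_inj_one ?_
    rw [hmu] at hmu'
    exact (sub_right_injective hmu').symm
  subst hkk
  have ha0 : a ≠ 0 := by rintro rfl; exact hk0 (by rw [ha, zero_smul])
  refine ⟨b / a, ?_⟩
  by_contra hc
  obtain ⟨k'', _, hk''0, _, hmu''⟩ := comp_hw hE hI hξ h0 (hw.sub_smul hw' (b / a)) (sub_ne_zero.2 hc)
  have hkk : k'' = k' := by
    refine single_inj_one ?_
    rw [hmu] at hmu''
    exact (sub_right_injective hmu'').symm
  subst hkk
  refine hk''0 ?_
  rw [Pi.sub_apply, Pi.smul_apply, ha, hb, smul_smul, div_mul_cancel₀ _ ha0, sub_self]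

theorem cE_hw {E : Fin n → Fin n → Module.End ℂ V} (hE : GLc E) (hI : GIrr E) {nu : Fin n → ℂ} {ξ : V}
    (hξ : HW E nu ξ) (h0 : ξ ≠ 0) {i : Fin n} {w : Fin n → V} (hw : HW (dE E) (nu - Pi.single i 1) w) :
    cE E w = ell nu i • w := by
  by_cases hw0 : w = 0
  · rw [hw0, map_zero, smul_zero]
  obtain ⟨k, hk, hk0, ⟨a, ha⟩, hmu⟩ := comp_hw hE hI hξ h0 hw hw0
  have hkk : i = k := single_inj_one (sub_right_injective hmu)
  subst hkk
  have hc : HW (dE E) (nu - Pi.single i 1) (cE E w) := by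
    constructor
    · intro a b hab
      rw [← cE_dE hE, hw.1 a b hab, map_zero]
    · intro a
      rw [← cE_dE hE, hw.2, map_smul]
  obtain ⟨d, hd⟩ := dhw_unique hE hI hξ h0 hw hw0 hc
  have h1 : cE E w i = ell nu i • w i := by
    have h2 : ∀ b, E i b (w b) = (if b = i then nu i • w i else 0) + if i < b then w i else 0 := by
      intro b
      rcases lt_trichotomy b i with h | h | h
      · rw [hk b h]; simp [h.ne, h.not_gt]
      · subst h; rw [ha, map_smul, hξ.2, smul_comm]; simp
      · have := congrFun (hw.1 i b h) b
        rw [dE_apply, Pi.zero_apply, sub_eq_zero] at this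
        rw [this]; simp [h, h.ne']
    rw [cE_apply, Finset.sum_congr rfl fun b _ => h2 b, Finset.sum_add_distrib, Finset.sum_ite_eq', if_pos (Finset.mem_univ _),
      ← Finset.sum_filter, Finset.sum_const]
    have hc : (Finset.univ.filter (fun k : Fin n => i < k)).card = n - 1 - i.val := by
      have : (Finset.univ.filter (fun k : Fin n => i < k)) = Finset.Ioi i := by ext; simp
      rw [this, Fin.card_Ioi]
    rw [hc, ell, ← Nat.cast_smul_eq_nsmul ℂ, Nat.cast_sub (by have := i.2; omega), Nat.cast_sub (by have := i.2; omega)]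
    push_cast
    module
  rw [hd, Pi.smul_apply] at h1
  rw [hd, smul_left_injective ℂ hk0 h1]

end gl2
end YG

namespace YG
open Filter

section gl3
variable {n : ℕ} {V : Type} [AddCommGroup V] [Module ℂ V]

theorem aeval_eig {W : Type} [AddCommGroup W] [Module ℂ W] (f : Module.End ℂ W) (p : Polynomial ℂ) (a : ℂ) (v : W)
    (h : f v = a • v) : Polynomial.aeval f p v = p.eval a • v := by
  induction p using Polynomial.induction_on' with
  | add p q hp hq => rw [map_add, LinearMap.add_apply, hp, hq, Polynomial.eval_add, add_smul]
  | monomial m b =>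
    have hm : ∀ m : ℕ, (f ^ m) v = a ^ m • v := by
      intro m
      induction m with
      | zero => simp
      | succ m ih => rw [pow_succ, Module.End.mul_apply, h, map_smul, ih, smul_smul, pow_succ, mul_comm]
    rw [Polynomial.aeval_monomial, Module.End.mul_apply, hm, Module.algebraMap_end_apply, Polynomial.eval_monomial, smul_smul]

theorem ker_range {M : Type} [AddCommGroup M] [Module ℂ M] {E : Fin n → Fin n → Module.End ℂ V} (hE : GLc E) (hI : GIrr E)
    {nu : Fin n → ℂ} {ξ : V} (hξ : HW E nu ξ) (h0 : ξ ≠ 0)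
    (hd : ∀ i j : Fin n, i ≠ j → ell nu i ≠ ell nu j)
    {EM : Fin n → Fin n → Module.End ℂ M} (φ : M →ₗ[ℂ] (Fin n → V)) (hφ : ∀ i j m, dE E i j (φ m) = φ (EM i j m))
    (i : Fin n) {ξM : M} (hM : HW EM (nu - Pi.single i 1) ξM) (hφ0 : φ ξM ≠ 0) (v : Fin n → V)
    (hv : cE E v = ell nu i • v) : v ∈ LinearMap.range φ := by
  let p := ppoly nu (Finset.univ.erase i)
  have hp : ppoly nu Finset.univ = (Polynomial.X - Polynomial.C (ell nu i)) * p :=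
    (Finset.mul_prod_erase Finset.univ _ (Finset.mem_univ i)).symm
  have hchar := char_id hE hI hξ h0
  have hpe : ∀ w, cE E (Polynomial.aeval (cE E) p w) = ell nu i • Polynomial.aeval (cE E) p w := by
    intro w
    have := LinearMap.congr_fun hchar w
    rw [hp, map_mul, Module.End.mul_apply, map_sub, Polynomial.aeval_X, Polynomial.aeval_C, LinearMap.sub_apply,
      Module.algebraMap_end_apply, LinearMap.zero_apply, sub_eq_zero] at this
    exact this
  have hφhw : HW (dE E) (nu - Pi.single i 1) (φ ξM) := by
    constructor
    · intro a b hab; rw [hφ, hM.1 a b hab, map_zero]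
    · intro a; rw [hφ, hM.2, map_smul]
  have hinvR : ∀ a b w, w ∈ LinearMap.range φ → dE E a b w ∈ LinearMap.range φ := by
    rintro a b _ ⟨m, rfl⟩
    exact ⟨_, (hφ a b m).symm⟩
  have hgt : ∀ k, i < k → Polynomial.aeval (cE E) p (Pi.single k ξ) = 0 := by
    intro k hk
    exact ppoly_single hE hξ _ k rfl _ fun j hj => Finset.mem_erase.2 ⟨(hk.trans_le hj).ne', Finset.mem_univ _⟩
  have hi : Polynomial.aeval (cE E) p (Pi.single i ξ) ∈ LinearMap.range φ := by
    have hw : HW (dE E) (nu - Pi.single i 1) (Polynomial.aeval (cE E) p (Pi.single i ξ)) := by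
      constructor
      · intro a b hab
        rw [← cE_pow_dE hE, dE_single, hξ.1 a b hab, Pi.single_zero, zero_sub, map_neg]
        split_ifs with h
        · rw [hgt b (h ▸ hab), neg_zero]
        · rw [map_zero, neg_zero]
      · intro a
        rw [← cE_pow_dE hE, dE_single, hξ.2, Pi.single_smul, map_sub, map_smul, Pi.sub_apply, sub_smul]
        congr 1
        by_cases h : a = i
        · subst h; simp
        · simp [h, Pi.single_apply]
    obtain ⟨c, hc⟩ := dhw_unique hE hI hξ h0 hφhw hφ0 hw
    exact ⟨c • ξM, by rw [map_smul, hc]⟩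
  have hall : ∀ (d : ℕ) (k : Fin n), n - k.val = d → Polynomial.aeval (cE E) p (Pi.single k ξ) ∈ LinearMap.range φ := by
    intro d
    induction d using Nat.strong_induction_on with
    | _ d ih =>
      intro k hk
      rcases lt_trichotomy k i with h | h | h
      · have h1 := hpe (Pi.single k ξ)
        have h2 : cE E (Polynomial.aeval (cE E) p (Pi.single k ξ)) = Polynomial.aeval (cE E) p (cE E (Pi.single k ξ)) := by
          have : Polynomial.aeval (cE E) (Polynomial.X * p) = Polynomial.aeval (cE E) (p * Polynomial.X) := by rw [mul_comm]
          rw [map_mul, map_mul, Polynomial.aeval_X] at this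
          exact LinearMap.congr_fun this _
        rw [h2, cE_single hξ, map_add, map_smul, map_sum] at h1
        have h3 : (ell nu i - ell nu k) • Polynomial.aeval (cE E) p (Pi.single k ξ)
            = ∑ l ∈ Finset.univ.filter (fun l => k < l), dE E l k (Polynomial.aeval (cE E) p (Pi.single l ξ)) := by
          rw [sub_smul, ← h1, add_sub_cancel_left]
          exact Finset.sum_congr rfl fun l _ => cE_pow_dE hE _ _ _ _
        have h4 : (ell nu i - ell nu k) • Polynomial.aeval (cE E) p (Pi.single k ξ) ∈ LinearMap.range φ := by
          rw [h3]
          refine Submodule.sum_mem _ fun l hl => hinvR _ _ _ (ih (n - l.val) ?_ l rfl)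
          have := Fin.lt_def.1 (Finset.mem_filter.1 hl).2
          have := l.2
          omega
        exact (Submodule.smul_mem_iff _ (sub_ne_zero.2 (hd i k h.ne'))).1 h4
      · rw [h]; exact hi
      · rw [hgt k h]; exact Submodule.zero_mem _
  have htop : (LinearMap.range φ).comap (Polynomial.aeval (cE E) p) = ⊤ := by
    refine dspan hI h0 _ ?_ fun l => hall _ l rfl
    intro a b w hw
    rw [Submodule.mem_comap] at hw ⊢
    rw [cE_pow_dE hE]
    exact hinvR _ _ _ hw
  have hv1 : v ∈ (LinearMap.range φ).comap (Polynomial.aeval (cE E) p) := by rw [htop]; trivial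
  rw [Submodule.mem_comap, aeval_eig _ _ _ _ hv] at hv1
  refine (Submodule.smul_mem_iff _ ?_).1 hv1
  simp only [p, ppoly, Polynomial.eval_prod, Polynomial.eval_sub, Polynomial.eval_X, Polynomial.eval_C]
  exact Finset.prod_ne_zero_iff.2 fun j hj => sub_ne_zero.2 (hd i j (Finset.ne_of_mem_erase hj).symm)

/-- The action on the natural module tensored with `V`. -/
noncomputable def uE (E : Fin n → Fin n → Module.End ℂ V) (i j : Fin n) : Module.End ℂ (Fin n → V) where
  toFun w k := E i j (w k) + if k = i then w j else 0
  map_add' w w' := by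
    funext k
    simp only [Pi.add_apply, map_add]
    split_ifs <;> abel
  map_smul' c w := by
    funext k
    simp only [Pi.smul_apply, map_smul, RingHom.id_apply]
    split_ifs <;> simp [smul_add]

theorem uE_apply (E : Fin n → Fin n → Module.End ℂ V) (i j : Fin n) (w : Fin n → V) (k : Fin n) :
    uE E i j w k = E i j (w k) + if k = i then w j else 0 := rfl

theorem uE_glc {E : Fin n → Fin n → Module.End ℂ V} (hE : GLc E) : GLc (uE E) := by
  intro i j k l
  refine LinearMap.ext fun w => funext fun a => ?_
  have h := hE.ap i j k l (w a)
  simp only [LinearMap.sub_apply, Module.End.mul_apply, Pi.sub_apply, uE_apply, map_add, h]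
  by_cases h1 : j = k <;> by_cases h2 : l = i <;> by_cases h3 : a = i <;> by_cases h4 : a = k <;>
    by_cases h5 : k = i <;> simp_all [uE_apply] <;> (try split_ifs) <;> (try simp_all) <;> (try abel)

theorem uE_single (E : Fin n → Fin n → Module.End ℂ V) (i j b : Fin n) (m : V) :
    uE E i j (Pi.single b m) = Pi.single b (E i j m) + if j = b then Pi.single i m else 0 := by
  funext k
  rw [uE_apply, Pi.add_apply]
  by_cases h1 : k = b <;> by_cases h2 : j = b <;> by_cases h3 : k = i <;> simp_all [Pi.single_apply]

/-- The other Casimir-type operator. -/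
noncomputable def oE (E : Fin n → Fin n → Module.End ℂ V) : Module.End ℂ (Fin n → V) where
  toFun w k := ∑ a, E a k (w a)
  map_add' w w' := by
    funext k
    simp only [Pi.add_apply, map_add, Finset.sum_add_distrib]
  map_smul' c w := by
    funext k
    simp only [Pi.smul_apply, map_smul, RingHom.id_apply, Finset.smul_sum]

theorem oE_apply (E : Fin n → Fin n → Module.End ℂ V) (w : Fin n → V) (k : Fin n) :
    oE E w k = ∑ a, E a k (w a) := rfl

theorem oE_single (E : Fin n → Fin n → Module.End ℂ V) (b : Fin n) (m : V) (k : Fin n) :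
    oE E (Pi.single b m) k = E b k m := by
  rw [oE_apply, Finset.sum_eq_single b]
  · simp
  · intro a _ ha; simp [Pi.single_apply, ha]
  · simp

theorem oE_uE {E : Fin n → Fin n → Module.End ℂ V} (hE : GLc E) (i j : Fin n) (w : Fin n → V) :
    oE E (uE E i j w) = uE E i j (oE E w) := by
  funext k
  rw [oE_apply, uE_apply, oE_apply, oE_apply, map_sum]
  simp only [uE_apply, map_add]
  have h1 : ∀ a, E i j (E a k (w a)) = E a k (E i j (w a)) + (if j = a then E i k (w a) else 0) - (if k = i then E a j (w a) else 0) :=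
    fun a => hE.ap i j a k (w a)
  simp only [h1, Finset.sum_sub_distrib, Finset.sum_add_distrib, Finset.sum_ite_eq, Finset.mem_univ, if_true]
  have h2 : ∀ a, E a k (if a = i then w j else 0) = if a = i then E a k (w j) else 0 := by
    intro a; split_ifs <;> simp
  simp only [h2, Finset.sum_ite_eq', Finset.mem_univ, if_true]
  by_cases h : k = i <;> simp [h]

theorem exists_max_inv {W : Type} [AddCommGroup W] [Module ℂ W] [FiniteDimensional ℂ W]
    (D : Fin n → Fin n → Module.End ℂ W) (U : Submodule ℂ W) (hU : GInv D U) (hne : U ≠ ⊤) :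
    ∃ U', U ≤ U' ∧ GInv D U' ∧ U' ≠ ⊤ ∧ ∀ X, GInv D X → U' ≤ X → X = U' ∨ X = ⊤ := by
  obtain ⟨U', ⟨h1, h2, h3⟩, h4⟩ := (wellFounded_gt : WellFounded ((· > ·) : Submodule ℂ W → _ → Prop)).has_min
    {X | U ≤ X ∧ GInv D X ∧ X ≠ ⊤} ⟨U, le_rfl, hU, hne⟩
  refine ⟨U', h1, h2, h3, fun X hX hle => ?_⟩
  by_contra hc
  push Not at hc
  exact h4 X ⟨h1.trans hle, hX, hc.2⟩ (lt_of_le_of_ne hle hc.1.symm)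

theorem exists_step [FiniteDimensional ℂ V] {E : Fin n → Fin n → Module.End ℂ V} (hE : GLc E) (hI : GIrr E)
    {lam : Fin n → ℂ} {ξ : V} (hξ : HW E lam ξ) (h0 : ξ ≠ 0) (i0 : Fin n) (hi0 : ∀ j, i0 ≤ j)
    (hns : ¬ ∀ i j, E i j = if i = j then lam i0 • 1 else 0) :
    ∃ i, i ≠ i0 ∧ ∃ R : GLRep n (lam + Pi.single i 1), ∃ φ : V →ₗ[ℂ] (Fin n → R.V),
      (∀ a b m, dE R.E a b (φ m) = φ (E a b m)) ∧ φ ξ ≠ 0 := by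
  let U : Submodule ℂ (Fin n → V) := LinearMap.ker (oE E - lam i0 • 1)
  have hUm : ∀ w, w ∈ U ↔ oE E w = lam i0 • w := by
    intro w
    simp only [U, LinearMap.mem_ker, LinearMap.sub_apply, LinearMap.smul_apply, Module.End.one_apply, sub_eq_zero]
  have hUi : GInv (uE E) U := by
    intro i j w hw
    rw [hUm] at hw ⊢
    rw [oE_uE hE, hw, map_smul]
  have hU0 : Pi.single i0 ξ ∈ U := by
    rw [hUm]
    funext k
    rw [oE_single, Pi.smul_apply]
    rcases eq_or_ne k i0 with h | h
    · subst h; rw [hξ.2]; simp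
    · rw [hξ.1 i0 k (lt_of_le_of_ne (hi0 k) h.symm)]; simp [Pi.single_apply, h]
  have hUt : U ≠ ⊤ := by
    intro h
    refine hns fun i j => LinearMap.ext fun m => ?_
    have h1 : Pi.single i m ∈ U := by rw [h]; trivial
    have h2 := congrFun ((hUm _).1 h1) j
    rw [oE_single, Pi.smul_apply] at h2
    rw [h2]
    by_cases h : i = j
    · subst h; simp
    · simp [h, Pi.single_apply, Ne.symm h]
  obtain ⟨U', hUU, hinv, hnt, hmax⟩ := exists_max_inv (uE E) U hUi hUt
  have hex : ∃ i, Pi.single i ξ ∉ U' := by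
    by_contra hc
    push Not at hc
    let S : Submodule ℂ V := ⨅ l, U'.comap (LinearMap.single ℂ (fun _ : Fin n => V) l)
    have hS : ∀ m, m ∈ S ↔ ∀ l : Fin n, (Pi.single l m : Fin n → V) ∈ U' := by
      intro m; simp [S, Submodule.mem_iInf]
    have hSi : GInv E S := by
      intro i j m hm
      rw [hS] at hm ⊢
      intro l
      have h1 := hinv i j _ (hm l)
      rw [uE_single] at h1
      have h2 : (Pi.single l (E i j m) : Fin n → V) = (Pi.single l (E i j m) + if j = l then Pi.single i m else 0) - if j = l then Pi.single i m else 0 := by abel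
      rw [h2]
      refine U'.sub_mem h1 ?_
      split_ifs
      · exact hm i
      · exact U'.zero_mem
    rcases hI S hSi with h | h
    · have : ξ ∈ S := (hS ξ).2 hc
      rw [h] at this
      exact h0 ((Submodule.mem_bot ℂ).1 this)
    · refine hnt ?_
      rw [eq_top_iff]
      intro w _
      rw [← Finset.univ_sum_single w]
      refine U'.sum_mem fun l _ => ?_
      refine (hS (w l)).1 ?_ l
      rw [h]; trivial
  have hne : (Finset.univ.filter (fun i => Pi.single i ξ ∉ U')).Nonempty := by
    obtain ⟨k, hk⟩ := hex
    exact ⟨k, by simpa using hk⟩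
  obtain ⟨i, hi1, hi2⟩ := Finset.exists_min_image _ id hne
  have hi : Pi.single i ξ ∉ U' := (Finset.mem_filter.1 hi1).2
  have hlt : ∀ l, l < i → Pi.single l ξ ∈ U' := by
    intro l hl
    by_contra hc
    exact absurd (hi2 l (by simpa using hc)) (not_le.2 hl)
  let D : Fin n → Fin n → Module.End ℂ ((Fin n → V) ⧸ U') := fun a b => U'.mapQ U' (uE E a b) (fun w hw => hinv a b w hw)
  have hD : ∀ a b w, D a b (U'.mkQ w) = U'.mkQ (uE E a b w) := fun a b w => rfl
  let R : GLRep n (lam + Pi.single i 1) := {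
    V := (Fin n → V) ⧸ U'
    E := D
    commRel := by
      intro a b c d
      refine LinearMap.ext fun x => ?_
      obtain ⟨w, rfl⟩ := U'.mkQ_surjective x
      have h := (uE_glc hE).ap a b c d w
      simp only [LinearMap.sub_apply, LinearMap.comp_apply, hD, h, map_sub, map_add]
      by_cases h1 : b = c <;> by_cases h2 : d = a <;> simp only [h1, h2, if_true, if_false, LinearMap.zero_apply, hD, map_zero] <;> abel
    hv := U'.mkQ (Pi.single i ξ)
    hv_ne := by
      rw [Submodule.mkQ_apply, Ne, Submodule.Quotient.mk_eq_zero]; exact hi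
    hv_upper := by
      intro a b hab
      rw [hD, uE_single, hξ.1 a b hab, Submodule.mkQ_apply, Submodule.Quotient.mk_eq_zero, Pi.single_zero, zero_add]
      split_ifs with h
      · exact hlt a (h ▸ hab)
      · exact U'.zero_mem
    hv_diag := by
      intro a
      rw [hD, uE_single, hξ.2, ← map_smul, Pi.add_apply, add_smul, Pi.single_smul]
      congr 2
      by_cases h : a = i
      · subst h; simp
      · simp [h, Pi.single_apply]
    irreducible := by
      intro X hX
      have h1 : GInv (uE E) (X.comap U'.mkQ) := by
        intro a b w hw
        rw [Submodule.mem_comap] at hw ⊢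
        exact hX a b _ hw
      have h2 : U' ≤ X.comap U'.mkQ := by
        intro w hw
        rw [Submodule.mem_comap, Submodule.mkQ_apply, (Submodule.Quotient.mk_eq_zero U').2 hw]
        exact X.zero_mem
      rcases hmax _ h1 h2 with h | h
      · left
        rw [eq_bot_iff]
        intro x hx
        obtain ⟨w, rfl⟩ := U'.mkQ_surjective x
        have : w ∈ X.comap U'.mkQ := hx
        rw [h] at this
        rw [Submodule.mem_bot, Submodule.mkQ_apply, Submodule.Quotient.mk_eq_zero]
        exact this
      · right
        rw [eq_top_iff]
        intro x _
        obtain ⟨w, rfl⟩ := U'.mkQ_surjective x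
        have : w ∈ X.comap U'.mkQ := by rw [h]; trivial
        exact this }
  refine ⟨i, ?_, R, LinearMap.pi fun k => U'.mkQ ∘ₗ LinearMap.single ℂ (fun _ : Fin n => V) k, ?_, ?_⟩
  · rintro rfl
    exact hi (hUU hU0)
  · intro a b m
    funext k
    rw [dE_apply]
    change D a b (U'.mkQ (Pi.single k m)) - (if k = b then U'.mkQ (Pi.single a m) else 0) = U'.mkQ (Pi.single k (E a b m))
    rw [hD, uE_single, map_add]
    by_cases h : k = b
    · subst h; simp
    · simp [h, Ne.symm h]
  · intro h
    have h1 := congrFun h i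
    exact R.hv_ne h1

end gl3
end YG

namespace YG
open Filter

section gl4
variable {n : ℕ} {V : Type} [AddCommGroup V] [Module ℂ V] {ν : Type} [Fintype ν] [DecidableEq ν]

/-- Matrix representation in a basis. -/
noncomputable def mrep (b : Module.Basis ν ℂ V) {E : Fin n → Fin n → Module.End ℂ V} (hE : GLc E) : MRep n ν where
  e i j := LinearMap.toMatrixAlgEquiv b (E i j)
  comm i j k l := by
    rw [← map_mul, ← map_mul, ← map_sub, hE, map_sub]
    split_ifs <;> simp

/-- Basis of `Fin n → V`. -/
noncomputable def bW (n : ℕ) (b : Module.Basis ν ℂ V) : Module.Basis (Fin n × ν) ℂ (Fin n → V) :=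
  (Pi.basis fun _ : Fin n => b).reindex (Equiv.sigmaEquivProd (Fin n) ν)

theorem bW_apply (b : Module.Basis ν ℂ V) (k : Fin n) (α : ν) : bW n b (k, α) = Pi.single k (b α) := by
  simp [bW, Pi.basis_apply]

theorem bW_repr (b : Module.Basis ν ℂ V) (w : Fin n → V) (k : Fin n) (α : ν) : (bW n b).repr w (k, α) = b.repr (w k) α := by
  simp [bW]

theorem mrep_e (b : Module.Basis ν ℂ V) {E : Fin n → Fin n → Module.End ℂ V} (hE : GLc E) (i j : Fin n) (α β : ν) :
    (mrep b hE).e i j α β = b.repr (E i j (b β)) α := by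
  exact LinearMap.toMatrixAlgEquiv_apply b _ _ _

theorem Aop_mrep (b : Module.Basis ν ℂ V) {E : Fin n → Fin n → Module.End ℂ V} (hE : GLc E) (c : ℂ) :
    Aop (mrep b hE) c = LinearMap.toMatrixAlgEquiv (bW n b) (cE E + c • 1) := by
  ext ⟨k, α⟩ ⟨l, β⟩
  rw [LinearMap.toMatrixAlgEquiv_apply, bW_apply, bW_repr]
  simp only [Aop, Matrix.of_apply, MRep.L, Matrix.add_apply, mrep_e]
  rw [LinearMap.add_apply, LinearMap.smul_apply, Module.End.one_apply, Pi.add_apply, Pi.smul_apply, cE_apply,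
    Finset.sum_eq_single l, Pi.single_eq_same, map_add, Finsupp.add_apply, add_comm]
  · congr 1
    by_cases h : k = l
    · subst h; simp [Matrix.one_apply, Finsupp.single_apply, eq_comm]
    · simp [h, Pi.single_apply]
  · intro a _ ha; simp [Pi.single_apply, ha]
  · simp

theorem Eop_mrep (b : Module.Basis ν ℂ V) {E : Fin n → Fin n → Module.End ℂ V} (hE : GLc E) (i j : Fin n) :
    Eop (mrep b hE) i j = LinearMap.toMatrixAlgEquiv (bW n b) (dE E i j) := by
  ext ⟨k, α⟩ ⟨l, β⟩
  rw [LinearMap.toMatrixAlgEquiv_apply, bW_apply, bW_repr, dE_apply]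
  simp only [Eop, Matrix.sub_apply, inR_apply, inL_apply, mrep_e, map_sub, Finsupp.sub_apply]
  congr 1
  · by_cases h : k = l
    · subst h; simp
    · simp [h, Pi.single_apply]
  · by_cases h1 : k = j <;> by_cases h2 : l = i
    · subst h1; subst h2; simp [Finsupp.single_apply, eq_comm]
    · subst h1; simp [h2, Ne.symm h2, Matrix.single_apply, Pi.single_apply]
    · simp [h1, Ne.symm h1, Matrix.single_apply]
    · simp [h1, Ne.symm h1, Matrix.single_apply]

theorem exists_factor {W X : Type} [AddCommGroup W] [Module ℂ W] [AddCommGroup X] [Module ℂ X] (A : W →ₗ[ℂ] W) (g : W →ₗ[ℂ] X)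
    (h : ∀ w, A w = 0 → g w = 0) : ∃ B : W →ₗ[ℂ] X, B ∘ₗ A = g := by
  obtain ⟨s, hs⟩ := A.rangeRestrict.exists_rightInverse_of_surjective A.range_rangeRestrict
  obtain ⟨B, hB⟩ := (g ∘ₗ s).exists_extend
  refine ⟨B, LinearMap.ext fun w => ?_⟩
  have h1 := LinearMap.congr_fun hB (A.rangeRestrict w)
  have h2 : A (s (A.rangeRestrict w)) = A w := by
    have := LinearMap.congr_fun hs (A.rangeRestrict w)
    exact congrArg Subtype.val this
  have h3 : g (s (A.rangeRestrict w) - w) = 0 := h _ (by rw [map_sub, h2, sub_self])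
  rw [map_sub, sub_eq_zero] at h3
  rw [LinearMap.comp_apply, ← h3]
  exact h1

theorem exists_fuse {M μ : Type} [AddCommGroup M] [Module ℂ M] [Fintype μ] [DecidableEq μ]
    (b : Module.Basis ν ℂ V) (bM : Module.Basis μ ℂ M)
    {E : Fin n → Fin n → Module.End ℂ V} (hE : GLc E) {EM : Fin n → Fin n → Module.End ℂ M} (hEM : GLc EM) (c : ℂ)
    (φ : M →ₗ[ℂ] (Fin n → V)) (hφ : ∀ i j m, dE E i j (φ m) = φ (EM i j m))
    (hinj : Function.Injective φ) (hA : ∀ m, (cE E + c • 1) (φ m) = 0)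
    (hr : ∀ v, (cE E + c • 1) v = 0 → v ∈ LinearMap.range φ) :
    Nonempty (Fuse (mrep b hE) (mrep bM hEM) c) := by
  obtain ⟨ψ, hψ⟩ := φ.exists_leftInverse_of_injective (LinearMap.ker_eq_bot.2 hinj)
  obtain ⟨B, hB⟩ := exists_factor (cE E + c • 1) (LinearMap.id - φ ∘ₗ ψ) (by
    intro w hw
    obtain ⟨m, rfl⟩ := hr w hw
    have := LinearMap.congr_fun hψ m
    rw [LinearMap.comp_apply, LinearMap.id_apply] at this
    rw [LinearMap.sub_apply, LinearMap.comp_apply, this, LinearMap.id_apply, sub_self])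
  refine ⟨⟨LinearMap.toMatrix bM (bW n b) φ, LinearMap.toMatrix (bW n b) bM ψ, LinearMap.toMatrix (bW n b) (bW n b) B,
    ?_, ?_, ?_, ?_⟩⟩
  · rw [← LinearMap.toMatrix_comp, hψ, LinearMap.toMatrix_id]
  · rw [Aop_mrep]
    rw [show LinearMap.toMatrixAlgEquiv (bW n b) (cE E + c • 1) = LinearMap.toMatrix (bW n b) (bW n b) (cE E + c • 1) from rfl]
    rw [← LinearMap.toMatrix_comp]
    have : (cE E + c • 1) ∘ₗ φ = 0 := LinearMap.ext hA
    rw [this, map_zero]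
  · rw [Aop_mrep]
    change _ + _ * LinearMap.toMatrix (bW n b) (bW n b) _ = _
    rw [← LinearMap.toMatrix_comp, ← LinearMap.toMatrix_comp, hB, ← map_add, add_sub_cancel, LinearMap.toMatrix_id]
  · intro i j
    rw [Eop_mrep]
    change LinearMap.toMatrix (bW n b) (bW n b) _ * _ = _ * LinearMap.toMatrix bM bM (EM i j)
    rw [← LinearMap.toMatrix_comp, ← LinearMap.toMatrix_comp]
    congr 1
    exact LinearMap.ext fun m => hφ i j m

theorem mact_pi0 (X : Matrix ν ν ℂ) (u : ν → ℂ) : mact π0 X u = X.mulVec u := by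
  funext α
  refine (mact_apply _ _ _ _).trans ?_
  simp [Matrix.mulVec, dotProduct, π0, Algebra.ofId_apply, Module.algebraMap_end_apply]

theorem irr_mrep (b : Module.Basis ν ℂ V) {E : Fin n → Fin n → Module.End ℂ V} (hE : GLc E) (hI : GIrr E) :
    Irr (V := ν → ℂ) (box (one n) (mrep b hE)) (mact π0) := by
  intro S hS
  have h : GInv E (S.comap b.equivFun.toLinearMap) := by
    intro i j v hv
    have h1 := hS 0 i j _ hv
    rw [box_one_T, mact_pi0] at h1
    have h2 : (mrep b hE).L 0 i j = LinearMap.toMatrix b b (E i j) := by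
      simp only [MRep.L, zero_smul, ite_self, zero_add]; rfl
    rw [h2] at h1
    have h3 := LinearMap.toMatrix_mulVec_repr b b (E i j) v
    rw [Submodule.mem_comap]
    refine (Eq.subst h3 h1 :)
  have hc : ∀ u : ν → ℂ, u ∈ S ↔ b.equivFun.symm u ∈ S.comap b.equivFun.toLinearMap := by
    intro u; rw [Submodule.mem_comap, LinearEquiv.coe_coe, LinearEquiv.apply_symm_apply]
  rcases hI _ h with h | h
  · left
    rw [eq_bot_iff]
    intro u hu
    rw [hc, h, Submodule.mem_bot] at hu
    rw [Submodule.mem_bot]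
    exact (LinearEquiv.map_eq_zero_iff _).1 hu
  · right
    rw [eq_top_iff]
    intro u _
    rw [hc, h]; trivial

theorem unit_mrep (b : Module.Basis ν ℂ V) [FiniteDimensional ℂ V] {E : Fin n → Fin n → Module.End ℂ V} (hE : GLc E) (hI : GIrr E)
    {lam : Fin n → ℂ} {ξ : V} (hξ : HW E lam ξ) (h0 : ξ ≠ 0) (c : ℂ) (hc : ∀ j, - c ≠ ell lam j) :
    IsUnit (Matrix.of ((mrep b hE).L c) : Matrix (Fin n) (Fin n) (Matrix ν ν ℂ)) := by
  have h1 : IsUnit (cE E + c • 1) := by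
    rw [LinearMap.isUnit_iff_ker_eq_bot, LinearMap.ker_eq_bot']
    intro w hw
    rw [LinearMap.add_apply, LinearMap.smul_apply, Module.End.one_apply] at hw
    have h2 : cE E w = (-c) • w := by rw [neg_smul]; exact eq_neg_of_add_eq_zero_left hw
    have h3 := aeval_eig _ (ppoly lam Finset.univ) _ _ h2
    rw [char_id hE hI hξ h0, LinearMap.zero_apply] at h3
    refine (smul_eq_zero.1 h3.symm).resolve_left ?_
    simp only [ppoly, Polynomial.eval_prod, Polynomial.eval_sub, Polynomial.eval_X, Polynomial.eval_C]
    exact Finset.prod_ne_zero_iff.2 fun j hj => sub_ne_zero.2 (hc j)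
  have h2 : IsUnit (Aop (mrep b hE) c) := by
    rw [Aop_mrep]; exact h1.map _
  exact h2.map (Matrix.compRingEquiv (Fin n) ν ℂ).symm

theorem poly_mrep (b : Module.Basis ν ℂ V) {E : Fin n → Fin n → Module.End ℂ V} (hE : GLc E) (hI : GIrr E)
    {nu : Fin n → ℂ} {ξ : V} (hξ : HW E nu ξ) (h0 : ξ ≠ 0)
    (hd : ∀ i j : Fin n, i ≠ j → ell nu i ≠ ell nu j) (i : Fin n) :
    ∃ P : Polynomial ℂ, P.eval 0 ≠ 0 ∧
      Aop (mrep b hE) (-ell nu i) * Polynomial.aeval (Aop (mrep b hE) (-ell nu i)) P = 0 := by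
  refine ⟨(ppoly nu (Finset.univ.erase i)).comp (Polynomial.X + Polynomial.C (ell nu i)), ?_, ?_⟩
  · simp only [ppoly, Polynomial.eval_comp, Polynomial.eval_prod, Polynomial.eval_sub, Polynomial.eval_add, Polynomial.eval_X, Polynomial.eval_C, zero_add]
    exact Finset.prod_ne_zero_iff.2 fun j hj => sub_ne_zero.2 (hd i j (Finset.ne_of_mem_erase hj).symm)
  · have h1 : (Polynomial.X : Polynomial ℂ) * (ppoly nu (Finset.univ.erase i)).comp (Polynomial.X + Polynomial.C (ell nu i))
        = (ppoly nu Finset.univ).comp (Polynomial.X + Polynomial.C (ell nu i)) := by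
      have : ppoly nu Finset.univ = (Polynomial.X - Polynomial.C (ell nu i)) * ppoly nu (Finset.univ.erase i) :=
        (Finset.mul_prod_erase Finset.univ _ (Finset.mem_univ i)).symm
      rw [this, Polynomial.mul_comp]
      simp
    have h2 : Aop (mrep b hE) (-ell nu i) * Polynomial.aeval (Aop (mrep b hE) (-ell nu i)) ((ppoly nu (Finset.univ.erase i)).comp (Polynomial.X + Polynomial.C (ell nu i)))
       = Polynomial.aeval (Aop (mrep b hE) (-ell nu i)) ((ppoly nu Finset.univ).comp (Polynomial.X + Polynomial.C (ell nu i))) := by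
      rw [← h1, map_mul, Polynomial.aeval_X]
    rw [h2, Aop_mrep, Polynomial.aeval_comp]
    have h3 : Polynomial.aeval (LinearMap.toMatrixAlgEquiv (bW n b) (cE E + (-ell nu i) • 1)) (Polynomial.X + Polynomial.C (ell nu i))
        = LinearMap.toMatrixAlgEquiv (bW n b) (cE E) := by
      rw [map_add, Polynomial.aeval_X, Polynomial.aeval_C, map_add, map_smul, map_one, Algebra.algebraMap_eq_smul_one]
      module
    rw [h3, ← AlgEquiv.coe_toAlgHom, Polynomial.aeval_algHom_apply, char_id hE hI hξ h0, map_zero]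

end gl4

section main
variable {n : ℕ} {lam : Fin n → ℂ}

theorem glc_of (R : GLRep n lam) : GLc (V := R.V) R.E := fun i j k l => R.commRel i j k l

theorem hw_of (R : GLRep n lam) : HW (V := R.V) R.E lam R.hv := ⟨R.hv_upper, R.hv_diag⟩

theorem girr_of (R : GLRep n lam) : GIrr (V := R.V) R.E := fun U hU => R.irreducible U hU

/-- Matrices. -/
noncomputable def rmat (R : GLRep n lam) : MRep n (Fin (Module.finrank ℂ R.V)) := mrep (Module.finBasis ℂ R.V) (glc_of R)

theorem rpos (R : GLRep n lam) : 0 < Module.finrank ℂ R.V := by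
  haveI : Nontrivial R.V := ⟨R.hv, 0, R.hv_ne⟩
  exact Module.finrank_pos

theorem real_base (R : GLRep n lam) (c : ℂ) (h : ∀ i j, R.E i j = if i = j then c • (1 : Module.End ℂ R.V) else 0) :
    ∃ F : RFam (rmat R), Real F := by
  have h1 : ∀ i j, (rmat R).e i j = if i = j then c • 1 else 0 := by
    intro i j
    change LinearMap.toMatrixAlgEquiv _ (R.E i j) = _
    rw [h]
    split_ifs <;> simp
  refine ⟨baseFam _ c h1, ?_⟩
  have h2 : Module.finrank ℂ R.V ≤ 1 := by
    rcases R.irreducible (Submodule.span ℂ {R.hv}) (by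
      intro i j v hv
      rw [h]
      split_ifs
      · exact Submodule.smul_mem _ _ hv
      · exact Submodule.zero_mem _) with h3 | h3
    · exact absurd (Submodule.span_singleton_eq_bot.1 h3) R.hv_ne
    · rw [← finrank_top ℂ R.V, ← h3]
      rw [finrank_span_singleton R.hv_ne]
  haveI : Subsingleton (Fin (Module.finrank ℂ R.V)) := Fin.subsingleton_iff_le_one.2 h2
  refine ⟨1, one_ne_zero, 0, fun _ => 1, PolyFun.const _, fun u => ?_, ?_⟩
  · rw [pow_zero, one_smul]; rfl
  · rw [one_smul]
    ext α β γ δ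
    rw [Flip_apply, Subsingleton.elim α β, Subsingleton.elim γ β, Subsingleton.elim δ β]
    simp

theorem real_step (R : GLRep n lam) (i : Fin n) (N : GLRep n (lam + Pi.single i 1)) (φ : R.V →ₗ[ℂ] (Fin n → N.V))
    (hφ : ∀ a b m, dE (V := N.V) N.E a b (φ m) = φ (R.E a b m)) (hφ0 : φ R.hv ≠ 0) (hF : ∃ F : RFam (rmat N), Real F) :
    ∃ F : RFam (rmat R), Real F := by
  obtain ⟨F, hF⟩ := hF
  haveI : Nonempty (Fin (Module.finrank ℂ R.V)) := ⟨⟨0, rpos R⟩⟩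
  haveI : Nonempty (Fin (Module.finrank ℂ N.V)) := ⟨⟨0, rpos N⟩⟩
  have hd : ∀ a b : Fin n, a ≠ b → ell (lam + Pi.single i 1) a ≠ ell (lam + Pi.single i 1) b :=
    fun a b => ell_inj fun a b => hw_dom (glc_of N) (hw_of N) N.hv_ne
  have hlam : lam = (lam + Pi.single i 1) - Pi.single i 1 := by abel
  have hM : HW (V := R.V) R.E ((lam + Pi.single i 1) - Pi.single i 1) R.hv := by rw [← hlam]; exact hw_of R
  have hinj : Function.Injective φ := by
    rw [← LinearMap.ker_eq_bot]
    rcases R.irreducible (LinearMap.ker φ) (by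
      intro a b v hv
      rw [LinearMap.mem_ker] at hv ⊢
      rw [← hφ, hv, map_zero]) with h | h
    · exact h
    · exfalso
      refine hφ0 ?_
      have : R.hv ∈ LinearMap.ker φ := by rw [h]; trivial
      exact this
  have hchar : ∀ m, cE (V := N.V) N.E (φ m) = ell (lam + Pi.single i 1) i • φ m := by
    let K : Submodule ℂ R.V := LinearMap.ker ((cE (V := N.V) N.E - ell (lam + Pi.single i 1) i • 1) ∘ₗ φ)
    have hK : ∀ m, m ∈ K ↔ cE (V := N.V) N.E (φ m) = ell (lam + Pi.single i 1) i • φ m := by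
      intro m
      simp only [K, LinearMap.mem_ker, LinearMap.comp_apply, LinearMap.sub_apply, LinearMap.smul_apply, Module.End.one_apply, sub_eq_zero]
    have hv : R.hv ∈ K := by
      rw [hK]
      refine cE_hw (glc_of N) (girr_of N) (hw_of N) N.hv_ne ?_
      constructor
      · intro a b hab; rw [hφ, hM.1 a b hab, map_zero]
      · intro a; rw [hφ, hM.2, map_smul]
    rcases R.irreducible K (by
      intro a b v hv
      rw [hK] at hv ⊢
      rw [← hφ, cE_dE (glc_of N), hv, map_smul]) with h | h
    · rw [h] at hv
      exact absurd ((Submodule.mem_bot ℂ).1 hv) R.hv_ne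
    · intro m
      rw [← hK, h]; trivial
  obtain ⟨f⟩ := exists_fuse (Module.finBasis ℂ N.V) (Module.finBasis ℂ R.V) (glc_of N) (glc_of R) (-ell (lam + Pi.single i 1) i) φ hφ hinj
    (by
      intro m
      rw [LinearMap.add_apply, hchar, LinearMap.smul_apply, Module.End.one_apply, neg_smul, add_neg_cancel])
    (by
      intro v hv
      rw [LinearMap.add_apply, LinearMap.smul_apply, Module.End.one_apply, neg_smul, ← sub_eq_add_neg, sub_eq_zero] at hv
      exact ker_range (glc_of N) (girr_of N) (hw_of N) N.hv_ne hd φ hφ i hM hφ0 v hv)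
  obtain ⟨P, hP0, hP⟩ := poly_mrep (Module.finBasis ℂ N.V) (glc_of N) (girr_of N) (hw_of N) N.hv_ne hd i
  have hu := unit_mrep (Module.finBasis ℂ R.V) (glc_of R) (girr_of R) (hw_of R) R.hv_ne (-ell (lam + Pi.single i 1) i) (by
    intro j
    rw [neg_neg]
    by_cases hj : j = i
    · subst hj
      simp only [ell, Pi.add_apply, Pi.single_eq_same]
      intro h
      exact one_ne_zero (by linear_combination h : (1 : ℂ) = 0)
    · have := hd i j (Ne.symm hj)
      intro h
      refine this (h.trans ?_)
      simp [ell, Pi.single_apply, hj])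
  refine ⟨fuseFam F f, real_of_irr _ (irr_MM hF f (irr_mrep _ _ (girr_of N)) (irr_mrep _ _ (girr_of R)) P hP0 hP hu)⟩

theorem exists_real_pos (hn : 0 < n) : ∀ (m : ℕ) (lam : Fin n → ℂ) (R : GLRep n lam), ∑ j, (lam ⟨0, hn⟩ - lam j) = m →
    ∃ F : RFam (rmat R), Real F := by
  intro m
  have hi0 : ∀ j : Fin n, (⟨0, hn⟩ : Fin n) ≤ j := fun j => Fin.le_def.2 (Nat.zero_le _)
  have hnat : ∀ (lam : Fin n → ℂ) (R : GLRep n lam), ∃ m : ℕ, ∑ j, (lam ⟨0, hn⟩ - lam j) = m := by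
    intro lam R
    have h1 : ∀ j, ∃ m : ℕ, lam ⟨0, hn⟩ - lam j = m := by
      intro j
      rcases (hi0 j).eq_or_lt with h | h
      · exact ⟨0, by rw [← h]; simp⟩
      · exact hw_dom (glc_of R) (hw_of R) R.hv_ne h
    choose g hg using h1
    exact ⟨∑ j, g j, by push_cast; exact Finset.sum_congr rfl fun j _ => hg j⟩
  induction m with
  | zero =>
    intro lam R hm
    by_cases hs : ∀ i j, R.E i j = if i = j then lam ⟨0, hn⟩ • (1 : Module.End ℂ R.V) else 0
    · exact real_base R _ hs
    · obtain ⟨i, hi, N, φ, hφ, hφ0⟩ := exists_step (glc_of R) (girr_of R) (hw_of R) R.hv_ne _ hi0 hs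
      exfalso
      obtain ⟨m', hm'⟩ := hnat _ N
      have e : ∑ j, ((lam + Pi.single i 1 : Fin n → ℂ) ⟨0, hn⟩ - (lam + Pi.single i 1 : Fin n → ℂ) j) = ∑ j, (lam ⟨0, hn⟩ - lam j) - 1 := by
        simp only [Pi.add_apply, Pi.single_eq_of_ne hi.symm, add_zero, Finset.sum_sub_distrib, Finset.sum_add_distrib,
          Finset.sum_pi_single', Finset.mem_univ, if_true]
        ring
      rw [e, hm] at hm'
      have : ((m' + 1 : ℕ) : ℂ) = 0 := by push_cast; rw [← hm']; push_cast; ring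
      exact Nat.succ_ne_zero _ (Nat.cast_eq_zero.1 this)
  | succ m ih =>
    intro lam R hm
    by_cases hs : ∀ i j, R.E i j = if i = j then lam ⟨0, hn⟩ • (1 : Module.End ℂ R.V) else 0
    · exact real_base R _ hs
    · obtain ⟨i, hi, N, φ, hφ, hφ0⟩ := exists_step (glc_of R) (girr_of R) (hw_of R) R.hv_ne _ hi0 hs
      have e : ∑ j, ((lam + Pi.single i 1 : Fin n → ℂ) ⟨0, hn⟩ - (lam + Pi.single i 1 : Fin n → ℂ) j) = ∑ j, (lam ⟨0, hn⟩ - lam j) - 1 := by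
        simp only [Pi.add_apply, Pi.single_eq_of_ne hi.symm, add_zero, Finset.sum_sub_distrib, Finset.sum_add_distrib,
          Finset.sum_pi_single', Finset.mem_univ, if_true]
        ring
      refine real_step R i N φ hφ hφ0 (ih _ N ?_)
      rw [e, hm]; push_cast; ring

theorem exists_real (R : GLRep n lam) : ∃ F : RFam (rmat R), Real F := by
  rcases Nat.eq_zero_or_pos n with h | hn
  · subst h
    exact real_base R 0 fun i => i.elim0
  · have hi0 : ∀ j : Fin n, (⟨0, hn⟩ : Fin n) ≤ j := fun j => Fin.le_def.2 (Nat.zero_le _)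
    have h1 : ∀ j, ∃ m : ℕ, lam ⟨0, hn⟩ - lam j = m := by
      intro j
      rcases (hi0 j).eq_or_lt with h | h
      · exact ⟨0, by rw [← h]; simp⟩
      · exact hw_dom (glc_of R) (hw_of R) R.hv_ne h
    choose g hg using h1
    exact exists_real_pos hn (∑ j, g j) lam R (by push_cast; exact Finset.sum_congr rfl fun j _ => hg j)

/-- The helper attached to an irreducible module. -/
noncomputable def hlp (R : GLRep n lam) : Helper n :=
  ⟨Module.finrank ℂ R.V, rmat R, (exists_real R).choose, (exists_real R).choose_spec, rpos R⟩

end main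
end YG

namespace YG
open scoped TensorProduct

theorem coeff_mem {E : Type} [AddCommGroup E] [Module ℂ E] (S : Submodule ℂ E) (N : ℕ) :
    ∀ a : ℕ → E, (∀ x : ℂ, ∑ r ∈ Finset.range N, x ^ r • a r ∈ S) → ∀ r, r < N → a r ∈ S := by
  induction N with
  | zero => intro a _ r hr; omega
  | succ N ih =>
    intro a h
    have h0 : a 0 ∈ S := by
      have := h 0
      rw [Finset.sum_range_succ'] at this
      simpa using this
    have h1 : ∀ x : ℂ, ∑ r ∈ Finset.range N, x ^ r • a (r + 1) ∈ S := by
      have hp : PolyFun (fun x : ℂ => ∑ r ∈ Finset.range N, x ^ r • a (r + 1)) :=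
        PolyFun.sum _ fun r _ => PolyFun.mono r _
      refine hp.mem_of_ne S 0 fun x hx => ?_
      have := h x
      rw [Finset.sum_range_succ', pow_zero, one_smul] at this
      have h2 := (S.add_mem_iff_left h0).1 this
      have h3 := S.smul_mem x⁻¹ h2
      rw [Finset.smul_sum] at h3
      have h4 : ∑ r ∈ Finset.range N, x⁻¹ • x ^ (r + 1) • a (r + 1) = ∑ r ∈ Finset.range N, x ^ r • a (r + 1) :=
        Finset.sum_congr rfl fun r _ => by
          rw [smul_smul, pow_succ, mul_comm, mul_assoc, mul_inv_cancel₀ hx, mul_one]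
      rw [h4] at h3
      exact h3
    intro r hr
    rcases r with _ | r
    · exact h0
    · exact ih _ h1 r (by omega)

/-- A concrete model of a bundled module. -/
structure Model {n : ℕ} (Z : BY n) (W : Type) [AddCommGroup W] [Module ℂ W] (G : ℂ → Fin n → Fin n → Module.End ℂ W) where
  Ψ : W ≃ₗ[ℂ] Z.V
  int : ∀ x i j w, Ψ (G x i j w) = Z.π (Z.Y.T x i j) (Ψ w)

section model
variable {n : ℕ} {W : Type} [AddCommGroup W] [Module ℂ W] {G : ℂ → Fin n → Fin n → Module.End ℂ W}

theorem Model.irr_iff {Z : BY n} (m : Model Z W G) :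
    Z.Irr ↔ ∀ U : Submodule ℂ W, (∀ x i j, ∀ v ∈ U, G x i j v ∈ U) → U = ⊥ ∨ U = ⊤ := by
  constructor
  · intro h U hU
    have := h (U.map m.Ψ.toLinearMap) (by
      rintro x i j _ ⟨v, hv, rfl⟩
      exact ⟨_, hU x i j v hv, m.int x i j v⟩)
    rcases this with h | h
    · left
      exact (Submodule.map_eq_bot_iff (e := m.Ψ)).1 h
    · right
      exact (Submodule.map_eq_top_iff (e := m.Ψ)).1 h
  · intro h S hS
    have := h (S.comap m.Ψ.toLinearMap) (by
      intro x i j v hv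
      rw [Submodule.mem_comap] at hv ⊢
      refine (congrArg (· ∈ S) (m.int x i j v)).mpr ?_
      exact hS x i j _ hv)
    have e : (S.comap m.Ψ.toLinearMap).map m.Ψ.toLinearMap = S :=
      Submodule.map_comap_eq_of_surjective m.Ψ.surjective S
    rcases this with h | h
    · left; rw [← e, h, Submodule.map_bot]
    · right; rw [← e, h, Submodule.map_top]; exact m.Ψ.range

/-- Transport a model. -/
noncomputable def Model.congr {Z : BY n} (m : Model Z W G) {W' : Type} [AddCommGroup W'] [Module ℂ W'] (e : W' ≃ₗ[ℂ] W)
    {G' : ℂ → Fin n → Fin n → Module.End ℂ W'} (h : ∀ x i j w, e (G' x i j w) = G x i j (e w)) : Model Z W' G' where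
  Ψ := e.trans m.Ψ
  int x i j w := by rw [LinearEquiv.trans_apply, LinearEquiv.trans_apply, h, m.int]

/-- The step of a model. -/
noncomputable def Gs {lam : Fin n → ℂ} (G : ℂ → Fin n → Fin n → Module.End ℂ W) (R : GLRep n lam) (x : ℂ) (i j : Fin n) :
    Module.End ℂ (W ⊗[ℂ] R.V) :=
  x • TensorProduct.map (G x i j) LinearMap.id + ∑ a, TensorProduct.map (G x i a) (R.E a j)

noncomputable def tEq {lam : Fin n → ℂ} (R : GLRep n lam) {V : Type} [AddCommGroup V] [Module ℂ V] (Ψ : W ≃ₗ[ℂ] V) :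
    W ⊗[ℂ] R.V ≃ₗ[ℂ] (Fin (Module.finrank ℂ R.V) → V) :=
  (TensorProduct.equivFinsuppOfBasisRight (Module.finBasis ℂ R.V)).trans
    ((Finsupp.linearEquivFunOnFinite ℂ W _).trans (LinearEquiv.piCongrRight fun _ => Ψ))

theorem tEq_tmul {lam : Fin n → ℂ} (R : GLRep n lam) {V : Type} [AddCommGroup V] [Module ℂ V] (Ψ : W ≃ₗ[ℂ] V) (w : W) (v : R.V)
    (α) : tEq R Ψ (w ⊗ₜ v) α = (Module.finBasis ℂ R.V).repr v α • Ψ w := by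
  simp [tEq]

theorem L_repr {lam : Fin n → ℂ} (R : GLRep n lam) (x : ℂ) (a j : Fin n) (v : R.V) (α) :
    ∑ β, (rmat R).L x a j α β * (Module.finBasis ℂ R.V).repr v β
      = (if a = j then x * (Module.finBasis ℂ R.V).repr v α else 0) + (Module.finBasis ℂ R.V).repr (R.E a j v) α := by
  have h := congrFun (LinearMap.toMatrix_mulVec_repr (Module.finBasis ℂ R.V) (Module.finBasis ℂ R.V) (R.E a j) v) α
  rw [← h]
  simp only [MRep.L, Matrix.add_apply, add_mul, Finset.sum_add_distrib]
  congr 1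
  split_ifs
  · simp [Matrix.one_apply]
  · simp

theorem tEq_int {lam : Fin n → ℂ} (R : GLRep n lam) {A V : Type} [Ring A] [Algebra ℂ A] [AddCommGroup V] [Module ℂ V]
    (π : A →ₐ[ℂ] Module.End ℂ V) (Z : YM n A) (Ψ : W ≃ₗ[ℂ] V)
    (h : ∀ x i j w, Ψ (G x i j w) = π (Z.T x i j) (Ψ w)) (x : ℂ) (i j : Fin n) (w : W ⊗[ℂ] R.V) :
    tEq R Ψ (Gs G R x i j w) = mact π ((box Z (rmat R)).T x i j) (tEq R Ψ w) := by
  refine funext fun α => ?_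
  refine Eq.trans ?_ (mact_box π Z (rmat R) x i j _ α).symm
  induction w with
  | zero => simp only [map_zero, Pi.zero_apply, Finset.sum_const_zero]
  | add u v hu hv =>
    simp only [map_add, Pi.add_apply, Finset.sum_add_distrib]
    rw [← hu, ← hv]
  | tmul w v =>
    simp only [Gs, LinearMap.add_apply, LinearMap.smul_apply, LinearMap.sum_apply, TensorProduct.map_tmul, map_add, map_smul,
      map_sum, Pi.add_apply, Pi.smul_apply, Finset.sum_apply, lact_apply, tEq_tmul, smul_smul, ← h, LinearMap.id_apply]
    simp only [← Finset.sum_smul, L_repr, add_smul, Finset.sum_add_distrib]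
    congr 1
    simp

/-- Adding one tensor factor to a model. -/
noncomputable def Model.step {Z : BY n} (m : Model Z W G) {lam : Fin n → ℂ} (R : GLRep n lam) :
    Model (Z.box (rmat R) (rpos R)) (W ⊗[ℂ] R.V) (Gs G R) where
  Ψ := tEq R m.Ψ
  int x i j w := tEq_int R Z.π Z.Y m.Ψ m.int x i j w

/-- The model of the trivial module. -/
noncomputable def Model.base (n : ℕ) : Model (BY.one n) ℂ (fun _ i j => if i = j then 1 else 0) where
  Ψ := LinearEquiv.refl ℂ ℂ
  int x i j w := by
    change (if i = j then (1 : Module.End ℂ ℂ) else 0) w = π0 (if i = j then 1 else 0 : ℂ) w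
    split_ifs
    · rw [map_one]
    · rw [map_zero]

noncomputable def G1 {lam : Fin n → ℂ} (A : GLRep n lam) (x : ℂ) (i j : Fin n) : Module.End ℂ A.V :=
  (if i = j then x • 1 else 0) + A.E i j

noncomputable def Model.one {lam : Fin n → ℂ} (A : GLRep n lam) : Model (prodL [hlp A]) A.V (G1 A) :=
  ((Model.base n).step A).congr (TensorProduct.lid ℂ A.V).symm (by
    intro x i j w
    simp only [G1, Gs, TensorProduct.lid_symm_apply, LinearMap.add_apply, LinearMap.smul_apply, LinearMap.sum_apply,
      TensorProduct.map_tmul, LinearMap.id_apply]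
    rw [Finset.sum_eq_single i]
    · by_cases h : i = j <;> simp [h, TensorProduct.tmul_add]
    · intro a _ ha
      simp [Ne.symm ha]
    · simp)

noncomputable def Model.two {lam mu : Fin n → ℂ} (A : GLRep n lam) (B : GLRep n mu) :
    Model (prodL [hlp B, hlp A]) (A.V ⊗[ℂ] B.V) (Gs (G1 A) B) :=
  (Model.one A).step B

theorem Gs_G1 {lam mu : Fin n → ℂ} (A : GLRep n lam) (B : GLRep n mu) (x : ℂ) (i j : Fin n) (w : A.V ⊗[ℂ] B.V) :
    Gs (G1 A) B x i j w = (if i = j then x ^ 2 • w else 0) + x • t1 A B i j w + t2 A B i j w := by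
  induction w with
  | zero => simp
  | add u v hu hv =>
    simp only [map_add, hu, hv, smul_add]
    split_ifs <;> (try rw [smul_add]) <;> abel
  | tmul u v =>
    simp only [Gs, G1, t1, t2, LinearMap.add_apply, LinearMap.smul_apply, LinearMap.sum_apply,
      TensorProduct.map_tmul, LinearMap.id_apply, TensorProduct.add_tmul, Finset.sum_add_distrib, smul_add]
    have e : ∑ a, ((if i = a then x • (1 : Module.End ℂ A.V) else 0) u) ⊗ₜ[ℂ] (B.E a j v) = x • u ⊗ₜ[ℂ] (B.E i j v) := by
      rw [Finset.sum_eq_single i]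
      · simp [TensorProduct.smul_tmul']
      · intro a _ ha
        simp [Ne.symm ha]
      · simp
    rw [e]
    have e2 : x • (((if i = j then x • (1 : Module.End ℂ A.V) else 0) u) ⊗ₜ[ℂ] v) = if i = j then x ^ 2 • u ⊗ₜ[ℂ] v else 0 := by
      split_ifs
      · simp [TensorProduct.smul_tmul', smul_smul, sq]
      · simp
    rw [e2]
    abel

theorem irred2_iff {lam mu : Fin n → ℂ} (A : GLRep n lam) (B : GLRep n mu) :
    YangianIrred2 A B ↔ (prodL [hlp B, hlp A]).Irr := by
  rw [(Model.two A B).irr_iff]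
  constructor
  · intro h U hU
    have key : ∀ i j, ∀ v ∈ U, t2 A B i j v ∈ U ∧ t1 A B i j v ∈ U := by
      intro i j v hv
      have := coeff_mem U 3 (fun r => if r = 0 then t2 A B i j v else if r = 1 then t1 A B i j v else if i = j then v else 0) (by
        intro x
        have h1 := hU x i j v hv
        rw [Gs_G1] at h1
        simp only [Finset.sum_range_succ, Finset.sum_range_zero]
        have e : (if i = j then x ^ 2 • v else 0) = x ^ 2 • if i = j then v else 0 := by split_ifs <;> simp
        rw [e] at h1
        simp only [if_true, pow_zero, pow_one, one_smul, one_ne_zero, if_false, zero_add]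
        norm_num
        convert h1 using 1
        simp only [smul_ite, smul_zero]
        abel)
      exact ⟨this 0 (by norm_num), this 1 (by norm_num)⟩
    exact h U (fun i j v hv => (key i j v hv).2) (fun i j v hv => (key i j v hv).1)
  · intro h U h1 h2
    refine h U fun x i j v hv => ?_
    rw [Gs_G1]
    refine U.add_mem (U.add_mem ?_ (U.smul_mem _ (h1 i j v hv))) (h2 i j v hv)
    split_ifs
    · exact U.smul_mem _ hv
    · exact U.zero_mem

end model
end YG

namespace YG
open scoped TensorProduct

section multi
variable {n k : ℕ}

/-- Splitting off the last factor. -/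
noncomputable def lastEq {k : ℕ} (V : Fin (k + 1) → Type) [∀ i, AddCommGroup (V i)] [∀ i, Module ℂ (V i)] :
    (⨂[ℂ] i, V i) ≃ₗ[ℂ] (⨂[ℂ] i : Fin k, V i.castSucc) ⊗[ℂ] V (Fin.last k) :=
  LinearEquiv.ofLinear
    (PiTensorProduct.lift (MultilinearMap.uncurryRight
      ((TensorProduct.mk ℂ (⨂[ℂ] i : Fin k, V i.castSucc) (V (Fin.last k))).compMultilinearMap (PiTensorProduct.tprod ℂ))))
    (TensorProduct.lift (PiTensorProduct.lift (MultilinearMap.curryRight (PiTensorProduct.tprod ℂ))))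
    (by
      refine TensorProduct.ext (PiTensorProduct.ext (MultilinearMap.ext fun u => LinearMap.ext fun v => ?_))
      simp)
    (by
      refine PiTensorProduct.ext (MultilinearMap.ext fun u => ?_)
      simp)

theorem lastEq_tprod (V : Fin (k + 1) → Type) [∀ i, AddCommGroup (V i)] [∀ i, Module ℂ (V i)] (v : ∀ i, V i) :
    lastEq V (PiTensorProduct.tprod ℂ v) = (PiTensorProduct.tprod ℂ fun i : Fin k => v i.castSucc) ⊗ₜ[ℂ] v (Fin.last k) := by
  simp [lastEq]
  rfl

variable {lam : Fin k → Fin n → ℂ}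

/-- One factor of the summand of `tMulti`. -/
noncomputable def opP (M : ∀ p : Fin k, GLRep n (lam p)) {r : ℕ} (p : Fin r → Fin k) (a : Fin (r + 1) → Fin n) (q : Fin k) :
    (M q).V →ₗ[ℂ] (M q).V :=
  if h : ∃ s : Fin r, p s = q then (M q).E (a h.choose.castSucc) (a h.choose.succ) else LinearMap.id

theorem opP_of {M : ∀ p : Fin k, GLRep n (lam p)} {r : ℕ} {p : Fin r → Fin k} (hp : Function.Injective p)
    (a : Fin (r + 1) → Fin n) {q : Fin k} {s : Fin r} (h : p s = q) : opP M p a q = (M q).E (a s.castSucc) (a s.succ) := by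
  have h1 : ∃ s : Fin r, p s = q := ⟨s, h⟩
  rw [opP, dif_pos h1, hp (h1.choose_spec.trans h.symm)]

theorem opP_not {M : ∀ p : Fin k, GLRep n (lam p)} {r : ℕ} {p : Fin r → Fin k}
    (a : Fin (r + 1) → Fin n) {q : Fin k} (h : ¬ ∃ s, p s = q) : opP M p a q = LinearMap.id := by
  rw [opP, dif_neg h]

theorem tMulti_tprod (M : ∀ p : Fin k, GLRep n (lam p)) (r : ℕ) (i j : Fin n) (v : ∀ p, (M p).V) :
    tMulti M r i j (PiTensorProduct.tprod ℂ v) = ∑ p : {p : Fin r → Fin k // StrictMono p},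
      ∑ a : {g : Fin (r + 1) → Fin n // g 0 = i ∧ g (Fin.last r) = j},
        PiTensorProduct.tprod ℂ fun q => opP M p.1 a.1 q (v q) := by
  rw [tMulti, LinearMap.sum_apply]
  refine Finset.sum_congr rfl fun p _ => ?_
  rw [LinearMap.sum_apply]
  refine Finset.sum_congr rfl fun a _ => ?_
  rw [PiTensorProduct.map_tprod]
  rfl

theorem tMulti_zero (M : ∀ p : Fin k, GLRep n (lam p)) (i j : Fin n) : tMulti M 0 i j = if i = j then 1 else 0 := by
  refine PiTensorProduct.ext (MultilinearMap.ext fun v => ?_)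
  rw [LinearMap.compMultilinearMap_apply, LinearMap.compMultilinearMap_apply, tMulti_tprod]
  have hu : Unique {p : Fin 0 → Fin k // StrictMono p} := ⟨⟨⟨Fin.elim0, fun a => a.elim0⟩⟩, fun p => Subtype.ext (funext fun a => a.elim0)⟩
  rw [Fintype.sum_unique]
  have e : ∀ a : {g : Fin (0 + 1) → Fin n // g 0 = i ∧ g (Fin.last 0) = j},
      (PiTensorProduct.tprod ℂ fun q => opP M (hu.default).1 a.1 q (v q)) = PiTensorProduct.tprod ℂ v := by
    intro a
    refine congrArg _ (funext fun q => ?_)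
    rw [opP_not _ (by rintro ⟨s, _⟩; exact s.elim0)]; rfl
  rw [Finset.sum_congr rfl fun a _ => e a]
  split_ifs with h
  · have : Unique {g : Fin (0 + 1) → Fin n // g 0 = i ∧ g (Fin.last 0) = j} :=
      ⟨⟨⟨fun _ => i, rfl, h⟩⟩, fun g => Subtype.ext (funext fun a => by
        have : a = 0 := Fin.ext (Nat.lt_one_iff.1 a.2)
        subst this; exact g.2.1)⟩
    rw [Fintype.sum_unique]; rfl
  · have : IsEmpty {g : Fin (0 + 1) → Fin n // g 0 = i ∧ g (Fin.last 0) = j} :=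
      ⟨fun g => h (g.2.1.symm.trans g.2.2)⟩
    rw [Finset.univ_eq_empty, Finset.sum_empty]; rfl

theorem tMulti_gt (M : ∀ p : Fin k, GLRep n (lam p)) {r : ℕ} (hr : k < r) (i j : Fin n) : tMulti M r i j = 0 := by
  have : IsEmpty {p : Fin r → Fin k // StrictMono p} := ⟨fun p => by
    have := Fintype.card_le_of_injective _ p.2.injective
    simp at this
    omega⟩
  rw [tMulti, Finset.univ_eq_empty, Finset.sum_empty]

/-- Splitting of strictly increasing maps. -/
noncomputable def splP (r k : ℕ) : {p : Fin (r + 1) → Fin k // StrictMono p} ⊕ {p : Fin r → Fin k // StrictMono p} →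
    {p : Fin (r + 1) → Fin (k + 1) // StrictMono p} :=
  Sum.elim (fun p => ⟨fun s => (p.1 s).castSucc, fun a b h => Fin.castSucc_lt_castSucc_iff.2 (p.2 h)⟩)
    (fun p => ⟨Fin.snoc (α := fun _ => Fin (k + 1)) (fun s => (p.1 s).castSucc) (Fin.last k), by
      intro a b h
      induction b using Fin.lastCases with
      | last =>
        induction a using Fin.lastCases with
        | last => exact absurd h (lt_irrefl _)
        | cast a => simp [Fin.castSucc_lt_last]
      | cast b =>
        induction a using Fin.lastCases with
        | last => exact absurd h (by simp [Fin.le_last])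
        | cast a =>
          simp only [Fin.snoc_castSucc]
          exact Fin.castSucc_lt_castSucc_iff.2 (p.2 (Fin.castSucc_lt_castSucc_iff.1 h))⟩)

theorem splP_bij (r k : ℕ) : Function.Bijective (splP r k) := by
  constructor
  · rintro (p | p) (p' | p') h
    · congr 1
      refine Subtype.ext (funext fun s => ?_)
      have := congrFun (congrArg Subtype.val h) s
      exact Fin.castSucc_injective _ this
    · exfalso
      have := congrFun (congrArg Subtype.val h) (Fin.last r)
      simp only [splP, Sum.elim_inl, Sum.elim_inr, Fin.snoc_last] at this
      exact (Fin.castSucc_lt_last _).ne this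
    · exfalso
      have := congrFun (congrArg Subtype.val h) (Fin.last r)
      simp only [splP, Sum.elim_inl, Sum.elim_inr, Fin.snoc_last] at this
      exact (Fin.castSucc_lt_last _).ne this.symm
    · congr 1
      refine Subtype.ext (funext fun s => ?_)
      have := congrFun (congrArg Subtype.val h) s.castSucc
      simp only [splP, Sum.elim_inl, Sum.elim_inr, Fin.snoc_castSucc] at this
      exact Fin.castSucc_injective _ this
  · intro p
    have hlt : ∀ s : Fin (r + 1), s < Fin.last r → p.1 s ≠ Fin.last k := fun s hs =>
      ((p.2 hs).trans_le (Fin.le_last _)).ne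
    by_cases h : p.1 (Fin.last r) = Fin.last k
    · refine ⟨Sum.inr ⟨fun s => (p.1 s.castSucc).castPred (hlt _ (Fin.castSucc_lt_last s)), fun a b hab => ?_⟩, ?_⟩
      · exact Fin.castPred_lt_castPred_iff.2 (p.2 (Fin.castSucc_lt_castSucc_iff.2 hab))
      · refine Subtype.ext (funext fun s => ?_)
        induction s using Fin.lastCases with
        | last => simp [splP, h]
        | cast s => simp [splP]
    · have h' : ∀ s, p.1 s ≠ Fin.last k := fun s => by
        rcases (Fin.le_last s).eq_or_lt with e | e
        · rw [e]; exact h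
        · exact hlt s e
      refine ⟨Sum.inl ⟨fun s => (p.1 s).castPred (h' s), fun a b hab => ?_⟩, ?_⟩
      · exact Fin.castPred_lt_castPred_iff.2 (p.2 hab)
      · refine Subtype.ext (funext fun s => ?_)
        simp [splP]

/-- Splitting of index sequences. -/
noncomputable def splA (r : ℕ) (i j : Fin n) : (Σ b : Fin n, {g : Fin (r + 1) → Fin n // g 0 = i ∧ g (Fin.last r) = b}) →
    {g : Fin (r + 1 + 1) → Fin n // g 0 = i ∧ g (Fin.last (r + 1)) = j} :=
  fun g => ⟨Fin.snoc (α := fun _ => Fin n) g.2.1 j, by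
    refine ⟨?_, by simp⟩
    have : (0 : Fin (r + 1 + 1)) = (0 : Fin (r + 1)).castSucc := rfl
    rw [this, Fin.snoc_castSucc]; exact g.2.2.1⟩

theorem splA_bij (r : ℕ) (i j : Fin n) : Function.Bijective (splA r i j) := by
  constructor
  · rintro ⟨b, g, hg1, hg2⟩ ⟨b', g', hg1', hg2'⟩ h
    have e : g = g' := funext fun s => by
      have := congrFun (congrArg Subtype.val h) s.castSucc
      simpa [splA] using this
    subst e
    subst hg2
    subst hg2'
    rfl
  · intro g
    refine ⟨⟨g.1 (Fin.last r).castSucc, fun s => g.1 s.castSucc, g.2.1, rfl⟩, Subtype.ext (funext fun s => ?_)⟩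
    induction s using Fin.lastCases with
    | last => simp [splA, g.2.2]
    | cast s => simp [splA]

theorem snoc_inj {r k : ℕ} (p : {p : Fin r → Fin k // StrictMono p}) :
    Function.Injective (splP r k (Sum.inr p)).1 := (splP r k (Sum.inr p)).2.injective

variable {lam' : Fin (k + 1) → Fin n → ℂ}

theorem opP_inl_last (M : ∀ p : Fin (k + 1), GLRep n (lam' p)) {r : ℕ} (p : {p : Fin (r + 1) → Fin k // StrictMono p})
    (a : Fin (r + 1 + 1) → Fin n) : opP M (splP r k (Sum.inl p)).1 a (Fin.last k) = LinearMap.id := by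
  refine opP_not _ ?_
  rintro ⟨s, h⟩
  exact (Fin.castSucc_lt_last _).ne h

theorem opP_inl_cast (M : ∀ p : Fin (k + 1), GLRep n (lam' p)) {r : ℕ} (p : {p : Fin (r + 1) → Fin k // StrictMono p})
    (a : Fin (r + 1 + 1) → Fin n) (q : Fin k) :
    opP M (splP r k (Sum.inl p)).1 a q.castSucc = opP (fun q : Fin k => M q.castSucc) p.1 a q := by
  by_cases h : ∃ s, p.1 s = q
  · obtain ⟨s, hs⟩ := h
    rw [opP_of p.2.injective a hs]
    exact opP_of (splP r k (Sum.inl p)).2.injective a (congrArg Fin.castSucc hs)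
  · rw [opP_not _ h]
    refine opP_not _ ?_
    rintro ⟨s, hs⟩
    exact h ⟨s, Fin.castSucc_injective _ hs⟩

theorem opP_inr_last (M : ∀ p : Fin (k + 1), GLRep n (lam' p)) {r : ℕ} (p : {p : Fin r → Fin k // StrictMono p})
    {i j : Fin n} (g : Σ b : Fin n, {g : Fin (r + 1) → Fin n // g 0 = i ∧ g (Fin.last r) = b}) :
    opP M (splP r k (Sum.inr p)).1 (splA r i j g).1 (Fin.last k) = (M (Fin.last k)).E g.1 j := by
  rw [opP_of (snoc_inj p) _ (s := Fin.last r) (by simp [splP])]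
  congr 1
  · simp [splA, g.2.2.2]
  · simp [splA]

theorem opP_inr_cast (M : ∀ p : Fin (k + 1), GLRep n (lam' p)) {r : ℕ} (p : {p : Fin r → Fin k // StrictMono p})
    {i j : Fin n} (g : Σ b : Fin n, {g : Fin (r + 1) → Fin n // g 0 = i ∧ g (Fin.last r) = b}) (q : Fin k) :
    opP M (splP r k (Sum.inr p)).1 (splA r i j g).1 q.castSucc = opP (fun q : Fin k => M q.castSucc) p.1 g.2.1 q := by
  by_cases h : ∃ s, p.1 s = q
  · obtain ⟨s, hs⟩ := h
    rw [opP_of p.2.injective _ hs, opP_of (snoc_inj p) _ (s := s.castSucc) (q := q.castSucc) (by simp [splP, hs])]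
    congr 1
    · simp [splA]
    · simp only [splA]
      rw [Fin.succ_castSucc, Fin.snoc_castSucc]
  · rw [opP_not _ h]
    refine opP_not _ ?_
    rintro ⟨s, hs⟩
    induction s using Fin.lastCases with
    | last =>
      simp only [splP, Sum.elim_inr, Fin.snoc_last] at hs
      exact (Fin.castSucc_lt_last _).ne hs.symm
    | cast s =>
      simp only [splP, Sum.elim_inr, Fin.snoc_castSucc] at hs
      exact h ⟨s, Fin.castSucc_injective _ hs⟩

/-- The recurrence for `tMulti`. -/
theorem tMulti_rec (M : ∀ p : Fin (k + 1), GLRep n (lam' p)) (r : ℕ) (i j : Fin n) (w : ⨂[ℂ] p, (M p).V) :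
    lastEq (fun p => (M p).V) (tMulti M (r + 1) i j w)
      = TensorProduct.map (tMulti (fun q : Fin k => M q.castSucc) (r + 1) i j) LinearMap.id (lastEq (fun p => (M p).V) w)
        + ∑ a, TensorProduct.map (tMulti (fun q : Fin k => M q.castSucc) r i a) ((M (Fin.last k)).E a j)
          (lastEq (fun p => (M p).V) w) := by
  suffices h : (lastEq (fun p => (M p).V)).toLinearMap ∘ₗ tMulti M (r + 1) i j
      = (TensorProduct.map (tMulti (fun q : Fin k => M q.castSucc) (r + 1) i j) LinearMap.id
        + ∑ a, TensorProduct.map (tMulti (fun q : Fin k => M q.castSucc) r i a) ((M (Fin.last k)).E a j))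
        ∘ₗ (lastEq (fun p => (M p).V)).toLinearMap by
    have := LinearMap.congr_fun h w
    rw [LinearMap.comp_apply, LinearMap.comp_apply, LinearMap.add_apply, LinearMap.sum_apply] at this
    exact this
  refine PiTensorProduct.ext (MultilinearMap.ext fun v => ?_)
  rw [LinearMap.compMultilinearMap_apply, LinearMap.compMultilinearMap_apply, LinearMap.comp_apply, LinearMap.comp_apply,
    LinearMap.add_apply, LinearMap.sum_apply, tMulti_tprod]
  have e1 : ∀ v : ∀ p, (M p).V, (lastEq (fun p => (M p).V)).toLinearMap (PiTensorProduct.tprod ℂ v)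
    = (PiTensorProduct.tprod ℂ fun i : Fin k => v i.castSucc) ⊗ₜ[ℂ] v (Fin.last k) := fun v => lastEq_tprod _ v
  rw [e1, TensorProduct.map_tmul]
  simp only [TensorProduct.map_tmul]
  rw [← Fintype.sum_bijective _ (splP_bij r k) _ _ (fun _ => rfl), Fintype.sum_sum_type, map_add]
  congr 1
  · rw [tMulti_tprod]
    simp only [map_sum, TensorProduct.sum_tmul]
    refine Finset.sum_congr rfl fun p _ => Finset.sum_congr rfl fun a _ => ?_
    rw [e1, opP_inl_last]
    simp only [opP_inl_cast]
  · simp only [tMulti_tprod, map_sum, TensorProduct.sum_tmul]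
    rw [Finset.sum_comm (s := (Finset.univ : Finset (Fin n)))]
    refine Finset.sum_congr rfl fun p _ => ?_
    rw [← Fintype.sum_bijective _ (splA_bij r i j) _ _ (fun _ => rfl), Fintype.sum_sigma]
    refine Finset.sum_congr rfl fun b _ => Finset.sum_congr rfl fun g _ => ?_
    rw [e1, opP_inr_last]
    simp only [opP_inr_cast]

/-- The generating function. -/
noncomputable def GM (M : ∀ p : Fin k, GLRep n (lam p)) (x : ℂ) (i j : Fin n) : Module.End ℂ (⨂[ℂ] p, (M p).V) :=
  ∑ r ∈ Finset.range (k + 1), x ^ (k - r) • tMulti M r i j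

theorem GM_zero (M : ∀ p : Fin k, GLRep n (lam p)) (x : ℂ) (i j : Fin n) :
    x • GM M x i j = ∑ r ∈ Finset.range (k + 1), x ^ (k - r) • tMulti M (r + 1) i j + x ^ (k + 1) • tMulti M 0 i j := by
  have h : ∑ r ∈ Finset.range (k + 1 + 1), x ^ (k + 1 - r) • tMulti M r i j = x • GM M x i j := by
    rw [Finset.sum_range_succ, tMulti_gt M (Nat.lt_succ_self k), smul_zero, add_zero, GM, Finset.smul_sum]
    refine Finset.sum_congr rfl fun r hr => ?_
    rw [smul_smul, ← pow_succ', Nat.sub_add_comm (by have := Finset.mem_range.1 hr; omega)]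
  rw [← h, Finset.sum_range_succ']
  simp

theorem GM_rec (M : ∀ p : Fin (k + 1), GLRep n (lam' p)) (x : ℂ) (i j : Fin n) (w : ⨂[ℂ] p, (M p).V) :
    lastEq (fun p => (M p).V) (GM M x i j w)
      = Gs (GM fun q : Fin k => M q.castSucc) (M (Fin.last k)) x i j (lastEq (fun p => (M p).V) w) := by
  have e : ∀ (c : ℂ) (f : Module.End ℂ (⨂[ℂ] q : Fin k, (M q.castSucc).V)) (g : Module.End ℂ (M (Fin.last k)).V),
    TensorProduct.map (c • f) g = c • TensorProduct.map f g := fun c f g => TensorProduct.map_smul_left c f g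
  have es : ∀ (N : ℕ) (f : ℕ → Module.End ℂ (⨂[ℂ] q : Fin k, (M q.castSucc).V)) (g : Module.End ℂ (M (Fin.last k)).V),
    TensorProduct.map (∑ r ∈ Finset.range N, f r) g = ∑ r ∈ Finset.range N, TensorProduct.map (f r) g := by
    intro N f g
    induction N with
    | zero => simp
    | succ N ih => rw [Finset.sum_range_succ, Finset.sum_range_succ, TensorProduct.map_add_left, ih]
  rw [Gs, ← e, GM_zero, TensorProduct.map_add_left, es, e]
  have h0 : ∑ a, TensorProduct.map (GM (fun q : Fin k => M q.castSucc) x i a) ((M (Fin.last k)).E a j)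
      = ∑ r ∈ Finset.range (k + 1), x ^ (k - r) •
        ∑ a, TensorProduct.map (tMulti (fun q : Fin k => M q.castSucc) r i a) ((M (Fin.last k)).E a j) := by
    simp only [GM, es, e, Finset.smul_sum]
    rw [Finset.sum_comm]
  rw [h0, GM, Finset.sum_range_succ', LinearMap.add_apply, LinearMap.sum_apply, map_add, map_sum]
  simp only [LinearMap.add_apply, LinearMap.sum_apply, LinearMap.smul_apply, map_smul, tMulti_rec, e, Nat.add_sub_add_right,
    smul_add, Finset.sum_add_distrib]
  rw [add_right_comm]
  congr 2
  rw [Nat.sub_zero]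
  congr 1
  rw [tMulti_zero, tMulti_zero]
  split_ifs
  · exact (LinearMap.congr_fun TensorProduct.map_id _).symm
  · rw [TensorProduct.map_zero_left]; simp

end multi

section fin
variable {n : ℕ}

/-- The list of helpers, in reversed order. -/
noncomputable def lst : ∀ {k : ℕ} {lam : Fin k → Fin n → ℂ} (M : ∀ p : Fin k, GLRep n (lam p)), List (Helper n)
  | 0, _, _ => []
  | _ + 1, _, M => hlp (M (Fin.last _)) :: lst (fun q => M q.castSucc)

theorem lst_pairwise (P : Helper n → Helper n → Prop) : ∀ {k : ℕ} {lam : Fin k → Fin n → ℂ} (M : ∀ p : Fin k, GLRep n (lam p)),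
    (∀ h, h ∈ lst M ↔ ∃ p, h = hlp (M p)) ∧ ((lst M).Pairwise P ↔ ∀ p q : Fin k, p < q → P (hlp (M q)) (hlp (M p)))
  | 0, _, M => ⟨by simp [lst], by simp [lst]⟩
  | k + 1, lam, M => by
    obtain ⟨h1, h2⟩ := lst_pairwise P (fun q : Fin k => M q.castSucc)
    constructor
    · intro h
      rw [lst, List.mem_cons, h1]
      constructor
      · rintro (h | ⟨p, h⟩)
        · exact ⟨_, h⟩
        · exact ⟨_, h⟩
      · rintro ⟨p, h⟩
        induction p using Fin.lastCases with
        | last => exact Or.inl h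
        | cast p => exact Or.inr ⟨p, h⟩
    · rw [lst, List.pairwise_cons, h2]
      constructor
      · rintro ⟨ha, hb⟩ p q hpq
        induction q using Fin.lastCases with
        | last =>
          induction p using Fin.lastCases with
          | last => exact absurd hpq (lt_irrefl _)
          | cast p => exact ha _ ((h1 _).2 ⟨p, rfl⟩)
        | cast q =>
          induction p using Fin.lastCases with
          | last => exact absurd hpq (Fin.le_last _).not_gt
          | cast p => exact hb p q (Fin.castSucc_lt_castSucc_iff.1 hpq)
      · intro h
        refine ⟨fun a ha => ?_, fun p q hpq => h _ _ (Fin.castSucc_lt_castSucc_iff.2 hpq)⟩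
        obtain ⟨p, rfl⟩ := (h1 _).1 ha
        exact h _ _ (Fin.castSucc_lt_last p)

theorem model_multi : ∀ {k : ℕ} {lam : Fin k → Fin n → ℂ} (M : ∀ p : Fin k, GLRep n (lam p)),
    Nonempty (Model (prodL (lst M)) (⨂[ℂ] p, (M p).V) (GM M))
  | 0, lam, M => ⟨(Model.base n).congr (PiTensorProduct.isEmptyEquiv (Fin 0)) (by
      intro x i j w
      rw [GM, Finset.sum_range_one, pow_zero, one_smul, tMulti_zero]
      split_ifs
      · rfl
      · simp)⟩
  | k + 1, lam, M => by
    obtain ⟨m⟩ := model_multi (fun q : Fin k => M q.castSucc)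
    exact ⟨(m.step (M (Fin.last k))).congr (lastEq fun p => (M p).V) (GM_rec M)⟩

theorem irredMulti_iff {k : ℕ} {lam : Fin k → Fin n → ℂ} (M : ∀ p : Fin k, GLRep n (lam p)) :
    YangianIrredMulti M ↔ (prodL (lst M)).Irr := by
  obtain ⟨m⟩ := model_multi M
  rw [m.irr_iff]
  constructor
  · intro h U hU
    refine h U fun r hr i j v hv => ?_
    by_cases hk : r ≤ k
    · have := coeff_mem U (k + 1) (fun s => tMulti M (k - s) i j v) (by
        intro x
        have h1 := hU x i j v hv
        rw [GM, LinearMap.sum_apply, ← Finset.sum_range_reflect] at h1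
        convert h1 using 1
        refine Finset.sum_congr rfl fun s hs => ?_
        have hs' := Finset.mem_range.1 hs
        rw [LinearMap.smul_apply]
        have e1 : k + 1 - 1 - s = k - s := by omega
        have e2 : k - (k - s) = s := by omega
        rw [e1, e2]) (k - r) (by omega)
      beta_reduce at this
      rwa [Nat.sub_sub_self hk] at this
    · rw [tMulti_gt M (by omega)]
      exact U.zero_mem
  · intro h U hU
    refine h U fun x i j v hv => ?_
    rw [GM, LinearMap.sum_apply]
    refine U.sum_mem fun r _ => U.smul_mem _ ?_
    rcases r with _ | r
    · rw [tMulti_zero]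
      split_ifs
      · exact hv
      · exact U.zero_mem
    · exact hU _ (by omega) i j v hv

end fin
end YG

/-- The `Y(gl_n)`-module `L(λ^{(1)}) ⊗ ⋯ ⊗ L(λ^{(k)})` is
irreducible if and only if all the modules `L(λ^{(p)}) ⊗ L(λ^{(q)})` with
`p < q` are irreducible. -/
theorem tensorMulti_irreducible_iff_pairwise
    (k n : ℕ) (lam : Fin k → Fin n → ℂ)
    (hlam : ∀ p : Fin k, IsGLHighestWeight n (lam p))
    (M : ∀ p : Fin k, GLRep n (lam p)) :
    YangianIrredMulti M ↔
      ∀ p q : Fin k, p < q → YangianIrred2 (M p) (M q) := by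
  rw [YG.irredMulti_iff, YG.irr_list, (YG.lst_pairwise _ M).2]
  exact forall_congr' fun p => forall_congr' fun q => imp_congr_right fun _ => (YG.irred2_iff (M p) (M q)).symm
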